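/- Let B ⊂ ℝ⁴ be a convex body such that all intersections of B with 3-dimensional linear subspaces of ℝ⁴ are linearly equivalent to one another. Then B is an ellipsoid centered at 0. -/

import Mathlib

open Filter Topology

/-- Two subsets `A`, `B` of a real vector space are *linearly equivalent* if there is a
linear bijection `L` from the linear span of `A` to the linear span of `B` with `L(A) = B`. -/
def LinearlyEquivalent {V : Type*} [AddCommGroup V] [Module ℝ V] (A B : Set V) : Prop :=
  ∃ L : (Submodule.span ℝ A) ≃ₗ[ℝ] (Submodule.span ℝ B),
    (fun x : Submodule.span ℝ A => (L x : V)) '' {x | (x : V) ∈ A} = B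

/-- A set is an *ellipsoid centered at `0`* if it is the unit ball of an inner-product norm,
i.e. the set `{x | f x x ≤ 1}` for a symmetric positive definite bilinear form `f`. -/
def IsEllipsoid {X : Type*} [AddCommGroup X] [Module ℝ X] (K : Set X) : Prop :=
  ∃ f : X →ₗ[ℝ] X →ₗ[ℝ] ℝ, (∀ x y, f x y = f y x) ∧ (∀ x, x ≠ 0 → 0 < f x x) ∧
    K = {x | f x x ≤ 1}


/-- A (possibly asymmetric) norm on a real normed space. -/
structure SL {V : Type*} [NormedAddCommGroup V] [NormedSpace ℝ V] (F : V → ℝ) : Prop where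
  add : ∀ x y, F (x + y) ≤ F x + F y
  smul : ∀ (t : ℝ) x, 0 ≤ t → F (t • x) = t * F x
  pos : ∀ x, x ≠ 0 → 0 < F x
  cont : Continuous F

/-- `p` is a subgradient of `F` at `x`. -/
def IsSub {V : Type*} [NormedAddCommGroup V] [NormedSpace ℝ V] (F : V → ℝ) (x : V)
    (p : V →L[ℝ] ℝ) : Prop := ∀ y, F x + p (y - x) ≤ F y

section basics
variable {V : Type*} [NormedAddCommGroup V] [NormedSpace ℝ V] {F : V → ℝ}

theorem SL.zero (h : SL F) : F 0 = 0 := by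
  have := h.smul 0 0 le_rfl
  simpa using this

theorem SL.nonneg (h : SL F) (x : V) : 0 ≤ F x := by
  by_cases hx : x = 0
  · rw [hx, h.zero]
  · exact (h.pos x hx).le

theorem SL.sub_le (h : SL F) (x y : V) : F x - F y ≤ F (x - y) := by
  have := h.add (x - y) y
  simp only [sub_add_cancel] at this
  linarith

theorem SL.lower [FiniteDimensional ℝ V] (h : SL F) : ∃ c > 0, ∀ x, c * ‖x‖ ≤ F x := by
  have : ProperSpace V := FiniteDimensional.proper ℝ V
  by_cases hne : (Metric.sphere (0 : V) 1).Nonempty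
  · obtain ⟨x0, hx0, hmin⟩ := (isCompact_sphere (0 : V) 1).exists_isMinOn hne h.cont.continuousOn
    have hx0' : ‖x0‖ = 1 := by simpa using hx0
    have hx0n : x0 ≠ 0 := by
      intro h0; rw [h0] at hx0'; simp at hx0'
    refine ⟨F x0, h.pos _ hx0n, fun x => ?_⟩
    by_cases hx : x = 0
    · simp [hx, h.zero]
    · have hn : 0 < ‖x‖ := norm_pos_iff.mpr hx
      have hmem : (‖x‖⁻¹ • x) ∈ Metric.sphere (0 : V) 1 := by
        simp [norm_smul, hn.ne']
      have h1 : F x0 ≤ F (‖x‖⁻¹ • x) := hmin hmem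
      rw [h.smul _ _ (by positivity)] at h1
      have h2 : ‖x‖ * (‖x‖⁻¹ * F x) = F x := by field_simp
      nlinarith
  · refine ⟨1, one_pos, fun x => ?_⟩
    have hx : x = 0 := by
      by_contra hx
      apply hne
      exact ⟨‖x‖⁻¹ • x, by simp [norm_smul, norm_ne_zero_iff.mpr hx]⟩
    simp [hx, h.zero]

theorem SL.upper [FiniteDimensional ℝ V] (h : SL F) : ∃ C > 0, ∀ x, F x ≤ C * ‖x‖ := by
  have : ProperSpace V := FiniteDimensional.proper ℝ V
  obtain ⟨C, hC⟩ := (isCompact_closedBall (0 : V) 1).bddAbove_image h.cont.continuousOn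
  refine ⟨max C 1, by positivity, fun x => ?_⟩
  by_cases hx : x = 0
  · simp [hx, h.zero]
  · have hn : 0 < ‖x‖ := norm_pos_iff.mpr hx
    have h1 : F (‖x‖⁻¹ • x) ≤ C := hC ⟨_, by simp [norm_smul, hn.ne'], rfl⟩
    rw [h.smul _ _ (by positivity)] at h1
    have h2 : ‖x‖ * (‖x‖⁻¹ * F x) = F x := by field_simp
    have h3 := le_max_left C 1
    nlinarith

theorem SL.comp {V' : Type*} [NormedAddCommGroup V'] [NormedSpace ℝ V'] (h : SL F)
    (S : V' →L[ℝ] V) (hS : Function.Injective S) : SL (fun x => F (S x)) where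
  add x y := by simpa using h.add (S x) (S y)
  smul t x ht := by simpa using h.smul t (S x) ht
  pos x hx := h.pos _ (by
    intro h0; exact hx (hS (by simpa using h0)))
  cont := h.cont.comp S.continuous

theorem IsSub.self (h : SL F) {x : V} {p : V →L[ℝ] ℝ} (hp : IsSub F x p) : p x = F x := by
  have h1 := hp ((2 : ℝ) • x)
  have h2 := hp 0
  rw [h.smul _ _ (by norm_num)] at h1
  rw [h.zero] at h2
  simp only [map_sub, map_smul, smul_eq_mul, map_zero] at h1 h2
  linarith

theorem IsSub.le (h : SL F) {x : V} {p : V →L[ℝ] ℝ} (hp : IsSub F x p) (y : V) : p y ≤ F y := by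
  have h1 := hp y
  rw [map_sub, hp.self h] at h1
  linarith

theorem IsSub.of_le (h : SL F) {x : V} {p : V →L[ℝ] ℝ} (h1 : p x = F x) (h2 : ∀ y, p y ≤ F y) :
    IsSub F x p := fun y => by
  rw [map_sub, h1]; linarith [h2 y]

theorem SL.sub_bound [FiniteDimensional ℝ V] (h : SL F) :
    ∃ C > 0, ∀ x p, IsSub F x p → ‖p‖ ≤ C := by
  obtain ⟨C, hC, hC2⟩ := h.upper
  refine ⟨C, hC, fun x p hp => ContinuousLinearMap.opNorm_le_bound _ hC.le fun y => ?_⟩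
  rw [Real.norm_eq_abs, abs_le]
  have h1 := (hp.le h (-y)).trans (hC2 (-y))
  have h2 := (hp.le h y).trans (hC2 y)
  simp only [map_neg, norm_neg] at h1
  constructor <;> linarith

theorem IsSub.closed (h : SL F) {x : ℕ → V} {p : ℕ → V →L[ℝ] ℝ} {x0 : V} {p0 : V →L[ℝ] ℝ}
    (hp : ∀ n, IsSub F (x n) (p n)) (hx : Tendsto x atTop (𝓝 x0)) (hpt : Tendsto p atTop (𝓝 p0)) :
    IsSub F x0 p0 := by
  intro y
  have h1 : Tendsto (fun n => F (x n) + p n (y - x n)) atTop (𝓝 (F x0 + p0 (y - x0))) := by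
    refine ((h.cont.tendsto x0).comp hx).add ?_
    have h2 : Tendsto (fun n => (p n, y - x n)) atTop (𝓝 (p0, y - x0)) :=
      hpt.prodMk_nhds (tendsto_const_nhds.sub hx)
    exact (isBoundedBilinearMap_apply.continuous.tendsto (p0, y - x0)).comp h2
  exact le_of_tendsto' h1 fun n => hp n y

/-- bounded subgradients along a convergent sequence have a convergent subsequence. -/
theorem SL.sub_subseq [FiniteDimensional ℝ V] (h : SL F) {x : ℕ → V} {p : ℕ → V →L[ℝ] ℝ} {x0 : V}
    (hp : ∀ n, IsSub F (x n) (p n)) (hx : Tendsto x atTop (𝓝 x0)) :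
    ∃ p0, IsSub F x0 p0 ∧ ∃ φ : ℕ → ℕ, StrictMono φ ∧ Tendsto (p ∘ φ) atTop (𝓝 p0) := by
  have : ProperSpace (V →L[ℝ] ℝ) := FiniteDimensional.proper ℝ _
  obtain ⟨C, hC, hC2⟩ := h.sub_bound
  obtain ⟨p0, -, φ, hφ, hlim⟩ := (isCompact_closedBall (0 : V →L[ℝ] ℝ) C).tendsto_subseq
    (x := p) (fun n => by simpa using hC2 _ _ (hp n))
  exact ⟨p0, IsSub.closed h (fun n => hp (φ n)) (hx.comp hφ.tendsto_atTop) hlim, φ, hφ, hlim⟩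

theorem SL.convex (h : SL F) : ConvexOn ℝ Set.univ F := by
  refine ⟨convex_univ, fun x _ y _ a b ha hb hab => ?_⟩
  have := h.add (a • x) (b • y)
  rwa [h.smul _ _ ha, h.smul _ _ hb] at this

theorem SL.sub_of_hasFDerivAt (h : SL F) {x : V} {p : V →L[ℝ] ℝ} (hp : HasFDerivAt F p x) :
    IsSub F x p := by
  intro y
  have h1 : HasDerivAt (fun t : ℝ => F (x + t • (y - x))) (p (y - x)) 0 := by
    have h2 : HasDerivAt (fun t : ℝ => x + t • (y - x)) (y - x) 0 := by
      simpa using ((hasDerivAt_id (0 : ℝ)).smul_const (y - x)).const_add x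
    have h3 : HasFDerivAt F p (x + (0 : ℝ) • (y - x)) := by simpa using hp
    exact h3.comp_hasDerivAt 0 h2
  have h4 := h1.tendsto_slope_zero_right
  refine le_of_sub_nonneg ?_
  have h5 : p (y - x) ≤ F y - F x := by
    refine le_of_tendsto h4 ?_
    have : Set.Ioc (0 : ℝ) 1 ∈ 𝓝[>] (0 : ℝ) := Ioc_mem_nhdsGT one_pos
    filter_upwards [this] with t ht
    have h6 : x + t • (y - x) = (1 - t) • x + t • y := by
      rw [smul_sub, sub_smul, one_smul]; abel
    have h7 := h.add ((1 - t) • x) (t • y)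
    rw [h.smul _ _ (by linarith [ht.2]), h.smul _ _ ht.1.le, ← h6] at h7
    simp only [zero_add, zero_smul, add_zero, smul_eq_mul]
    rw [inv_mul_le_iff₀ ht.1]
    nlinarith
  linarith

/-- If a subgradient selection kills the velocity of a `C^1` curve, `F` is constant along it. -/
theorem SL.flow_const [FiniteDimensional ℝ V] (h : SL F) {c v : ℝ → V}
    (hc : ∀ t, HasDerivAt c (v t) t) (hv : Continuous v)
    (hp : ∀ t, ∃ p, IsSub F (c t) p ∧ p (v t) = 0) (a b : ℝ) : F (c a) = F (c b) := by
  obtain ⟨C, hC, hC2⟩ := h.sub_bound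
  choose p hp1 hp2 using hp
  have hd : ∀ t, HasDerivAt (fun t => F (c t)) 0 t := by
    intro t
    rw [hasDerivAt_iff_isLittleO]
    simp only [smul_zero, sub_zero]
    rw [Asymptotics.isLittleO_iff]
    intro ε hε
    have hvc : Tendsto v (𝓝 t) (𝓝 (v t)) := hv.tendsto t
    have h1 := (hasDerivAt_iff_isLittleO.mp (hc t))
    rw [Asymptotics.isLittleO_iff] at h1
    have hε2 : 0 < ε / (2 * C) := by positivity
    filter_upwards [h1 hε2, Metric.tendsto_nhds.mp hvc _ hε2] with s hs hs2
    rw [dist_eq_norm] at hs2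
    have hCC : C * (ε / (2 * C)) = ε / 2 := by field_simp
    have hA : |p t (c s - c t - (s - t) • v t)| ≤ ε / 2 * ‖s - t‖ := by
      refine ((p t).le_opNorm _).trans ?_
      calc ‖p t‖ * ‖c s - c t - (s - t) • v t‖ ≤ C * (ε / (2 * C) * ‖s - t‖) := by
            gcongr; exact hC2 _ _ (hp1 t)
        _ = _ := by rw [← mul_assoc, hCC]
    have hB : |p s (c s - c t - (s - t) • v s)| ≤ ε * ‖s - t‖ := by
      have e : c s - c t - (s - t) • v s = (c s - c t - (s - t) • v t) - (s - t) • (v s - v t) := by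
        rw [smul_sub]; abel
      refine ((p s).le_opNorm _).trans ?_
      calc ‖p s‖ * ‖c s - c t - (s - t) • v s‖
          ≤ C * (ε / (2 * C) * ‖s - t‖ + ‖s - t‖ * (ε / (2 * C))) := by
            gcongr
            · exact hC2 _ _ (hp1 s)
            · rw [e]
              refine (norm_sub_le _ _).trans ?_
              rw [norm_smul]
              gcongr
        _ = ε * ‖s - t‖ := by
            have : C * (ε / (2 * C) * ‖s - t‖ + ‖s - t‖ * (ε / (2 * C))) =
              2 * (C * (ε / (2 * C))) * ‖s - t‖ := by ring
            rw [this, hCC]; ring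
    have i1 := hp1 t (c s)
    have i2 := hp1 s (c t)
    simp only [map_sub, map_smul, hp2, smul_zero, sub_zero] at i1 i2 hA hB
    rw [abs_le] at hA hB
    rw [Real.norm_eq_abs, abs_le]
    have : 0 ≤ ε * ‖s - t‖ := by positivity
    constructor <;> linarith
  exact is_const_of_deriv_eq_zero (fun t => (hd t).differentiableAt) (fun t => (hd t).deriv) a b

/-- Derivative zero along a field killed by subgradients. -/
theorem SL.deriv_field [FiniteDimensional ℝ V] (h : SL F) {Y : V → V} {x : V}
    (hY : DifferentiableAt ℝ Y x)
    (hp : ∀ x, ∃ p, IsSub F x p ∧ p (Y x) = 0) :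
    HasDerivAt (fun t : ℝ => F (x + t • Y x)) 0 0 := by
  obtain ⟨C, hC, hC2⟩ := h.sub_bound
  choose p hp1 hp2 using hp
  rw [hasDerivAt_iff_isLittleO]
  simp only [smul_zero, sub_zero, zero_smul, add_zero]
  rw [Asymptotics.isLittleO_iff]
  intro ε hε
  have hcont : ContinuousAt (fun t : ℝ => Y (x + t • Y x)) 0 := by
    have : ContinuousAt Y (x + (0 : ℝ) • Y x) := by simpa using hY.continuousAt
    exact ContinuousAt.comp (f := fun t : ℝ => x + t • Y x) this (by fun_prop)
  have hε2 : 0 < ε / C := by positivity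
  filter_upwards [Metric.tendsto_nhds.mp hcont _ hε2] with t ht
  rw [dist_eq_norm] at ht
  simp only [zero_smul, add_zero] at ht
  have i1 := hp1 x (x + t • Y x)
  have i2 := hp1 (x + t • Y x) x
  simp only [add_sub_cancel_left, map_smul, hp2, smul_zero, add_zero] at i1
  have e : x - (x + t • Y x) = - (t • Y x) := by abel
  rw [e, map_neg, map_smul, smul_eq_mul] at i2
  have i3 : |p (x + t • Y x) (Y (x + t • Y x) - Y x)| ≤ ε := by
    refine ((p _).le_opNorm _).trans ?_
    calc _ ≤ C * (ε / C) := by gcongr; exact hC2 _ _ (hp1 _)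
      _ = ε := by field_simp
  rw [map_sub, hp2, zero_sub, abs_neg] at i3
  rw [Real.norm_eq_abs, Real.norm_eq_abs, abs_of_nonneg (by linarith)]
  calc F (x + t • Y x) - F x ≤ t * p (x + t • Y x) (Y x) := by linarith
    _ ≤ |t * p (x + t • Y x) (Y x)| := le_abs_self _
    _ ≤ ε * |t| := by rw [abs_mul, mul_comm]; gcongr

/-- extremal principle -/
theorem SL.extremal [FiniteDimensional ℝ V] (h : SL F) {Y : V → V} {x : V}
    (hY : DifferentiableAt ℝ Y x)
    (hp : ∀ x, ∃ p, IsSub F x p ∧ p (Y x) = 0) {q : V → ℝ} {q' : V →L[ℝ] ℝ}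
    (hq : HasFDerivAt q q' x) (hx : x ≠ 0)
    (hext : IsExtrOn (fun y => q y * F x ^ 2 - q x * F y ^ 2) Set.univ x ∨
      IsLocalExtr (fun y => q y * F x ^ 2 - q x * F y ^ 2) x) : q' (Y x) = 0 := by
  have hl : IsLocalExtr (fun y => q y * F x ^ 2 - q x * F y ^ 2) x := by
    rcases hext with h1 | h1
    · exact h1.isLocalExtr univ_mem
    · exact h1
  have hcurve : ContinuousAt (fun t : ℝ => x + t • Y x) 0 := by fun_prop
  have h2 : IsLocalExtr (fun t : ℝ => q (x + t • Y x) * F x ^ 2 - q x * F (x + t • Y x) ^ 2) 0 := by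
    have ht : Tendsto (fun t : ℝ => x + t • Y x) (𝓝 0) (𝓝 x) := by
      have := hcurve.tendsto; simpa using this
    rcases hl with h1 | h1
    · left
      have := ht.eventually h1
      simpa [IsLocalMin, IsMinFilter] using this
    · right
      have := ht.eventually h1
      simpa [IsLocalMax, IsMaxFilter] using this
  have hd1 : HasDerivAt (fun t : ℝ => q (x + t • Y x)) (q' (Y x)) 0 := by
    have h2 : HasDerivAt (fun t : ℝ => x + t • Y x) (Y x) 0 := by
      simpa using ((hasDerivAt_id (0 : ℝ)).smul_const (Y x)).const_add x
    have h3 : HasFDerivAt q q' (x + (0 : ℝ) • Y x) := by simpa using hq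
    exact h3.comp_hasDerivAt 0 h2
  have hd2 := h.deriv_field hY hp
  have hd3 := (hd1.mul_const (F x ^ 2)).sub ((hd2.pow 2).const_mul (q x))
  have h5 := h2.hasDerivAt_eq_zero hd3
  have hF := h.pos x hx
  have : q' (Y x) * F x ^ 2 = 0 := by simpa using h5
  rcases mul_eq_zero.mp this with h6 | h6
  · exact h6
  · exact absurd h6 (by positivity)

end basics


abbrev V3 := ℝ × ℝ × ℝ

/-- linear functional from coordinates -/
noncomputable def fun3 (a b c : ℝ) : V3 →L[ℝ] ℝ :=
  a • ContinuousLinearMap.fst ℝ ℝ (ℝ × ℝ) +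
  b • (ContinuousLinearMap.fst ℝ ℝ ℝ).comp (ContinuousLinearMap.snd ℝ ℝ (ℝ × ℝ)) +
  c • (ContinuousLinearMap.snd ℝ ℝ ℝ).comp (ContinuousLinearMap.snd ℝ ℝ (ℝ × ℝ))

@[simp] theorem fun3_apply (a b c : ℝ) (x : V3) : fun3 a b c x = a * x.1 + b * x.2.1 + c * x.2.2 := by
  simp [fun3]

theorem clm3 (p : V3 →L[ℝ] ℝ) : p = fun3 (p (1,0,0)) (p (0,1,0)) (p (0,0,1)) := by
  refine ContinuousLinearMap.ext fun x => ?_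
  obtain ⟨x, y, z⟩ := x
  have e : ((x, y, z) : V3) = x • ((1, 0, 0) : V3) + y • ((0, 1, 0) : V3) + z • ((0, 0, 1) : V3) := by
    simp
  rw [fun3_apply, e, map_add, map_add, map_smul, map_smul, map_smul]
  simp [mul_comm]

theorem clm3_apply (p : V3 →L[ℝ] ℝ) (x : V3) :
    p x = p (1,0,0) * x.1 + p (0,1,0) * x.2.1 + p (0,0,1) * x.2.2 := by
  conv_lhs => rw [clm3 p]
  simp

def det3 (a b c : V3) : ℝ :=
  (a.2.1 * b.2.2 - a.2.2 * b.2.1) * c.1 + (a.2.2 * b.1 - a.1 * b.2.2) * c.2.1 +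
    (a.1 * b.2.1 - a.2.1 * b.1) * c.2.2

noncomputable def cross3 (a b : V3) : V3 →L[ℝ] ℝ :=
  fun3 (a.2.1 * b.2.2 - a.2.2 * b.2.1) (a.2.2 * b.1 - a.1 * b.2.2) (a.1 * b.2.1 - a.2.1 * b.1)

theorem cross3_apply (a b c : V3) : cross3 a b c = det3 a b c := by
  simp [cross3, det3]

theorem clm3_unique {a b x : V3} {p : V3 →L[ℝ] ℝ} (ha : p a = 0) (hb : p b = 0)
    (hd : det3 a b x ≠ 0) : p = (p x / det3 a b x) • cross3 a b := by
  rw [clm3_apply] at ha hb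
  have hx := clm3_apply p x
  set p1 := p (1,0,0)
  set p2 := p (0,1,0)
  set p3 := p (0,0,1)
  have key : ∀ y : V3, p y * det3 a b x = p x * det3 a b y := by
    intro y
    rw [clm3_apply p y, hx]
    change (p1 * y.1 + p2 * y.2.1 + p3 * y.2.2) * _ = _
    obtain ⟨a1, a2, a3⟩ := a
    obtain ⟨b1, b2, b3⟩ := b
    obtain ⟨x1, x2, x3⟩ := x
    obtain ⟨y1, y2, y3⟩ := y
    simp only [det3] at *
    linear_combination ((b1 * (x2*y3 - x3*y2) + b2 * (x3*y1-x1*y3) + b3 * (x1*y2-x2*y1))) * ha -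
       (a1 * (x2*y3 - x3*y2) + a2 * (x3*y1-x1*y3) + a3 * (x1*y2-x2*y1)) * hb
  refine ContinuousLinearMap.ext fun y => ?_
  simp only [smul_apply, cross3_apply, smul_eq_mul]
  field_simp
  exact key y

/-- if a selection of subgradients is continuous at `x`, it is the derivative. -/
theorem SL.hasFDerivAt_of_cont {V : Type*} [NormedAddCommGroup V] [NormedSpace ℝ V] {F : V → ℝ}
    {p : V → V →L[ℝ] ℝ} {x : V} (hp : ∀ᶠ y in 𝓝 x, IsSub F y (p y)) (hc : ContinuousAt p x) :
    HasFDerivAt F (p x) x := by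
  rw [hasFDerivAt_iff_isLittleO, Asymptotics.isLittleO_iff]
  intro ε hε
  have hx := hp.self_of_nhds
  filter_upwards [hp, Metric.tendsto_nhds.mp hc ε hε] with y hy hy2
  rw [dist_eq_norm] at hy2
  have i1 := hx y
  have i2 := hy x
  have e : p y (x - y) = - p y (y - x) := by rw [← map_neg, neg_sub]
  rw [e] at i2
  have i3 : |(p y - p x) (y - x)| ≤ ε * ‖y - x‖ :=
    ((p y - p x).le_opNorm _).trans (by gcongr)
  rw [abs_le] at i3
  simp only [sub_apply] at i3
  rw [Real.norm_eq_abs, abs_le]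
  constructor
  · have : 0 ≤ ε * ‖y - x‖ := by positivity
    linarith
  · linarith [i3.2]

theorem integr {F : V3 → ℝ} (h : SL F) {U W : V3 → V3} (hU : Differentiable ℝ U)
    (hW : Differentiable ℝ W)
    (hp : ∀ x, ∃ p, IsSub F x p ∧ p (U x) = 0 ∧ p (W x) = 0) {x0 : V3}
    (hd : det3 (U x0) (W x0) x0 ≠ 0) {DU DW : V3 →L[ℝ] V3}
    (hDU : HasFDerivAt U DU x0) (hDW : HasFDerivAt W DW x0) :
    det3 (U x0) (W x0) (DU (W x0) - DW (U x0)) = 0 := by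
  set P : V3 → V3 →L[ℝ] ℝ := fun x => (F x / det3 (U x) (W x) x) • cross3 (U x) (W x) with hP
  have hdd : Differentiable ℝ (fun x => det3 (U x) (W x) x) := by
    unfold det3; fun_prop
  have hcd : Differentiable ℝ (fun x => cross3 (U x) (W x)) := by
    unfold cross3 fun3; fun_prop
  have hev : ∀ᶠ x in 𝓝 x0, det3 (U x) (W x) x ≠ 0 :=
    hdd.continuous.continuousAt.eventually_ne hd
  have hsub : ∀ x, det3 (U x) (W x) x ≠ 0 → IsSub F x (P x) := by
    intro x hx
    obtain ⟨p, h1, h2, h3⟩ := hp x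
    have h4 := clm3_unique h2 h3 hx
    rw [h1.self h] at h4
    rw [hP]
    simp only
    rw [← h4]; exact h1
  have hPc : ∀ x, det3 (U x) (W x) x ≠ 0 → ContinuousAt P x := by
    intro x hx
    exact ((h.cont.continuousAt).div hdd.continuous.continuousAt hx).smul
      hcd.continuous.continuousAt
  have hF : ∀ᶠ x in 𝓝 x0, HasFDerivAt F (P x) x := by
    filter_upwards [hev.eventually_nhds] with x hx
    exact SL.hasFDerivAt_of_cont (hx.mono fun y hy => hsub y hy) (hPc x hx.self_of_nhds)
  have hPd : DifferentiableAt ℝ P x0 := by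
    have hF0 : DifferentiableAt ℝ F x0 := hF.self_of_nhds.differentiableAt
    have e1 : DifferentiableAt ℝ (fun x => F x / det3 (U x) (W x) x) x0 := by
      simp only [div_eq_mul_inv]
      exact hF0.mul ((hdd x0).inv hd)
    exact e1.smul hcd.differentiableAt
  have hsym := second_derivative_symmetric_of_eventually hF hPd.hasFDerivAt
  have hUz : (fun x => P x (U x)) = fun _ => 0 := by
    funext x; simp only [hP, smul_apply, cross3_apply, smul_eq_mul]
    have : det3 (U x) (W x) (U x) = 0 := by simp only [det3]; ring
    rw [this, mul_zero]
  have hWz : (fun x => P x (W x)) = fun _ => 0 := by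
    funext x; simp only [hP, smul_apply, cross3_apply, smul_eq_mul]
    have : det3 (U x) (W x) (W x) = 0 := by simp only [det3]; ring
    rw [this, mul_zero]
  have d1 := hPd.hasFDerivAt.clm_apply hDU
  have d2 := hPd.hasFDerivAt.clm_apply hDW
  rw [hUz] at d1
  rw [hWz] at d2
  have e1 := congrArg (fun L : V3 →L[ℝ] ℝ => L (W x0)) (d1.unique (hasFDerivAt_const 0 x0))
  have e2 := congrArg (fun L : V3 →L[ℝ] ℝ => L (U x0)) (d2.unique (hasFDerivAt_const 0 x0))
  simp only [add_apply, ContinuousLinearMap.comp_apply,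
    ContinuousLinearMap.flip_apply, zero_apply] at e1 e2
  have e3 := hsym (W x0) (U x0)
  have e4 : P x0 (DU (W x0) - DW (U x0)) = 0 := by
    rw [map_sub]; linarith
  simp only [hP, smul_apply, cross3_apply, smul_eq_mul] at e4
  have hx0 : x0 ≠ 0 := by
    rintro rfl; exact hd (by simp [det3])
  have : F x0 / det3 (U x0) (W x0) x0 ≠ 0 := div_ne_zero (h.pos _ hx0).ne' hd
  exact (mul_eq_zero.mp e4).resolve_left this


def IsQuad {V : Type*} [AddCommGroup V] [Module ℝ V] (F : V → ℝ) : Prop :=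
  ∃ B : V →ₗ[ℝ] V →ₗ[ℝ] ℝ, ∀ x, F x ^ 2 = B x x

theorem integrQ {F : V3 → ℝ} (h : SL F) {U W : V3 → V3} (hU : Differentiable ℝ U)
    (hW : Differentiable ℝ W) {DU DW : V3 → V3 → V3}
    (hDU : ∀ x v (t : ℝ), U (x + t • v) = U x + t • DU x v + t ^ 2 • U v)
    (hDW : ∀ x v (t : ℝ), W (x + t • v) = W x + t • DW x v + t ^ 2 • W v)
    (hp : ∀ x, ∃ p, IsSub F x p ∧ p (U x) = 0 ∧ p (W x) = 0) {x0 : V3}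
    (hd : det3 (U x0) (W x0) x0 ≠ 0) :
    det3 (U x0) (W x0) (DU x0 (W x0) - DW x0 (U x0)) = 0 := by
  have key : ∀ (U : V3 → V3) (DU : V3 → V3 → V3), Differentiable ℝ U →
      (∀ x v (t : ℝ), U (x + t • v) = U x + t • DU x v + t ^ 2 • U v) →
      ∀ x v, fderiv ℝ U x v = DU x v := by
    intro U DU hU hq x v
    have h1 : HasDerivAt (fun t : ℝ => U (x + t • v)) (fderiv ℝ U x v) 0 := by
      have h2 : HasDerivAt (fun t : ℝ => x + t • v) v 0 := by
        simpa using ((hasDerivAt_id (0 : ℝ)).smul_const v).const_add x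
      have h3 : HasFDerivAt U (fderiv ℝ U x) (x + (0 : ℝ) • v) := by
        simpa using (hU x).hasFDerivAt
      exact h3.comp_hasDerivAt 0 h2
    have h2 : HasDerivAt (fun t : ℝ => U (x + t • v)) (DU x v) 0 := by
      simp only [hq]
      have h3 := (((hasDerivAt_id (0 : ℝ)).smul_const (DU x v)).const_add (U x)).add
        (((hasDerivAt_id (0 : ℝ)).pow 2).smul_const (U v))
      refine HasDerivAt.congr_deriv (f := fun t : ℝ => U x + t • DU x v + t ^ 2 • U v) h3 ?_
      simp
    exact h1.unique h2
  have := integr h hU hW hp hd (hU x0).hasFDerivAt (hW x0).hasFDerivAt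
  rwa [key U DU hU hDU, key W DW hW hDW] at this

structure Par where
  (p1 p2 p3 p4 p5 p6 p7 p8 p9 : ℝ)
  (q1 q2 q3 q4 q5 q6 q7 q8 q9 : ℝ)

namespace Par
variable (k : Par)

def P (x : V3) : V3 := (k.p1 * x.1 + k.p2 * x.2.1 + k.p5 * x.2.2,
  k.p3 * x.1 + k.p4 * x.2.1 + k.p6 * x.2.2, k.p7 * x.1 + k.p8 * x.2.1 + k.p9 * x.2.2)
def Q (x : V3) : V3 := (k.q1 * x.1 + k.q2 * x.2.1 + k.q5 * x.2.2,
  k.q3 * x.1 + k.q4 * x.2.1 + k.q6 * x.2.2, k.q7 * x.1 + k.q8 * x.2.1 + k.q9 * x.2.2)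
def J (x : V3) : V3 := (-x.2.1, x.1, 0)

def Y1 (x : V3) : V3 := x.2.2 • k.P x - x.1 • J x
def Y2 (x : V3) : V3 := x.2.2 • k.Q x - x.2.1 • J x
def Y3 (x : V3) : V3 := x.1 • k.Q x - x.2.1 • k.P x
def DY1 (x v : V3) : V3 := x.2.2 • k.P v - x.1 • J v + (v.2.2 • k.P x - v.1 • J x)
def DY2 (x v : V3) : V3 := x.2.2 • k.Q v - x.2.1 • J v + (v.2.2 • k.Q x - v.2.1 • J x)
def DY3 (x v : V3) : V3 := x.1 • k.Q v - x.2.1 • k.P v + (v.1 • k.Q x - v.2.1 • k.P x)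

theorem Y1_diff : Differentiable ℝ k.Y1 := by unfold Y1 P J; fun_prop
theorem Y2_diff : Differentiable ℝ k.Y2 := by unfold Y2 Q J; fun_prop
theorem Y3_diff : Differentiable ℝ k.Y3 := by unfold Y3 Q P; fun_prop

theorem Y1_q (x v : V3) (t : ℝ) : k.Y1 (x + t • v) = k.Y1 x + t • k.DY1 x v + t ^ 2 • k.Y1 v := by
  ext <;> simp [Y1, DY1, P, J] <;> ring
theorem Y2_q (x v : V3) (t : ℝ) : k.Y2 (x + t • v) = k.Y2 x + t • k.DY2 x v + t ^ 2 • k.Y2 v := by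
  ext <;> simp [Y2, DY2, Q, J] <;> ring
theorem Y3_q (x v : V3) (t : ℝ) : k.Y3 (x + t • v) = k.Y3 x + t • k.DY3 x v + t ^ 2 • k.Y3 v := by
  ext <;> simp [Y3, DY3, Q, P] <;> ring

def Adm (F : V3 → ℝ) (x : V3) (p : V3 →L[ℝ] ℝ) : Prop :=
  IsSub F x p ∧ p (k.Y1 x) = 0 ∧ p (k.Y2 x) = 0 ∧ p (k.Y3 x) = 0

structure Hyp (F : V3 → ℝ) : Prop where
  sl : SL F
  circ : ∀ x y, F (x, y, 0) = √(x ^ 2 + y ^ 2)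
  adm : ∀ x, ∃ p, k.Adm F x p

def Kak (F : V3 → ℝ) : Prop := ∃ w : V3, ∃ D : Set V3, Dense D ∧ ∀ x ∈ D, ∀ p, k.Adm F x p →
  p (k.P x) = x.1 * p w ∧ p (k.Q x) = x.2.1 * p w ∧ p (J x) = x.2.2 * p w

/-- the quadratic form `β` -/
def bet (x y : ℝ) : ℝ := y * (k.p7 * x + k.p8 * y) - x * (k.q7 * x + k.q8 * y)
def f1 (x y : ℝ) : ℝ := k.p1 * x ^ 2 + (k.p2 + k.p3) * x * y + k.p4 * y ^ 2
def f2 (x y : ℝ) : ℝ := k.q1 * x ^ 2 + (k.q2 + k.q3) * x * y + k.q4 * y ^ 2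
def gam (x y : ℝ) : ℝ := y * k.f1 x y - x * k.f2 x y

variable {k} {F : V3 → ℝ}

theorem circ_sub (hF : k.Hyp F) {x y : ℝ} (hxy : x ^ 2 + y ^ 2 = 1) {p : V3 →L[ℝ] ℝ}
    (hp : IsSub F (x, y, 0) p) : p (1, 0, 0) = x ∧ p (0, 1, 0) = y := by
  have h1 := hp.self hF.sl
  rw [hF.circ, hxy, Real.sqrt_one, clm3_apply] at h1
  have h2 := hp.le hF.sl (p (1,0,0), p (0,1,0), 0)
  rw [hF.circ, clm3_apply] at h2
  set a := p (1,0,0)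
  set b := p (0,1,0)
  simp only [mul_zero, add_zero] at h1 h2
  have h3 : √(a ^ 2 + b ^ 2) ≤ 1 := by
    by_contra hc
    push Not at hc
    have h4 := Real.sq_sqrt (show 0 ≤ a ^ 2 + b ^ 2 by positivity)
    nlinarith
  have h5 : a ^ 2 + b ^ 2 ≤ 1 := by nlinarith
  have h6 : (a - x) ^ 2 + (b - y) ^ 2 ≤ 0 := by nlinarith
  constructor <;> nlinarith [sq_nonneg (a - x), sq_nonneg (b - y)]

theorem circ_rel (hF : k.Hyp F) {x y : ℝ} (hxy : x ^ 2 + y ^ 2 = 1) :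
    ∃ h, k.gam x y + k.bet x y * h = 0 := by
  obtain ⟨p, h1, -, -, h2⟩ := hF.adm (x, y, 0)
  obtain ⟨e1, e2⟩ := circ_sub hF hxy h1
  rw [clm3_apply, e1, e2] at h2
  refine ⟨p (0,0,1), ?_⟩
  simp only [Y3, P, Q, gam, bet, f1, f2, Prod.fst_sub, Prod.snd_sub, Prod.smul_fst, Prod.smul_snd,
    smul_eq_mul] at h2 ⊢
  linear_combination -h2

theorem circ_gam (hF : k.Hyp F) (hb : ∀ x y, k.bet x y = 0) (x y : ℝ) : k.gam x y = 0 := by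
  by_cases h0 : x ^ 2 + y ^ 2 = 0
  · have hx : x = 0 := by nlinarith [sq_nonneg x, sq_nonneg y]
    have hy : y = 0 := by nlinarith [sq_nonneg x, sq_nonneg y]
    simp [gam, hx, hy]
  · have hpos : 0 < x ^ 2 + y ^ 2 := lt_of_le_of_ne (by positivity) (Ne.symm h0)
    set r := √(x ^ 2 + y ^ 2) with hr
    have hr0 : 0 < r := Real.sqrt_pos.mpr hpos
    have hr2 : r ^ 2 = x ^ 2 + y ^ 2 := Real.sq_sqrt hpos.le
    obtain ⟨h, hh⟩ := circ_rel hF (x := x / r) (y := y / r) (by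
      rw [div_pow, div_pow, ← add_div, hr2, div_self h0])
    rw [hb, zero_mul, add_zero] at hh
    have : k.gam x y = r ^ 3 * k.gam (x / r) (y / r) := by
      simp only [gam, f1, f2]; field_simp
    rw [this, hh, mul_zero]

/-- `T` -/
theorem T_id (hF : k.Hyp F) (x y : ℝ) (hx : x ≠ 0) (hb : k.bet x y ≠ 0) :
    (x * (k.f1 x y + y * ((k.p2 + k.p3) * x + 2 * k.p4 * y) - x * ((k.q2 + k.q3) * x + 2 * k.q4 * y))
      - y * (y * (2 * k.p1 * x + (k.p2 + k.p3) * y) - k.f2 x y - x * (2 * k.q1 * x + (k.q2 + k.q3) * y)))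
       * k.bet x y
    - k.gam x y * (x * ((k.p7 * x + 2 * k.p8 * y) - x * k.q8)
      - y * (y * k.p7 - (2 * k.q7 * x + k.q8 * y))) +
      (k.f2 x y * (k.p7 * x + k.p8 * y) - k.f1 x y * (k.q7 * x + k.q8 * y)) * k.bet x y = 0 := by
  have hxy : 0 < x ^ 2 + y ^ 2 := by positivity
  have hd : det3 (k.Y3 (x, y, 0)) (k.Y1 (x, y, 0)) (x, y, 0) ≠ 0 := by
    have : det3 (k.Y3 (x, y, 0)) (k.Y1 (x, y, 0)) (x, y, 0) = - k.bet x y * x * (x ^ 2 + y ^ 2) := by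
      simp [det3, Y3, Y1, P, Q, J, bet]; ring
    rw [this]
    exact mul_ne_zero (mul_ne_zero (neg_ne_zero.mpr hb) hx) hxy.ne'
  have h1 := integrQ hF.sl k.Y3_diff k.Y1_diff k.Y3_q k.Y1_q (fun x => by
    obtain ⟨p, a, b, c, d⟩ := hF.adm x
    exact ⟨p, a, d, b⟩) hd
  have hx2 : x ^ 2 ≠ 0 := pow_ne_zero 2 hx
  refine (mul_eq_zero.mp ?_).resolve_left hx2
  simp only [det3, Y3, Y1, DY1, DY3, P, Q, J, Prod.fst_sub, Prod.snd_sub, Prod.smul_fst, Prod.smul_snd,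
    smul_eq_mul, Prod.fst_add, Prod.snd_add, zero_mul, mul_zero, zero_sub, sub_zero, zero_add, add_zero] at h1
  simp only [gam, bet, f1, f2]
  linear_combination -h1

end Par

namespace Par

/-- change of coordinates between parameter sets -/
structure Rel (k k' : Par) (S : V3 ≃L[ℝ] V3) (w : V3) (c11 c12 c21 c22 d1 d2 : ℝ) : Prop where
  hP : ∀ x, S (k'.P x) = c11 • k.P (S x) + c12 • k.Q (S x) + d1 • J (S x) - x.1 • w
  hQ : ∀ x, S (k'.Q x) = c21 • k.P (S x) + c22 • k.Q (S x) + d2 • J (S x) - x.2.1 • w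
  hJ : ∀ x, S (J x) = J (S x) - x.2.2 • w
  h1 : ∀ x, x.1 = c11 * (S x).1 + c12 * (S x).2.1 + d1 * (S x).2.2
  h2 : ∀ x, x.2.1 = c21 * (S x).1 + c22 * (S x).2.1 + d2 * (S x).2.2
  h3 : ∀ x, x.2.2 = (S x).2.2
  hdet : c11 * c22 - c12 * c21 ≠ 0
  hcirc : ∀ x y, (S (x, y, 0)).1 ^ 2 + (S (x, y, 0)).2.1 ^ 2 = x ^ 2 + y ^ 2

variable {k k' : Par} {S : V3 ≃L[ℝ] V3} {w : V3} {c11 c12 c21 c22 d1 d2 : ℝ} {F : V3 → ℝ}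

theorem Rel.adm (h : Rel k k' S w c11 c12 c21 c22 d1 d2) {x : V3} {p : V3 →L[ℝ] ℝ}
    (hp : k.Adm F (S x) p) : k'.Adm (fun x => F (S x)) x (p.comp (S : V3 →L[ℝ] V3)) := by
  obtain ⟨a0, a1, a2, a3⟩ := hp
  refine ⟨?_, ?_, ?_, ?_⟩
  · intro y
    have := a0 (S y)
    simpa using this
  all_goals
    simp only [Y1, Y2, Y3, map_sub, map_smul, ContinuousLinearMap.comp_apply,
      ContinuousLinearEquiv.coe_coe, h.hP, h.hQ, h.hJ, map_add, smul_eq_mul] at a1 a2 a3 ⊢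
    try rw [h.h1 x]
    try rw [h.h2 x]
    try rw [h.h3 x]
  · linear_combination c11 * a1 + c12 * a2
  · linear_combination c21 * a1 + c22 * a2
  · linear_combination (c11 * c22 - c12 * c21) * a3 + (d1 * c21 - d2 * c11) * a1 +
      (d1 * c22 - d2 * c12) * a2

theorem Rel.hyp (h : Rel k k' S w c11 c12 c21 c22 d1 d2) (hF : k.Hyp F) :
    k'.Hyp (fun x => F (S x)) where
  sl := hF.sl.comp (S : V3 →L[ℝ] V3) S.injective
  circ x y := by
    have h0 : (S (x, y, 0)).2.2 = 0 := (h.h3 (x, y, 0)).symm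
    have e : S (x, y, 0) = ((S (x, y, 0)).1, (S (x, y, 0)).2.1, 0) := by
      ext <;> simp [h0]
    rw [e, hF.circ, h.hcirc]
  adm x := by
    obtain ⟨p, hp⟩ := hF.adm (S x)
    exact ⟨_, h.adm hp⟩

theorem Rel.quad (hq : IsQuad (fun x => F (S x))) : IsQuad F := by
  obtain ⟨B, hB⟩ := hq
  refine ⟨B.compl₁₂ (S.symm : V3 →ₗ[ℝ] V3) (S.symm : V3 →ₗ[ℝ] V3), fun x => ?_⟩
  have := hB (S.symm x)
  simpa using this

theorem Rel.kak (h : Rel k k' S w c11 c12 c21 c22 d1 d2) (hq : k'.Kak (fun x => F (S x))) :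
    k.Kak F := by
  obtain ⟨w', D, hD, hK⟩ := hq
  refine ⟨w + S w', S '' D, ?_, ?_⟩
  · exact S.surjective.denseRange.dense_image S.continuous hD
  · rintro _ ⟨x, hx, rfl⟩ p hp
    obtain ⟨e1, e2, e3⟩ := hK x hx _ (h.adm hp)
    simp only [map_sub, map_smul, ContinuousLinearMap.comp_apply,
      ContinuousLinearEquiv.coe_coe, h.hP, h.hQ, h.hJ, map_add, smul_eq_mul] at e1 e2 e3 ⊢
    rw [h.h3 x] at e3
    rw [h.h1 x] at e1
    rw [h.h2 x] at e2
    have hd := h.hdet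
    refine ⟨mul_left_cancel₀ hd ?_, mul_left_cancel₀ hd ?_, by linear_combination e3⟩
    · linear_combination c22 * e1 - c12 * e2 + (-c22 * d1 + c12 * d2) * e3
    · linear_combination c11 * e2 - c21 * e1 + (-c11 * d2 + c21 * d1) * e3

noncomputable def shearL (m n : ℝ) : V3 →L[ℝ] V3 :=
  (fun3 1 0 m).prod ((fun3 0 1 n).prod (fun3 0 0 1))

noncomputable def shear (m n : ℝ) : V3 ≃L[ℝ] V3 :=
  ContinuousLinearEquiv.equivOfInverse (shearL m n) (shearL (-m) (-n))
    (fun x => by ext <;> simp [shearL]) (fun x => by ext <;> simp [shearL])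

@[simp] theorem shear_apply (m n : ℝ) (x : V3) :
    shear m n x = (x.1 + m * x.2.2, x.2.1 + n * x.2.2, x.2.2) := by
  ext <;> simp [shear, shearL]

def shearP (k : Par) (m n : ℝ) : Par where
  p1 := k.p1 - m * k.p7 + n
  p2 := k.p2 + m - m * k.p8
  p3 := k.p3 - 2 * m - n * k.p7
  p4 := k.p4 - n * k.p8
  p5 := k.p1 * m + k.p2 * n + k.p5 + m * n - m * (k.p7 * m + k.p8 * n + k.p9)
  p6 := k.p3 * m + k.p4 * n + k.p6 - m ^ 2 - n * (k.p7 * m + k.p8 * n + k.p9)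
  p7 := k.p7
  p8 := k.p8
  p9 := k.p7 * m + k.p8 * n + k.p9
  q1 := k.q1 - m * k.q7
  q2 := k.q2 + 2 * n - m * k.q8
  q3 := k.q3 - n - n * k.q7
  q4 := k.q4 - m - n * k.q8
  q5 := k.q1 * m + k.q2 * n + k.q5 + n ^ 2 - m * (k.q7 * m + k.q8 * n + k.q9)
  q6 := k.q3 * m + k.q4 * n + k.q6 - m * n - n * (k.q7 * m + k.q8 * n + k.q9)
  q7 := k.q7
  q8 := k.q8
  q9 := k.q7 * m + k.q8 * n + k.q9

theorem shear_rel (k : Par) (m n : ℝ) :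
    Rel k (k.shearP m n) (shear m n) (-n, m, 0) 1 0 0 1 (-m) (-n) where
  hP x := by ext <;> simp [P, Q, J, shearP] <;> ring
  hQ x := by ext <;> simp [P, Q, J, shearP] <;> ring
  hJ x := by ext <;> simp [J] <;> ring
  h1 x := by simp
  h2 x := by simp
  h3 x := by simp
  hdet := by norm_num
  hcirc x y := by simp

noncomputable def rotL (c s : ℝ) : V3 →L[ℝ] V3 :=
  (fun3 c (-s) 0).prod ((fun3 s c 0).prod (fun3 0 0 1))

noncomputable def rot (c s : ℝ) (h : c ^ 2 + s ^ 2 = 1) : V3 ≃L[ℝ] V3 :=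
  ContinuousLinearEquiv.equivOfInverse (rotL c s) (rotL c (-s))
    (fun x => by
      ext
      · simp [rotL]; linear_combination x.1 * h
      · simp [rotL]; linear_combination x.2.1 * h
      · simp [rotL]) (fun x => by
      ext
      · simp [rotL]; linear_combination x.1 * h
      · simp [rotL]; linear_combination x.2.1 * h
      · simp [rotL])

@[simp] theorem rot_apply (c s : ℝ) (h : c ^ 2 + s ^ 2 = 1) (x : V3) :
    rot c s h x = (c * x.1 - s * x.2.1, s * x.1 + c * x.2.1, x.2.2) := by
  ext <;> simp [rot, rotL, sub_eq_add_neg]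

/-- rotated parameters -/
def rotP (k : Par) (c s : ℝ) : Par where
  p1 := c * (c * (k.p1 * c + k.p2 * s) + s * (k.q1 * c + k.q2 * s)) + s * (c * (k.p3 * c + k.p4 * s) + s * (k.q3 * c + k.q4 * s))
  p2 := c * (c * (-k.p1 * s + k.p2 * c) + s * (-k.q1 * s + k.q2 * c)) + s * (c * (-k.p3 * s + k.p4 * c) + s * (-k.q3 * s + k.q4 * c))
  p3 := -s * (c * (k.p1 * c + k.p2 * s) + s * (k.q1 * c + k.q2 * s)) + c * (c * (k.p3 * c + k.p4 * s) + s * (k.q3 * c + k.q4 * s))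
  p4 := -s * (c * (-k.p1 * s + k.p2 * c) + s * (-k.q1 * s + k.q2 * c)) + c * (c * (-k.p3 * s + k.p4 * c) + s * (-k.q3 * s + k.q4 * c))
  p5 := c * (c * k.p5 + s * k.q5) + s * (c * k.p6 + s * k.q6)
  p6 := -s * (c * k.p5 + s * k.q5) + c * (c * k.p6 + s * k.q6)
  p7 := c * (k.p7 * c + k.p8 * s) + s * (k.q7 * c + k.q8 * s)
  p8 := c * (-k.p7 * s + k.p8 * c) + s * (-k.q7 * s + k.q8 * c)
  p9 := c * k.p9 + s * k.q9
  q1 := c * (-s * (k.p1 * c + k.p2 * s) + c * (k.q1 * c + k.q2 * s)) + s * (-s * (k.p3 * c + k.p4 * s) + c * (k.q3 * c + k.q4 * s))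
  q2 := c * (-s * (-k.p1 * s + k.p2 * c) + c * (-k.q1 * s + k.q2 * c)) + s * (-s * (-k.p3 * s + k.p4 * c) + c * (-k.q3 * s + k.q4 * c))
  q3 := -s * (-s * (k.p1 * c + k.p2 * s) + c * (k.q1 * c + k.q2 * s)) + c * (-s * (k.p3 * c + k.p4 * s) + c * (k.q3 * c + k.q4 * s))
  q4 := -s * (-s * (-k.p1 * s + k.p2 * c) + c * (-k.q1 * s + k.q2 * c)) + c * (-s * (-k.p3 * s + k.p4 * c) + c * (-k.q3 * s + k.q4 * c))
  q5 := c * (-s * k.p5 + c * k.q5) + s * (-s * k.p6 + c * k.q6)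
  q6 := -s * (-s * k.p5 + c * k.q5) + c * (-s * k.p6 + c * k.q6)
  q7 := -s * (k.p7 * c + k.p8 * s) + c * (k.q7 * c + k.q8 * s)
  q8 := -s * (-k.p7 * s + k.p8 * c) + c * (-k.q7 * s + k.q8 * c)
  q9 := -s * k.p9 + c * k.q9

theorem rot_rel (k : Par) (c s : ℝ) (h : c ^ 2 + s ^ 2 = 1) :
    Rel k (k.rotP c s) (rot c s h) 0 c s (-s) c 0 0 where
  hP x := by
    have hc : c ^ 2 = 1 - s ^ 2 := by linarith
    ext
    · simp [P, Q, J, rotP]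
      linear_combination (c * (x.1 * (k.p1 * c + k.p2 * s) + x.2.1 * (-k.p1 * s + k.p2 * c) + x.2.2 * k.p5) + s * (x.1 * (k.q1 * c + k.q2 * s) + x.2.1 * (-k.q1 * s + k.q2 * c) + x.2.2 * k.q5)) * h
    · simp [P, Q, J, rotP]
      linear_combination (c * (x.1 * (k.p3 * c + k.p4 * s) + x.2.1 * (-k.p3 * s + k.p4 * c) + x.2.2 * k.p6) + s * (x.1 * (k.q3 * c + k.q4 * s) + x.2.1 * (-k.q3 * s + k.q4 * c) + x.2.2 * k.q6)) * h
    · simp [P, Q, J, rotP]; ring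
  hQ x := by
    ext
    · simp [P, Q, J, rotP]
      linear_combination (-s * (x.1 * (k.p1 * c + k.p2 * s) + x.2.1 * (-k.p1 * s + k.p2 * c) + x.2.2 * k.p5) + c * (x.1 * (k.q1 * c + k.q2 * s) + x.2.1 * (-k.q1 * s + k.q2 * c) + x.2.2 * k.q5)) * h
    · simp [P, Q, J, rotP]
      linear_combination (-s * (x.1 * (k.p3 * c + k.p4 * s) + x.2.1 * (-k.p3 * s + k.p4 * c) + x.2.2 * k.p6) + c * (x.1 * (k.q3 * c + k.q4 * s) + x.2.1 * (-k.q3 * s + k.q4 * c) + x.2.2 * k.q6)) * h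
    · simp [P, Q, J, rotP]; ring
  hJ x := by ext <;> simp [J] <;> ring
  h1 x := by simp; linear_combination -x.1 * h
  h2 x := by simp; linear_combination -x.2.1 * h
  h3 x := by simp
  hdet := by
    have : c * c - s * (-s) = 1 := by linear_combination h
    rw [this]; norm_num
  hcirc x y := by simp; linear_combination (x ^ 2 + y ^ 2) * h

end Par


theorem poly5 {c0 c1 c2 c3 c4 c5 : ℝ}
    (h : ∀ t : ℝ, c0 + c1 * t + c2 * t ^ 2 + c3 * t ^ 3 + c4 * t ^ 4 + c5 * t ^ 5 = 0) :
    c0 = 0 ∧ c1 = 0 ∧ c2 = 0 ∧ c3 = 0 ∧ c4 = 0 ∧ c5 = 0 := by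
  have a0 := h 0
  have a1 := h 1
  have a2 := h (-1)
  have a3 := h 2
  have a4 := h (-2)
  have a5 := h 3
  norm_num at a0 a1 a2 a3 a4 a5
  refine ⟨?_, ?_, ?_, ?_, ?_, ?_⟩ <;> linarith

theorem quad_generic {d0 d1 d2 : ℝ} (h : ¬ (d0 = 0 ∧ d1 = 0 ∧ d2 = 0)) {a b : ℝ} (hab : a < b) :
    ∃ t, a < t ∧ t < b ∧ d0 + d1 * t + d2 * t ^ 2 ≠ 0 := by
  by_contra hc
  push Not at hc
  apply h
  set s := (b - a) / 4 with hs
  have hs0 : 0 < s := by linarith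
  set m := (a + b) / 2 with hm
  have h1 := hc m (by linarith) (by linarith)
  have h2 := hc (m + s) (by linarith) (by linarith)
  have h3 := hc (m - s) (by linarith) (by linarith)
  have e2 : d2 = 0 := by
    have : d2 * s ^ 2 = 0 := by linear_combination (h2 + h3 - 2 * h1) / 2
    exact (mul_eq_zero.mp this).resolve_right (by positivity)
  subst e2
  have e1 : d1 = 0 := by
    have : d1 * s = 0 := by linear_combination (h2 - h3) / 2
    exact (mul_eq_zero.mp this).resolve_right (by positivity)
  subst e1
  exact ⟨by linarith, rfl, rfl⟩

theorem dense_ne {V : Type*} [NormedAddCommGroup V] [NormedSpace ℝ V] (l : V →L[ℝ] ℝ) (hl : l ≠ 0) :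
    Dense {x | l x ≠ 0} := by
  obtain ⟨v, hv⟩ : ∃ v, l v ≠ 0 := by
    by_contra hc
    push Not at hc
    exact hl (ContinuousLinearMap.ext hc)
  intro x
  by_cases hx : l x = 0
  · have h1 : Tendsto (fun t : ℝ => x + t • v) (𝓝[≠] 0) (𝓝 x) := by
      have : ContinuousAt (fun t : ℝ => x + t • v) 0 := by fun_prop
      have h2 := this.tendsto
      simp only [zero_smul, add_zero] at h2
      exact h2.mono_left nhdsWithin_le_nhds
    refine mem_closure_of_tendsto h1 ?_
    filter_upwards [self_mem_nhdsWithin] with t ht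
    simp only [Set.mem_setOf_eq, map_add, map_smul, hx, zero_add, smul_eq_mul]
    exact mul_ne_zero ht hv
  · exact subset_closure hx

namespace Par
variable {k : Par} {F : V3 → ℝ}

structure Lin (k : Par) : Prop where
  e1 : k.p1 = 0
  e4 : k.p4 = 0
  e3 : k.p3 = - k.p2
  g1 : k.q1 = 0
  g4 : k.q4 = 0
  g3 : k.q3 = - k.q2

def qk (κ : ℝ) (x : V3) : ℝ := x.1 ^ 2 + x.2.1 ^ 2 + κ * x.2.2 ^ 2

theorem qk_deriv (κ : ℝ) (x : V3) :
    HasFDerivAt (qk κ) (fun3 (2 * x.1) (2 * x.2.1) (2 * κ * x.2.2)) x := by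
  have h1 : HasFDerivAt (fun x : V3 => x.1) (fun3 1 0 0) x := by
    have := (fun3 1 0 0).hasFDerivAt (x := x)
    simpa [Function.comp_def] using this.congr_of_eventuallyEq (Eventually.of_forall fun y => by simp)
  have h2 : HasFDerivAt (fun x : V3 => x.2.1) (fun3 0 1 0) x := by
    exact ((fun3 0 1 0).hasFDerivAt (x := x)).congr_of_eventuallyEq (Eventually.of_forall fun y => by simp)
  have h3 : HasFDerivAt (fun x : V3 => x.2.2) (fun3 0 0 1) x := by
    exact ((fun3 0 0 1).hasFDerivAt (x := x)).congr_of_eventuallyEq (Eventually.of_forall fun y => by simp)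
  have := ((h1.pow 2).add (h2.pow 2)).add ((h3.pow 2).const_mul κ)
  refine HasFDerivAt.congr_fderiv (f := qk κ) this ?_
  refine ContinuousLinearMap.ext fun v => ?_
  simp
  ring

def E1 (k : Par) (κ : ℝ) (x : V3) : ℝ :=
  k.p5 * x.1 + k.p6 * x.2.1 + κ * (k.p7 * x.1 + k.p8 * x.2.1 + k.p9 * x.2.2)
def E2 (k : Par) (κ : ℝ) (x : V3) : ℝ :=
  k.q5 * x.1 + k.q6 * x.2.1 + κ * (k.q7 * x.1 + k.q8 * x.2.1 + k.q9 * x.2.2)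

theorem crit_of_ext (hk : Lin k) (hF : k.Hyp F) {κ : ℝ} {x : V3} (hx : x.2.2 ≠ 0)
    (hl : IsLocalExtr (fun y => qk κ y * F x ^ 2 - qk κ x * F y ^ 2) x) :
    k.E1 κ x = 0 ∧ k.E2 κ x = 0 := by
  have hx0 : x ≠ 0 := by rintro rfl; exact hx rfl
  have i1 := hF.sl.extremal (Y := k.Y1) (x := x) k.Y1_diff.differentiableAt (fun x => by
    obtain ⟨p, a, b, c, d⟩ := hF.adm x
    exact ⟨p, a, b⟩) (qk_deriv κ x) hx0 (Or.inr hl)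
  have i2 := hF.sl.extremal (Y := k.Y2) (x := x) k.Y2_diff.differentiableAt (fun x => by
    obtain ⟨p, a, b, c, d⟩ := hF.adm x
    exact ⟨p, a, c⟩) (qk_deriv κ x) hx0 (Or.inr hl)
  have h2 : 2 * x.2.2 ^ 2 ≠ 0 := by positivity
  constructor
  · refine mul_left_cancel₀ h2 ?_
    simp only [fun3_apply, Y1, P, J, Prod.fst_sub, Prod.snd_sub, Prod.smul_fst, Prod.smul_snd,
      smul_eq_mul, hk.e1, hk.e4, hk.e3] at i1
    unfold E1
    linear_combination i1
  · refine mul_left_cancel₀ h2 ?_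
    simp only [fun3_apply, Y2, Q, J, Prod.fst_sub, Prod.snd_sub, Prod.smul_fst, Prod.smul_snd,
      smul_eq_mul, hk.g1, hk.g4, hk.g3] at i2
    unfold E2
    linear_combination i2

theorem qk_cont (κ : ℝ) : Continuous (qk κ) := by unfold qk; fun_prop

theorem qk_smul (κ t : ℝ) (x : V3) : qk κ (t • x) = t ^ 2 * qk κ x := by
  simp [qk]; ring

theorem crit_max (hk : Lin k) (hF : k.Hyp F) {κ σ : ℝ} (hσ : σ = 1 ∨ σ = -1)
    (hex : ∃ x : V3, 0 < x.2.2 ∧ 0 < σ * (qk κ x - F x ^ 2)) :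
    ∃ x : V3, 0 < x.2.2 ∧ 0 < σ * (qk κ x - F x ^ 2) ∧ k.E1 κ x = 0 ∧ k.E2 κ x = 0 := by
  set K : Set V3 := Metric.sphere 0 1 ∩ {x | 0 ≤ x.2.2} with hK
  have hKc : IsCompact K := (isCompact_sphere 0 1).inter_right
    (isClosed_le continuous_const (by fun_prop))
  have hnz : ∀ x ∈ K, x ≠ 0 := by
    rintro x ⟨h1, -⟩ rfl
    simp at h1
  have hFp : ∀ x ∈ K, 0 < F x := fun x hx => hF.sl.pos x (hnz x hx)
  have hcont : ContinuousOn (fun x => σ * qk κ x / F x ^ 2) K := by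
    refine ContinuousOn.div (by have := qk_cont κ; fun_prop) ((hF.sl.cont.pow 2).continuousOn) ?_
    intro x hx
    exact pow_ne_zero 2 (hFp x hx).ne'
  obtain ⟨x0, hx0, hpos⟩ := hex
  have hx00 : x0 ≠ 0 := by rintro rfl; simp at hx0
  have hn : ∀ x : V3, 0 < x.2.2 → ‖x‖⁻¹ • x ∈ K := by
    intro x hx
    have hx00 : x ≠ 0 := by rintro rfl; simp at hx
    have : 0 < ‖x‖ := norm_pos_iff.mpr hx00
    refine ⟨by simp [norm_smul, this.ne'], ?_⟩
    simp only [Set.mem_setOf_eq, Prod.smul_snd, smul_eq_mul]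
    positivity
  have hscale : ∀ x : V3, 0 < x.2.2 → σ * qk κ (‖x‖⁻¹ • x) / F (‖x‖⁻¹ • x) ^ 2 =
      σ * qk κ x / F x ^ 2 := by
    intro x hx
    have hx00 : x ≠ 0 := by rintro rfl; simp at hx
    have : 0 < ‖x‖ := norm_pos_iff.mpr hx00
    have hFx := hF.sl.pos x hx00
    rw [qk_smul, hF.sl.smul _ _ (by positivity)]
    field_simp
  obtain ⟨X, hXK, hmax⟩ := hKc.exists_isMaxOn ⟨_, hn x0 hx0⟩ hcont
  have hFX := hFp X hXK
  have hmax' : ∀ y : V3, 0 < y.2.2 → σ * qk κ y / F y ^ 2 ≤ σ * qk κ X / F X ^ 2 := by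
    intro y hy
    have := hmax (hn y hy)
    simp only [Set.mem_setOf_eq] at this
    rwa [hscale y hy] at this
  have hM : σ < σ * qk κ X / F X ^ 2 := by
    refine lt_of_lt_of_le ?_ (hmax' x0 hx0)
    have := hF.sl.pos x0 hx00
    rw [lt_div_iff₀ (by positivity)]
    linarith
  have hXz : 0 < X.2.2 := by
    have hz : 0 ≤ X.2.2 := hXK.2
    rcases lt_or_eq_of_le hz with h | h
    · exact h
    · exfalso
      have e : X = (X.1, X.2.1, 0) := by ext <;> simp [← h]
      have h2 : F X ^ 2 = X.1 ^ 2 + X.2.1 ^ 2 := by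
        rw [e, hF.circ]
        exact Real.sq_sqrt (by positivity)
      have h3 : qk κ X = F X ^ 2 := by
        rw [h2]; simp [qk, ← h]
      rw [h3, mul_div_assoc, div_self (by positivity), mul_one] at hM
      exact lt_irrefl _ hM
  refine ⟨X, hXz, ?_, crit_of_ext hk hF (κ := κ) hXz.ne' ?_⟩
  · rw [lt_div_iff₀ (by positivity)] at hM
    linarith
  · have hev : ∀ᶠ y in 𝓝 X, 0 < y.2.2 := by
      have : Continuous (fun y : V3 => y.2.2) := by fun_prop
      exact this.continuousAt.eventually (lt_mem_nhds hXz)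
    have key : ∀ᶠ y in 𝓝 X, σ * (qk κ y * F X ^ 2 - qk κ X * F y ^ 2) ≤ 0 := by
      filter_upwards [hev] with y hy
      have h1 := hmax' y hy
      have hy0 : y ≠ 0 := by rintro rfl; simp at hy
      have hFy := hF.sl.pos y hy0
      rw [div_le_div_iff₀ (by positivity) (by positivity)] at h1
      linarith
    rcases hσ with rfl | rfl
    · right
      filter_upwards [key] with y hy
      linarith
    · left
      filter_upwards [key] with y hy
      linarith

theorem crit_eq (hk : Lin k) (hF : k.Hyp F) {κ : ℝ} (h : ∀ x : V3, 0 < x.2.2 → qk κ x = F x ^ 2)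
    (x : V3) (hx : 0 < x.2.2) : k.E1 κ x = 0 ∧ k.E2 κ x = 0 := by
  refine crit_of_ext hk hF (κ := κ) hx.ne' (Or.inl ?_)
  have hev : ∀ᶠ y in 𝓝 x, 0 < y.2.2 := by
    have : Continuous (fun y : V3 => y.2.2) := by fun_prop
    exact this.continuousAt.eventually (lt_mem_nhds hx)
  filter_upwards [hev] with y hy
  rw [h x hx, h y hy]
  linarith

theorem crit_exists (hk : Lin k) (hF : k.Hyp F) (κ : ℝ) :
    ∃ x : V3, 0 < x.2.2 ∧ k.E1 κ x = 0 ∧ k.E2 κ x = 0 := by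
  by_cases h1 : ∃ x : V3, 0 < x.2.2 ∧ 0 < 1 * (qk κ x - F x ^ 2)
  · obtain ⟨x, a, -, b⟩ := crit_max hk hF (Or.inl rfl) h1
    exact ⟨x, a, b⟩
  by_cases h2 : ∃ x : V3, 0 < x.2.2 ∧ 0 < (-1) * (qk κ x - F x ^ 2)
  · obtain ⟨x, a, -, b⟩ := crit_max hk hF (Or.inr rfl) h2
    exact ⟨x, a, b⟩
  push Not at h1 h2
  refine ⟨(0, 0, 1), by norm_num, crit_eq hk hF (κ := κ) (fun x hx => ?_) _ (by norm_num)⟩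
  linarith [h1 x hx, h2 x hx]

theorem dicho (hk : Lin k) (hF : k.Hyp F) {κ : ℝ}
    (hd : (k.p5 + κ * k.p7) * (k.q6 + κ * k.q8) - (k.p6 + κ * k.p8) * (k.q5 + κ * k.q7) ≠ 0) :
    (∀ x : V3, 0 < x.2.2 → qk κ x ≤ F x ^ 2) ∨ (∀ x : V3, 0 < x.2.2 → F x ^ 2 ≤ qk κ x) := by
  by_contra hc
  push Not at hc
  obtain ⟨⟨x, hx, hx2⟩, ⟨y, hy, hy2⟩⟩ := hc
  obtain ⟨X, hX, hX1, hX2, hX3⟩ := crit_max hk hF (κ := κ) (Or.inl rfl) ⟨x, hx, by linarith⟩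
  obtain ⟨Y, hY, hY1, hY2, hY3⟩ := crit_max hk hF (κ := κ) (Or.inr rfl) ⟨y, hy, by linarith⟩
  -- Y.2.2 • X = X.2.2 • Y
  have e : Y.2.2 • X = X.2.2 • Y := by
    have a1 : (k.p5 + κ * k.p7) * (Y.2.2 * X.1 - X.2.2 * Y.1) +
        (k.p6 + κ * k.p8) * (Y.2.2 * X.2.1 - X.2.2 * Y.2.1) = 0 := by
      unfold E1 at hX2 hY2
      linear_combination Y.2.2 * hX2 - X.2.2 * hY2
    have a2 : (k.q5 + κ * k.q7) * (Y.2.2 * X.1 - X.2.2 * Y.1) +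
        (k.q6 + κ * k.q8) * (Y.2.2 * X.2.1 - X.2.2 * Y.2.1) = 0 := by
      unfold E2 at hX3 hY3
      linear_combination Y.2.2 * hX3 - X.2.2 * hY3
    ext
    · simp only [Prod.smul_fst, smul_eq_mul]
      refine mul_left_cancel₀ hd ?_
      linear_combination (k.q6 + κ * k.q8) * a1 - (k.p6 + κ * k.p8) * a2
    · simp only [Prod.smul_fst, Prod.smul_snd, smul_eq_mul]
      refine mul_left_cancel₀ hd ?_
      linear_combination (k.p5 + κ * k.p7) * a2 - (k.q5 + κ * k.q7) * a1
    · simp [mul_comm]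
  have e1 := qk_smul κ Y.2.2 X
  have e2 := hF.sl.smul Y.2.2 X hY.le
  rw [e] at e1 e2
  rw [qk_smul] at e1
  rw [hF.sl.smul _ _ hX.le] at e2
  have e3 : X.2.2 ^ 2 * (qk κ Y - F Y ^ 2) = Y.2.2 ^ 2 * (qk κ X - F X ^ 2) := by
    have : (X.2.2 * F Y) ^ 2 = (Y.2.2 * F X) ^ 2 := by rw [e2]
    linear_combination e1 - this
  have p1 : 0 < Y.2.2 ^ 2 * (qk κ X - F X ^ 2) := by
    apply mul_pos (by positivity); linarith
  have p2 : X.2.2 ^ 2 * (qk κ Y - F Y ^ 2) < 0 := by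
    apply mul_neg_of_pos_of_neg (by positivity); linarith
  linarith

def d0 (k : Par) : ℝ := k.p5 * k.q6 - k.p6 * k.q5
def d1 (k : Par) : ℝ := k.p5 * k.q8 + k.p7 * k.q6 - k.p6 * k.q7 - k.p8 * k.q5
def d2 (k : Par) : ℝ := k.p7 * k.q8 - k.p8 * k.q7

theorem lin_up (hk : Lin k) (hF : k.Hyp F) (hd : ¬ (k.d0 = 0 ∧ k.d1 = 0 ∧ k.d2 = 0)) :
    ∃ κ, ∀ x : V3, 0 < x.2.2 → qk κ x = F x ^ 2 := by
  have gen : ∀ a b : ℝ, a < b → ∃ κ, a < κ ∧ κ < b ∧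
      ((∀ x : V3, 0 < x.2.2 → qk κ x ≤ F x ^ 2) ∨ (∀ x : V3, 0 < x.2.2 → F x ^ 2 ≤ qk κ x)) := by
    intro a b hab
    obtain ⟨t, h1, h2, h3⟩ := quad_generic hd hab
    refine ⟨t, h1, h2, dicho hk hF ?_⟩
    intro h4; apply h3
    unfold d0 d1 d2
    linear_combination h4
  set Sm : Set ℝ := {κ | ∀ x : V3, 0 < x.2.2 → qk κ x ≤ F x ^ 2} with hSm
  have he3 : 0 < F (0, 0, 1) := hF.sl.pos _ (by simp)
  have hq3 : ∀ κ, qk κ (0, 0, 1) = κ := by intro κ; simp [qk]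
  have hne : Sm.Nonempty := by
    obtain ⟨κ, h1, h2, h3⟩ := gen (-1) 0 (by norm_num)
    refine ⟨κ, h3.resolve_right ?_⟩
    intro h4
    have := h4 (0, 0, 1) (by norm_num)
    rw [hq3] at this
    nlinarith
  have hbd : BddAbove Sm := by
    refine ⟨F (0, 0, 1) ^ 2, fun κ hκ => ?_⟩
    have := hκ (0, 0, 1) (by norm_num)
    rwa [hq3] at this
  refine ⟨sSup Sm, fun x hx => le_antisymm ?_ ?_⟩
  · have h1 : sSup Sm ≤ (F x ^ 2 - x.1 ^ 2 - x.2.1 ^ 2) / x.2.2 ^ 2 := by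
      refine csSup_le hne fun κ hκ => ?_
      rw [le_div_iff₀ (by positivity)]
      have := hκ x hx
      unfold qk at this
      linarith
    rw [le_div_iff₀ (by positivity)] at h1
    unfold qk
    linarith
  · by_contra hc
    push Not at hc
    have h1 : sSup Sm < (F x ^ 2 - x.1 ^ 2 - x.2.1 ^ 2) / x.2.2 ^ 2 := by
      rw [lt_div_iff₀ (by positivity)]
      unfold qk at hc
      linarith
    obtain ⟨κ, h2, h3, h4⟩ := gen _ _ h1
    rcases h4 with h4 | h4
    · exact absurd (le_csSup hbd h4) (not_le.mpr h2)
    · have := h4 x hx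
      rw [lt_div_iff₀ (by positivity)] at h3
      unfold qk at this
      linarith

theorem hyp_neg (hF : k.Hyp F) : k.Hyp (fun x => F (-x)) where
  sl := {
    add := fun x y => by rw [neg_add]; exact hF.sl.add _ _
    smul := fun t x ht => by rw [← smul_neg]; exact hF.sl.smul _ _ ht
    pos := fun x hx => hF.sl.pos _ (neg_ne_zero.mpr hx)
    cont := hF.sl.cont.comp continuous_neg }
  circ x y := by
    have : -((x, y, 0) : V3) = (-x, -y, 0) := by simp
    rw [this, hF.circ]; simp
  adm x := by
    obtain ⟨p, a, b, c, d⟩ := hF.adm (-x)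
    refine ⟨-p, ?_, ?_, ?_, ?_⟩
    · intro y
      have := a (-y)
      simp only [neg_apply, map_sub, map_neg] at this ⊢
      linarith
    · have : k.Y1 (-x) = k.Y1 x := by ext <;> simp [Y1, P, J] <;> ring
      rw [this] at b; simp [b]
    · have : k.Y2 (-x) = k.Y2 x := by ext <;> simp [Y2, Q, J] <;> ring
      rw [this] at c; simp [c]
    · have : k.Y3 (-x) = k.Y3 x := by ext <;> simp [Y3, P, Q] <;> ring
      rw [this] at d; simp [d]

theorem quad_of_qk {κ : ℝ} (h : ∀ x, F x ^ 2 = qk κ x) : IsQuad F := by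
  refine ⟨LinearMap.mk₂ ℝ (fun x y : V3 => x.1 * y.1 + x.2.1 * y.2.1 + κ * (x.2.2 * y.2.2))
    ?_ ?_ ?_ ?_, fun x => ?_⟩
  · intros; simp; ring
  · intros; simp; ring
  · intros; simp; ring
  · intros; simp; ring
  · rw [h]; simp [qk]; ring

theorem lin_nondeg (hk : Lin k) (hF : k.Hyp F) (hd : ¬ (k.d0 = 0 ∧ k.d1 = 0 ∧ k.d2 = 0)) :
    IsQuad F := by
  obtain ⟨κ, h1⟩ := lin_up hk hF hd
  obtain ⟨κ', h2⟩ := lin_up hk (hyp_neg hF) hd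
  by_cases hκ : κ = κ'
  · subst hκ
    refine quad_of_qk (κ := κ) fun x => ?_
    rcases lt_trichotomy x.2.2 0 with h | h | h
    · have := h2 (-x) (by simpa using h)
      simp only [neg_neg] at this
      rw [← this]; simp [qk]
    · have e : x = (x.1, x.2.1, 0) := by ext <;> simp [h]
      rw [e, hF.circ, Real.sq_sqrt (by positivity)]
      simp [qk]
    · exact (h1 x h).symm
  · exfalso
    apply hd
    have c1 := crit_eq hk hF h1
    have c2 := crit_eq hk (hyp_neg hF) h2
    have a1 := c1 (0,0,1) (by norm_num)
    have a2 := c1 (1,0,1) (by norm_num)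
    have a3 := c1 (0,1,1) (by norm_num)
    have b1 := c2 (0,0,1) (by norm_num)
    have b2 := c2 (1,0,1) (by norm_num)
    have b3 := c2 (0,1,1) (by norm_num)
    simp only [E1, E2, mul_zero, mul_one, zero_add, add_zero] at a1 a2 a3 b1 b2 b3
    have hne := sub_ne_zero.mpr hκ
    have x7 : k.p7 = 0 := mul_left_cancel₀ hne (by linarith [a2.1, b2.1, a1.1, b1.1])
    have x8 : k.p8 = 0 := mul_left_cancel₀ hne (by linarith [a3.1, b3.1, a1.1, b1.1])
    have y7 : k.q7 = 0 := mul_left_cancel₀ hne (by linarith [a2.2, b2.2, a1.2, b1.2])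
    have y8 : k.q8 = 0 := mul_left_cancel₀ hne (by linarith [a3.2, b3.2, a1.2, b1.2])
    rw [x7] at a2
    rw [x8] at a3
    rw [y7] at a2
    rw [y8] at a3
    have x5 : k.p5 = 0 := by linarith [a2.1, a1.1]
    have x6 : k.p6 = 0 := by linarith [a3.1, a1.1]
    simp [d0, d1, d2, x7, x8, x5, x6]

end Par


theorem pencil1 {a b c d e f g h : ℝ} (h0 : a * d - b * c = 0) (h2 : e * h - f * g = 0)
    (h1 : a * h + e * d - b * g - f * c = 0) (ha : a ≠ 0) :
    (∃ m n : ℝ, (m ≠ 0 ∨ n ≠ 0) ∧ m * a + n * c = 0 ∧ m * b + n * d = 0 ∧ m * e + n * g = 0 ∧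
      m * f + n * h = 0) ∨
    (∃ m n : ℝ, (m ≠ 0 ∨ n ≠ 0) ∧ a * m + b * n = 0 ∧ c * m + d * n = 0 ∧ e * m + f * n = 0 ∧
      g * m + h * n = 0) := by
  have hd : d = b * c / a := by field_simp; linarith
  have hrs : (-c * e + a * g) * (-b * e + a * f) = 0 := by
    subst hd
    field_simp at h1
    have h3 : a ^ 2 * (e * h - f * g) = 0 := by rw [h2, mul_zero]
    linear_combination -h3 + e * h1
  rcases mul_eq_zero.mp hrs with r | s
  · refine Or.inl ⟨-c, a, Or.inr ha, by ring, by linarith, r, ?_⟩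
    refine mul_left_cancel₀ ha ?_
    linear_combination a * h1 + b * r - e * h0
  · refine Or.inr ⟨-b, a, Or.inr ha, by ring, by linarith, by linarith, ?_⟩
    refine mul_left_cancel₀ ha ?_
    linear_combination a * h1 + c * s - e * h0

theorem pencil {a b c d e f g h : ℝ} (h0 : a * d - b * c = 0) (h2 : e * h - f * g = 0)
    (h1 : a * h + e * d - b * g - f * c = 0) :
    (∃ m n : ℝ, (m ≠ 0 ∨ n ≠ 0) ∧ m * a + n * c = 0 ∧ m * b + n * d = 0 ∧ m * e + n * g = 0 ∧
      m * f + n * h = 0) ∨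
    (∃ m n : ℝ, (m ≠ 0 ∨ n ≠ 0) ∧ a * m + b * n = 0 ∧ c * m + d * n = 0 ∧ e * m + f * n = 0 ∧
      g * m + h * n = 0) := by
  by_cases ha : a = 0
  swap
  · exact pencil1 h0 h2 h1 ha
  by_cases hb : b = 0
  swap
  · rcases pencil1 (a := b) (b := a) (c := d) (d := c) (e := f) (f := e) (g := h) (h := g)
      (by linarith) (by linarith) (by linarith) hb with ⟨m, n, i, j, k, l, o⟩ | ⟨m, n, i, j, k, l, o⟩
    · exact Or.inl ⟨m, n, i, k, j, o, l⟩
    · exact Or.inr ⟨n, m, i.symm, by linarith, by linarith, by linarith, by linarith⟩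
  by_cases hc : c = 0
  swap
  · rcases pencil1 (a := c) (b := d) (c := a) (d := b) (e := g) (f := h) (g := e) (h := f)
      (by linarith) (by linarith) (by linarith) hc with ⟨m, n, i, j, k, l, o⟩ | ⟨m, n, i, j, k, l, o⟩
    · exact Or.inl ⟨n, m, i.symm, by linarith, by linarith, by linarith, by linarith⟩
    · exact Or.inr ⟨m, n, i, k, j, o, l⟩
  by_cases hd : d = 0
  swap
  · rcases pencil1 (a := d) (b := c) (c := b) (d := a) (e := h) (f := g) (g := f) (h := e)
      (by linarith) (by linarith) (by linarith) hd with ⟨m, n, i, j, k, l, o⟩ | ⟨m, n, i, j, k, l, o⟩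
    · exact Or.inl ⟨n, m, i.symm, by linarith, by linarith, by linarith, by linarith⟩
    · exact Or.inr ⟨n, m, i.symm, by linarith, by linarith, by linarith, by linarith⟩
  subst ha hb hc hd
  by_cases he : e = 0 ∧ g = 0
  · by_cases hf : f = 0 ∧ h = 0
    · exact Or.inl ⟨1, 0, by simp, by simp, by simp, by simp [he], by simp [hf]⟩
    · refine Or.inl ⟨-h, f, ?_, by simp, by simp, by simp [he], by ring⟩
      by_contra hc; push Not at hc; exact hf ⟨hc.2, neg_eq_zero.mp hc.1⟩
  · refine Or.inl ⟨-g, e, ?_, by simp, by simp, by ring, by linarith⟩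
    by_contra hc; push Not at hc; exact he ⟨hc.2, neg_eq_zero.mp hc.1⟩

namespace Par
variable {k : Par} {F : V3 → ℝ}

theorem dense_ne2 {l l' : V3 →L[ℝ] ℝ} (h : l ≠ 0) (h' : l' ≠ 0) : Dense {x | l x ≠ 0 ∧ l' x ≠ 0} := by
  have := (dense_ne l h).inter_of_isOpen_left (dense_ne l' h')
    (isOpen_ne_fun l.continuous continuous_const)
  exact this

theorem fun3_ne {a b c : ℝ} (h : a ≠ 0 ∨ b ≠ 0 ∨ c ≠ 0) : fun3 a b c ≠ 0 := by
  intro hc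
  have h1 := congrArg (fun l : V3 →L[ℝ] ℝ => l (1, 0, 0)) hc
  have h2 := congrArg (fun l : V3 →L[ℝ] ℝ => l (0, 1, 0)) hc
  have h3 := congrArg (fun l : V3 →L[ℝ] ℝ => l (0, 0, 1)) hc
  simp at h1 h2 h3
  tauto

theorem left_ker (hk : Lin k) (hF : k.Hyp F) {m n : ℝ} (hmn : m ≠ 0 ∨ n ≠ 0)
    (h5 : m * k.p5 + n * k.q5 = 0) (h6 : m * k.p6 + n * k.q6 = 0)
    (h7 : m * k.p7 + n * k.q7 = 0) (h8 : m * k.p8 + n * k.q8 = 0) : k.Kak F := by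
  have h9 : m * k.p9 + n * k.q9 = 0 := by
    obtain ⟨x, hx, e1, e2⟩ := crit_exists hk hF 1
    unfold E1 at e1
    unfold E2 at e2
    refine mul_right_cancel₀ hx.ne' ?_
    linear_combination m * e1 + n * e2 - x.1 * h5 - x.2.1 * h6 - x.1 * h7 - x.2.1 * h8
  refine ⟨0, {x | fun3 m n (m * k.p2 + n * k.q2) x ≠ 0 ∧ fun3 0 0 1 x ≠ 0}, ?_, ?_⟩
  · exact dense_ne2 (fun3_ne (by tauto)) (fun3_ne (by simp))
  · rintro x ⟨hx1, hx2⟩ p ⟨-, a1, a2, -⟩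
    simp only [fun3_apply] at hx1 hx2
    have hJ : p (J x) = 0 := by
      have e : m • k.Y1 x + n • k.Y2 x = (-(m * x.1 + n * x.2.1 + (m * k.p2 + n * k.q2) * x.2.2)) • J x := by
        ext
        · simp [Y1, Y2, P, Q, J, hk.e1, hk.g1]
          linear_combination x.2.2 ^ 2 * h5
        · simp [Y1, Y2, P, Q, J, hk.e3, hk.g3, hk.e4, hk.g4]
          linear_combination x.2.2 ^ 2 * h6
        · simp [Y1, Y2, P, Q, J]
          linear_combination x.2.2 ^ 2 * h9 + x.2.2 * x.1 * h7 + x.2.2 * x.2.1 * h8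
      have e2 := congrArg p e
      simp only [map_add, map_smul, a1, a2, smul_eq_mul] at e2
      have : (m * x.1 + n * x.2.1 + (m * k.p2 + n * k.q2) * x.2.2) * p (J x) = 0 := by linarith
      exact (mul_eq_zero.mp this).resolve_left hx1
    have hz : x.2.2 ≠ 0 := by simpa using hx2
    simp only [Y1, Y2, map_sub, map_smul, hJ, smul_eq_mul, mul_zero, sub_zero] at a1 a2
    refine ⟨?_, ?_, ?_⟩
    · simpa [hz] using a1
    · simpa [hz] using a2
    · simp [hJ]

theorem Lin.rot (hk : Lin k) {c s : ℝ} : Lin (k.rotP c s) := by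
  obtain ⟨e1, e4, e3, g1, g4, g3⟩ := hk
  constructor <;> simp only [rotP, e1, e4, e3, g1, g4, g3] <;> ring

theorem right_ker0 (hk : Lin k) (hF : k.Hyp F) (h5 : k.p5 = 0) (h7 : k.p7 = 0) (g5 : k.q5 = 0)
    (g7 : k.q7 = 0) : k.Kak F := by
  by_cases hΔ : k.p6 * k.q8 - k.p8 * k.q6 = 0
  · by_cases h6 : k.p6 = 0 ∧ k.q6 = 0
    · by_cases h8 : k.p8 = 0 ∧ k.q8 = 0
      · exact left_ker hk hF (m := 1) (n := 0) (by simp) (by simp [h5]) (by simp [h6]) (by simp [h7])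
          (by simp [h8])
      · refine left_ker hk hF (m := -k.q8) (n := k.p8) ?_ (by simp [h5, g5]) (by simp [h6])
          (by simp [h7, g7]) (by ring)
        by_contra hc; push Not at hc; exact h8 ⟨hc.2, neg_eq_zero.mp hc.1⟩
    · refine left_ker hk hF (m := -k.q6) (n := k.p6) ?_ (by simp [h5, g5]) (by ring)
          (by simp [h7, g7]) (by linarith)
      by_contra hc; push Not at hc; exact h6 ⟨hc.2, neg_eq_zero.mp hc.1⟩
  exfalso
  -- c = 0
  have hc : ∀ κ, (k.p6 * k.q9 - k.q6 * k.p9) * κ + (k.p8 * k.q9 - k.q8 * k.p9) * κ ^ 2 = 0 := by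
    intro κ
    obtain ⟨x, hx, e1, e2⟩ := crit_exists hk hF κ
    unfold E1 at e1
    unfold E2 at e2
    rw [h5, h7] at e1
    rw [g5, g7] at e2
    refine mul_right_cancel₀ hx.ne' ?_
    linear_combination (k.p6 + κ * k.p8) * e2 - (k.q6 + κ * k.q8) * e1
  have c1 := hc 1
  have c2 := hc (-1)
  have u1 : k.p6 * k.q9 - k.q6 * k.p9 = 0 := by linarith
  have u2 : k.p8 * k.q9 - k.q8 * k.p9 = 0 := by linarith
  have h9 : k.p9 = 0 := by
    refine mul_left_cancel₀ hΔ ?_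
    linear_combination k.p8 * u1 - k.p6 * u2
  have g9 : k.q9 = 0 := by
    refine mul_left_cancel₀ hΔ ?_
    linear_combination k.q8 * u1 - k.q6 * u2
  have key : ∀ t s : ℝ, det3 (k.Y1 (t, s, 1)) (k.Y2 (t, s, 1)) (t, s, 1) *
      det3 (k.Y1 (t, s, 1)) (k.Y2 (t, s, 1)) (k.DY1 (t, s, 1) (k.Y2 (t, s, 1)) - k.DY2 (t, s, 1) (k.Y1 (t, s, 1))) = 0 := by
    intro t s
    by_cases hd : det3 (k.Y1 (t, s, 1)) (k.Y2 (t, s, 1)) (t, s, 1) = 0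
    · rw [hd, zero_mul]
    · rw [integrQ hF.sl k.Y1_diff k.Y2_diff k.Y1_q k.Y2_q (fun x => by
        obtain ⟨p, a, b, c, d⟩ := hF.adm x
        exact ⟨p, a, b, c⟩) hd, mul_zero]
  have e1 : ∀ t s : ℝ, det3 (k.Y1 (t, s, 1)) (k.Y2 (t, s, 1)) (t, s, 1) =
     (-k.q8*t*s^3-k.q8*t^3*s+k.p8*s^4+k.p8*t^2*s^2)+(k.p8*k.q2-k.p2*k.q8)*(s^3+t^2*s)+(k.q6*t*s-k.p6*s^2+(k.p6*k.q8-k.p8*k.q6)*t*s)+(k.p2*k.q6-k.p6*k.q2)*s := by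
    intro t s
    simp [det3, Y1, Y2, P, Q, J, h5, h7, g5, g7, h9, g9, hk.e1, hk.e3, hk.e4, hk.g1, hk.g3, hk.g4]
    ring
  have e2 : ∀ t s : ℝ, det3 (k.Y1 (t, s, 1)) (k.Y2 (t, s, 1)) (k.DY1 (t, s, 1) (k.Y2 (t, s, 1)) - k.DY2 (t, s, 1) (k.Y1 (t, s, 1)))
      = -(k.p6 * k.q8 - k.p8 * k.q6) * s ^ 2 * (k.p6 + (k.p2*k.q8-k.q2-k.p8*k.q2) * s - (1+2*k.p8) * s ^ 2 - k.p2*t+2*k.q8*t*s-t^2) := by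
    intro t s
    simp [det3, Y1, Y2, DY1, DY2, P, Q, J, h5, h7, g5, g7, h9, g9, hk.e1, hk.e3, hk.e4, hk.g1, hk.g3, hk.g4]
    ring
  simp only [e1, e2] at key
  have key2 : ∀ s : ℝ, s ≠ 0 → k.q8 = 0 ∧ k.p8 * s + (k.p8*k.q2-k.p2*k.q8) = 0 := by
    intro s hs
    obtain ⟨a0, ha0⟩ : ∃ a, a = k.p8*s^3+(k.p8*k.q2-k.p2*k.q8)*s^2-k.p6*s+(k.p2*k.q6-k.p6*k.q2) := ⟨_, rfl⟩
    obtain ⟨a1, ha1⟩ : ∃ a, a = -k.q8*s^2 + k.q6+(k.p6*k.q8-k.p8*k.q6) := ⟨_, rfl⟩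
    obtain ⟨a2, ha2⟩ : ∃ a, a = k.p8 * s+(k.p8*k.q2-k.p2*k.q8) := ⟨_, rfl⟩
    obtain ⟨b0, hb0⟩ : ∃ a, a = k.p6 + (k.p2*k.q8-k.q2-k.p8*k.q2) * s - (1+2*k.p8) * s ^ 2 := ⟨_, rfl⟩
    obtain ⟨b1, hb1⟩ : ∃ a, a = 2*k.q8*s - k.p2 := ⟨_, rfl⟩
    have key2 : ∀ t : ℝ, a0 * b0 + (a0 * b1 + a1 * b0) * t + (-a0 + a1 * b1 + a2 * b0) * t ^ 2 +
        (-a1 + a2 * b1 - k.q8 * b0) * t ^ 3 + (-a2 - k.q8 * b1) * t ^ 4 + k.q8 * t ^ 5 = 0 := by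
      intro t
      refine mul_left_cancel₀ hΔ (mul_left_cancel₀ (pow_ne_zero 3 hs) ?_)
      rw [ha0, ha1, ha2, hb0, hb1]
      linear_combination -key t s
    obtain ⟨-, -, -, -, k4, k5⟩ := poly5 key2
    rw [k5] at k4
    exact ⟨k5, by rw [← ha2]; linarith⟩
  obtain ⟨i1, i2⟩ := key2 1 one_ne_zero
  obtain ⟨-, i3⟩ := key2 2 two_ne_zero
  have i4 : k.p8 = 0 := by linarith
  apply hΔ
  rw [i1, i4]; ring

theorem right_ker (hk : Lin k) (hF : k.Hyp F) {m n : ℝ} (hmn : m ≠ 0 ∨ n ≠ 0)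
    (h5 : k.p5 * m + k.p6 * n = 0) (h6 : k.q5 * m + k.q6 * n = 0)
    (h7 : k.p7 * m + k.p8 * n = 0) (h8 : k.q7 * m + k.q8 * n = 0) : k.Kak F := by
  have hpos : 0 < m ^ 2 + n ^ 2 := by
    rcases hmn with h | h
    · positivity
    · positivity
  set r := √(m ^ 2 + n ^ 2) with hr
  have hr0 : 0 < r := Real.sqrt_pos.mpr hpos
  have hr2 : r ^ 2 = m ^ 2 + n ^ 2 := Real.sq_sqrt hpos.le
  have h1 : (m / r) ^ 2 + (n / r) ^ 2 = 1 := by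
    rw [div_pow, div_pow, ← add_div, hr2, div_self hpos.ne']
  have R := rot_rel k (m / r) (n / r) h1
  have a5 : k.p5 * (m / r) + k.p6 * (n / r) = 0 := by field_simp; linarith
  have a6 : k.q5 * (m / r) + k.q6 * (n / r) = 0 := by field_simp; linarith
  have a7 : k.p7 * (m / r) + k.p8 * (n / r) = 0 := by field_simp; linarith
  have a8 : k.q7 * (m / r) + k.q8 * (n / r) = 0 := by field_simp; linarith
  refine R.kak (right_ker0 (Lin.rot hk) (R.hyp hF) ?_ ?_ ?_ ?_) <;> simp only [rotP]
  · linear_combination (m / r) * a5 + (n / r) * a6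
  · linear_combination (m / r) * a7 + (n / r) * a8
  · linear_combination (m / r) * a6 - (n / r) * a5
  · linear_combination (m / r) * a8 - (n / r) * a7

theorem lin_case (hk : Lin k) (hF : k.Hyp F) : IsQuad F ∨ k.Kak F := by
  by_cases hd : k.d0 = 0 ∧ k.d1 = 0 ∧ k.d2 = 0
  · right
    obtain ⟨h0, h1, h2⟩ := hd
    unfold d0 at h0
    unfold d1 at h1
    unfold d2 at h2
    rcases pencil (a := k.p5) (b := k.p6) (c := k.q5) (d := k.q6) (e := k.p7) (f := k.p8)
      (g := k.q7) (h := k.q8) (by linarith) (by linarith) (by linarith) with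
      ⟨m, n, i, j1, j2, j3, j4⟩ | ⟨m, n, i, j1, j2, j3, j4⟩
    · exact left_ker hk hF i j1 j2 j3 j4
    · exact right_ker hk hF i j1 j2 j3 j4
  · exact Or.inl (lin_nondeg hk hF hd)

end Par


theorem poly5_inf {c0 c1 c2 c3 c4 c5 : ℝ}
    (h : {t : ℝ | c0 + c1 * t + c2 * t ^ 2 + c3 * t ^ 3 + c4 * t ^ 4 + c5 * t ^ 5 = 0}.Infinite) :
    c0 = 0 ∧ c1 = 0 ∧ c2 = 0 ∧ c3 = 0 ∧ c4 = 0 ∧ c5 = 0 := by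
  open Polynomial in
  have h0 : (C c0 + C c1 * X + C c2 * X ^ 2 + C c3 * X ^ 3 + C c4 * X ^ 4 + C c5 * X ^ 5 : ℝ[X]) = 0 := by
    refine Polynomial.eq_zero_of_infinite_isRoot _ (h.mono ?_)
    intro t ht
    have ht' : c0 + c1 * t + c2 * t ^ 2 + c3 * t ^ 3 + c4 * t ^ 4 + c5 * t ^ 5 = 0 := ht
    simpa [Polynomial.IsRoot] using ht'
  refine poly5 fun t => ?_
  have := congrArg (Polynomial.eval t) h0
  simpa using this

theorem poly4t {c0 c1 c2 c3 c4 : ℝ}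
    (h : ∀ t : ℝ, c0 * t ^ 0 + c1 * t ^ 1 + c2 * t ^ 2 + c3 * t ^ 3 + c4 * t ^ 4 = 0) :
    c0 = 0 ∧ c1 = 0 ∧ c2 = 0 ∧ c3 = 0 ∧ c4 = 0 := by
  have := poly5 (c0 := c0) (c1 := c1) (c2 := c2) (c3 := c3) (c4 := c4) (c5 := 0)
    (fun t => by linear_combination h t)
  tauto

theorem poly3t {c0 c1 c2 c3 : ℝ}
    (h : ∀ t : ℝ, c0 * t ^ 0 + c1 * t ^ 1 + c2 * t ^ 2 + c3 * t ^ 3 = 0) :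
    c0 = 0 ∧ c1 = 0 ∧ c2 = 0 ∧ c3 = 0 := by
  have := poly5 (c0 := c0) (c1 := c1) (c2 := c2) (c3 := c3) (c4 := 0) (c5 := 0)
    (fun t => by linear_combination h t)
  tauto

namespace Par
variable {k : Par} {F : V3 → ℝ}

structure Exc (k : Par) : Prop where
  h4 : k.p4 = - k.p1
  g4 : k.q4 = - k.q1
  h3 : k.p3 = 2 * k.q1 - k.p2
  g3 : k.q3 = -2 * k.p1 - k.q2
  h7 : k.p7 = 0
  h8 : k.p8 = -3
  g7 : k.q7 = 3
  g8 : k.q8 = 0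

def gD (k : Par) (t z : ℝ) : ℝ := (-6*t^2 - 3 - 3*t^4) * z ^ 0 +
    (-15*k.p1*t - 3*k.p2*t^2 - 9*k.q1*t^2 - 1*k.q9*t^2 + 7*k.q1 - 3*k.p2 + 1*k.p1*t^3 - 1*k.q9 -
      3*k.q2*t^3 - 3*k.q2*t + 1*k.p9*t^3 + 1*k.p9*t) * z ^ 1 +
    (-2*k.p1^2 - 1*k.p1*k.q2 - 2*k.p1*k.q9*t - 2*k.p1*k.p2*t - 1*k.p2*k.q1*t^2 - 1*k.p2*k.q9*t^2 -
      4*k.p5*t + 4*k.q6*t - 2*k.q1^2 - 2*k.q1*k.q2*t + 2*k.q1*k.q9 + 1*k.p2*k.q1 - 1*k.p2*k.q9 +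
      1*k.p1*k.q2*t^2 - 1*k.p6*t^2 + 3*k.p6 + 1*k.q5 - 3*k.q5*t^2 + 2*k.p9*k.q1*t + 1*k.p9*k.q2*t^2 +
      2*k.p1*k.p9 + 1*k.p9*k.q2) * z ^ 2 +
    (1*k.p1*k.q6 + 1*k.p2*k.q6*t - 2*k.p1*k.p5 - 1*k.p5*k.q2 - 1*k.p5*k.q1*t - 1*k.p5*k.q9*t -
      2*k.q1*k.q5 + 1*k.p2*k.q5 + 1*k.p1*k.q5*t - 1*k.p6*k.q1 - 1*k.p6*k.q2*t + 1*k.p6*k.q9 +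
      1*k.p9*k.q5*t - 1*k.p9*k.q6) * z ^ 3 +
    (1*k.p5*k.q6 - 1*k.p6*k.q5) * z ^ 4

def gI3 (k : Par) (t : ℝ) : ℝ := (6*k.p1*k.q1 - 15*k.p1*k.p2 + 3*k.p1*k.q9 + 15*k.p5 - 9*k.q1*k.q2 - 5*k.p9*k.q1 + 3*k.q6) * t ^ 0 +
    (12*k.p1^2 + 12*k.p1*k.q2 + 12*k.p1*k.p9 - 36*k.p2*k.q1 + 36*k.q1^2 + 12*k.q5 + 12*k.p6 + 4*k.q1*k.q9) * t ^ 1 +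
    (6*k.p1*k.q9 - 36*k.p1*k.q1 - 18*k.q1*k.q2 + 6*k.p9*k.q1 + 18*k.q6 + 18*k.p1*k.p2 + 18*k.p5) * t ^ 2 +
    (-12*k.p2*k.q1 + 12*k.q1^2 + 12*k.q1*k.q9 + 36*k.p1^2 + 36*k.p1*k.q2 + 4*k.p1*k.p9 + 12*k.p6 +
      12*k.q5) * t ^ 3 +
    (9*k.p1*k.p2 + 6*k.p1*k.q1 - 5*k.p1*k.q9 + 15*k.q1*k.q2 + 3*k.p5 + 15*k.q6 + 3*k.p9*k.q1) * t ^ 4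

def gI4 (k : Par) (t : ℝ) : ℝ := (18*k.p1^3 + 15*k.p1^2*k.q2 + 10*k.p1^2*k.p9 + 3*k.p1*k.q2^2 + 5*k.p1*k.p9*k.q2 + 18*k.p1*k.q1^2 +
      3*k.p1*k.p2*k.q1 - 6*k.p1*k.q5 + 18*k.p1*k.p6 + 3*k.p1*k.q1*k.q9 - 5*k.p1*k.p2*k.q9 - 21*k.p5*k.q1 +
      6*k.p2*k.p5 + 11*k.p5*k.q9 + 18*k.q1^2*k.q2 + 7*k.p9*k.q1^2 - 3*k.q1*k.q6 - 9*k.p2*k.q1*k.q2 -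
      2*k.p2*k.p9*k.q1 - 6*k.p1*k.p2^2 + 6*k.p2*k.q6 - 3*k.q2*k.q5 - 8*k.p9*k.q5 - 3*k.p6*k.q2 -
      2*k.q1*k.q2*k.q9 + 1*k.q6*k.q9 - 1*k.p9*k.q1*k.q9 + 1*k.p1*k.q9^2) * t ^ 0 +
    (18*k.p1^2*k.q1 + 11*k.p1^2*k.q9 + 9*k.p1*k.p2*k.q2 - 9*k.p1*k.q1*k.q2 + 6*k.p1*k.q2*k.q9 +
      9*k.p1*k.q6 + 6*k.p1*k.p2*k.p9 + 9*k.p2*k.q1^2 - 9*k.p2^2*k.q1 + 3*k.p2*k.q5 + 3*k.p2*k.p6 -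
      15*k.p2*k.q1*k.q9 + 39*k.p1*k.p5 + 12*k.p5*k.q2 - 3*k.p5*k.p9 - 9*k.p9*k.q6 - 30*k.q1*k.q5 +
      42*k.p6*k.q1 + 10*k.p6*k.q9 + 20*k.q1^2*k.q9 + 2*k.q5*k.q9 + 1*k.p1*k.p9*k.q9 + 2*k.q1*k.q9^2 +
      18*k.q1^3 + 15*k.p9*k.q1*k.q2 + 9*k.p1*k.p9*k.q1 + 1*k.p9^2*k.q1) * t ^ 1 +
    (-9*k.p1*k.p2*k.q1 - 9*k.p1*k.q1*k.q9 + 15*k.p1*k.p2*k.q9 - 9*k.p2*k.q1*k.q2 + 6*k.p2*k.p9*k.q1 +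
      12*k.p2*k.q6 + 9*k.p5*k.q9 + 9*k.p5*k.q1 + 15*k.q1*k.q6 + 3*k.q6*k.q9 - 1*k.p9*k.q1*k.q9 -
      1*k.p1*k.q9^2 + 18*k.q1^2*k.q2 + 27*k.p1^2*k.q2 + 9*k.p1*k.q2^2 - 15*k.p1*k.p9*k.q2 + 48*k.p1*k.q5 -
      24*k.p1*k.p6 + 3*k.p6*k.q2 - 2*k.p6*k.p9 + 3*k.q2*k.q5 + 6*k.q1*k.q2*k.q9 - 10*k.p9*k.q5 -
      1*k.p9*k.q1^2 - 10*k.p1^2*k.p9 - 2*k.p1*k.p9^2) * t ^ 2 +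
    (-3*k.p2^2*k.q1 - 3*k.p2*k.q1^2 + 5*k.p2*k.q1*k.q9 + 9*k.p1*k.p2*k.q2 + 3*k.p1*k.q1*k.q2 -
      2*k.p1*k.q2*k.q9 + 9*k.p1*k.p5 - 9*k.p1*k.q6 + 3*k.p1^2*k.q9 - 3*k.p2*k.p6 + 8*k.p6*k.q9 +
      6*k.p5*k.q2 + 6*k.q1*k.q2^2 + 6*k.q2*k.q6 + 24*k.q1*k.q5 - 3*k.p2*k.q5 - 11*k.p9*k.q6 -
      5*k.p9*k.q1*k.q2 - 2*k.p1*k.p2*k.p9 - 1*k.p5*k.p9 - 1*k.p9^2*k.q1 + 1*k.p1*k.p9*k.q9 -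
      3*k.p1*k.p9*k.q1) * t ^ 3

def gI5 (k : Par) (t : ℝ) : ℝ := (-12*k.p1^2*k.q6 - 6*k.p1*k.q2*k.q6 - 10*k.p1*k.p9*k.q6 + 6*k.p1*k.q1*k.q5 - 3*k.p1*k.p2*k.q5 +
      6*k.p1*k.p6*k.q1 + 9*k.p1*k.p6*k.q9 + 4*k.p1^3*k.q9 + 2*k.p1^2*k.q2*k.q9 + 4*k.p1*k.q1^2*k.q9 +
      2*k.p1*k.p2*k.q1*k.q9 - 1*k.p1*k.q5*k.q9 + 18*k.p1^2*k.p5 + 15*k.p1*k.p5*k.q2 + 3*k.p5*k.q2^2 +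
      12*k.p5*k.q1^2 - 6*k.p2*k.p5*k.q1 - 3*k.p5*k.q5 + 3*k.p5*k.p6 - 14*k.p5*k.q1*k.q9 + 5*k.p2*k.p5*k.q9
      - 6*k.q1^2*k.q6 + 6*k.q1*k.q2*k.q5 + 15*k.p9*k.q1*k.q5 + 15*k.p6*k.q1*k.q2 - 3*k.p2*k.q1*k.q6 +
      4*k.q1^2*k.q2*k.q9 - 2*k.q1*k.q6*k.q9 - 3*k.p2*k.q2*k.q5 - 5*k.p2*k.p9*k.q5 - 3*k.p2*k.p6*k.q2 +
      3*k.p2^2*k.q6 - 2*k.p2*k.q1*k.q2*k.q9 - 2*k.p1*k.p2^2*k.q9 + 2*k.p2*k.q6*k.q9 - 1*k.p6*k.p9*k.q1 +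
      6*k.p1*k.p2*k.p6 - 3*k.p6*k.q6 + 3*k.q5*k.q6 - 1*k.p6*k.q2*k.q9 - 2*k.p9*k.q5*k.q9 + 2*k.p5*k.q9^2 -
      4*k.p1^2*k.p9*k.q1 + 2*k.p1*k.p9*k.q1*k.q2 - 4*k.p9*k.q1^3 + 2*k.p2*k.p9*k.q1^2 + 4*k.p1^2*k.p2*k.p9
      + 2*k.p9*k.q1*k.q2^2 + 2*k.p1*k.p2*k.p9*k.q2 - 1*k.p9*k.q2*k.q6) * t ^ 0 +
    (6*k.p1*k.p5*k.q1 - 6*k.p1*k.q1*k.q6 + 6*k.p1*k.p2*k.q6 + 4*k.p1^2*k.p2*k.q9 - 4*k.p1*k.q1*k.q2*k.q9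
      - 6*k.p2*k.p9*k.q6 - 12*k.p2*k.q1*k.q5 + 6*k.p2*k.p6*k.q1 + 4*k.p2*k.p6*k.q9 + 4*k.p1*k.p2*k.q2*k.q9
      + 8*k.p2*k.q1^2*k.q9 - 4*k.p2^2*k.q1*k.q9 - 2*k.p2*k.q5*k.q9 + 6*k.p5*k.q1*k.q2 + 16*k.p6*k.q1*k.q9
      - 2*k.p9*k.q6*k.q9 + 2*k.p6*k.q9^2 + 24*k.q1^2*k.q5 + 6*k.p1*k.q2*k.q5 - 24*k.p1*k.p9*k.q5 -
      12*k.p1*k.p6*k.q2 + 24*k.p1*k.p5*k.q9 + 6*k.p6*k.q1^2 + 2*k.p6*k.p9*k.q2 + 6*k.p6^2 -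
      12*k.p9*k.q1*k.q6 + 18*k.p1^2*k.q5 - 6*k.q5^2 - 4*k.p9*k.q2*k.q5 + 6*k.p5*k.q2*k.q9 +
      4*k.p1*k.p2*k.p9*k.q1 - 4*k.p9*k.q1^2*k.q2 - 8*k.p1^2*k.p9*k.q2 - 4*k.p1*k.p9*k.q2^2 +
      4*k.p2*k.p9*k.q1*k.q2 + 4*k.p1*k.p6*k.p9 + 2*k.p9^2*k.q5 - 2*k.p5*k.p9*k.q9) * t ^ 1 +
    (-6*k.p2*k.p5*k.q1 + 3*k.p2*k.q1*k.q6 + 3*k.p2^2*k.q6 + 2*k.p1*k.p2^2*k.q9 + 1*k.p2*k.p5*k.q9 +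
      2*k.p2*k.q1*k.q2*k.q9 + 8*k.p5*k.q1*k.q9 + 9*k.p1*k.p5*k.q2 - 6*k.p1*k.q2*k.q6 + 9*k.p1*k.p2*k.q5 +
      1*k.p1*k.q5*k.q9 - 2*k.p1*k.p2*k.q1*k.q9 + 2*k.p1^2*k.q2*k.q9 - 5*k.p1*k.p6*k.q9 - 3*k.p2*k.p6*k.q2
      + 3*k.p6*k.q1*k.q2 + 5*k.p6*k.q2*k.q9 - 3*k.p5*k.p6 + 3*k.p6*k.q6 + 3*k.p5*k.q2^2 +
      12*k.q1*k.q2*k.q5 - 3*k.p2*k.q2*k.q5 - 5*k.p9*k.q2*k.q6 + 3*k.p5*k.q5 - 3*k.q5*k.q6 -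
      11*k.p9*k.q1*k.q5 - 2*k.p1*k.p2*k.p9*k.q2 - 2*k.p5*k.p9*k.q2 - 2*k.p9*k.q1*k.q2^2 - 2*k.p1*k.p5*k.p9
      + 1*k.p2*k.p9*k.q5 + 1*k.p6*k.p9*k.q1 + 4*k.p1*k.p9*k.q6 + 2*k.p9^2*k.q6 - 2*k.p6*k.p9*k.q9 +
      2*k.p2*k.p9*k.q1^2 - 2*k.p1*k.p9*k.q1*k.q2) * t ^ 2

def gI6 (k : Par) (t : ℝ) : ℝ := (-9*k.p1*k.p5*k.q6 + 3*k.p1*k.q6^2 + 6*k.p1^2*k.p5*k.q9 + 3*k.p1*k.p5*k.q2*k.q9 +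
      1*k.p1*k.p6*k.q1*k.q9 - 1*k.p1^2*k.q6*k.q9 - 1*k.p1*k.p9*k.q6*k.q9 + 1*k.p1*k.p6*k.q9^2 -
      6*k.p5*k.q2*k.q6 - 3*k.p5*k.p9*k.q6 + 3*k.p5*k.p6*k.q1 + 1*k.p5*k.p6*k.q9 + 6*k.p5*k.q1^2*k.q9 -
      3*k.p2*k.p5*k.q1*k.q9 - 2*k.p5*k.q5*k.q9 - 2*k.p1*k.p5*k.p9*k.q9 - 1*k.p5*k.p9*k.q2*k.q9 -
      2*k.p5*k.q1*k.q9^2 + 1*k.p2*k.p5*k.q9^2 - 6*k.q1*k.q5*k.q6 + 4*k.p6*k.q1*k.q2*k.q9 -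
      2*k.p2*k.q1*k.q6*k.q9 + 2*k.p9*k.q1*k.q5*k.q9 + 3*k.p2*k.q5*k.q6 - 1*k.p2*k.p6*k.q2*k.q9 +
      1*k.p2^2*k.q6*k.q9 - 1*k.p2*k.p9*k.q5*k.q9 - 3*k.p6*k.q1*k.q6 + 3*k.p6*k.q2*k.q5 + 2*k.p6*k.p9*k.q5
      + 3*k.p6^2*k.q2 - 3*k.p2*k.p6*k.q6 + 2*k.p1*k.p2*k.p6*k.q9 - 1*k.p6*k.q6*k.q9 -
      1*k.p6*k.p9*k.q1*k.q9 - 6*k.p9*k.q1^2*k.q5 + 3*k.p2*k.p9*k.q1*k.q5 - 1*k.p6*k.p9*k.q1^2 +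
      1*k.p1*k.p9*k.q1*k.q6 + 1*k.p9^2*k.q1*k.q6 - 6*k.p1^2*k.p9*k.q5 - 3*k.p1*k.p9*k.q2*k.q5 +
      2*k.p9*k.q5^2 + 2*k.p1*k.p9^2*k.q5 + 1*k.p9^2*k.q2*k.q5 + 2*k.p1*k.p6*k.p9*k.q2 -
      4*k.p1*k.p2*k.p9*k.q6 + 1*k.p6*k.p9*k.q2^2 - 1*k.p2*k.p9*k.q2*k.q6 - 2*k.p9*k.q1*k.q2*k.q6 +
      1*k.p9*k.q6^2) * t ^ 0 +
    (6*k.p2*k.p5*k.q6 + 4*k.p1*k.p2*k.p5*k.q9 + 1*k.p2*k.p5*k.q2*k.q9 + 2*k.p2*k.q1*k.q5*k.q9 -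
      1*k.p2^2*k.q5*k.q9 + 3*k.p2*k.p6*k.q1*k.q9 - 1*k.p2*k.p9*k.q6*k.q9 + 1*k.p2*k.p6*k.q9^2 -
      3*k.p5^2*k.q1 - 3*k.p5*k.q1*k.q6 - 3*k.p5*k.q6*k.q9 + 1*k.p5^2*k.q9 + 2*k.p5*k.q1*k.q2*k.q9 -
      1*k.p5*k.p9*k.q1*k.q9 + 1*k.p1*k.p5*k.q9^2 + 9*k.p1*k.p5*k.q5 - 3*k.p1*k.q5*k.q6 -
      1*k.p1*k.p5*k.q1*k.q9 + 1*k.p1^2*k.q5*k.q9 - 3*k.p1*k.p6*k.q2*k.q9 - 1*k.p1*k.p9*k.q5*k.q9 -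
      3*k.p5*k.p6*k.q2 - 3*k.p2*k.p6*k.q5 + 6*k.p6*k.q1*k.q5 + 2*k.p6*k.q5*k.q9 + 2*k.p6^2*k.q9 -
      1*k.p6*k.p9*k.q2*k.q9 + 3*k.p5*k.q2*k.q5 + 6*k.q1*k.q5^2 - 3*k.p2*k.q5^2 - 2*k.p1*k.p5*k.p9*k.q2 -
      1*k.p5*k.p9*k.q2^2 - 4*k.p9*k.q1*k.q2*k.q5 + 1*k.p2*k.p9*k.q2*k.q5 + 3*k.p1*k.p9*k.q2*k.q6 +
      1*k.p9^2*k.q2*k.q6 - 2*k.p1*k.p2*k.p9*k.q5 - 1*k.p5*k.p9*k.q5 + 1*k.p9*k.q5*k.q6 +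
      1*k.p9^2*k.q1*k.q5 + 1*k.p5*k.p9*k.q1^2 - 1*k.p1*k.p9*k.q1*k.q5 - 3*k.p2*k.p9*k.q1*k.q6 -
      2*k.p6*k.p9*k.q6) * t ^ 1

def gI7 (k : Par) (t : ℝ) : ℝ := (3*k.p5^2*k.q6 + 3*k.p5*k.q6^2 + 2*k.p1*k.p5^2*k.q9 + 1*k.p5^2*k.q2*k.q9 + 2*k.p5*k.q1*k.q5*k.q9 -
      1*k.p2*k.p5*k.q5*k.q9 + 2*k.p5*k.p6*k.q1*k.q9 - 1*k.p1*k.p5*k.q6*k.q9 - 3*k.p5*k.p6*k.q5 -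
      3*k.p6*k.q5*k.q6 - 1*k.p1*k.p6*k.q5*k.q9 + 1*k.p6^2*k.q2*k.q9 - 1*k.p2*k.p6*k.q6*k.q9 -
      2*k.p1*k.p5*k.p9*k.q5 - 1*k.p5*k.p9*k.q2*k.q5 - 2*k.p9*k.q1*k.q5^2 + 1*k.p2*k.p9*k.q5^2 -
      1*k.p6*k.p9*k.q1*k.q5 + 2*k.p1*k.p9*k.q5*k.q6 - 1*k.p5*k.p9*k.q1*k.q6 - 1*k.p6*k.p9*k.q2*k.q6 +
      1*k.p2*k.p9*k.q6^2) * t ^ 0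

theorem exc_D (h : Exc k) (t z : ℝ) :
    det3 (k.Y1 (1, t, z)) (k.Y2 (1, t, z)) (1, t, z) = z * k.gD t z := by
  simp only [det3, Y1, Y2, P, Q, J, Prod.fst_sub, Prod.snd_sub, Prod.smul_fst, Prod.smul_snd,
    smul_eq_mul, h.h4, h.g4, h.h3, h.g3, h.h7, h.h8, h.g7, h.g8, gD]
  ring

theorem exc_I (h : Exc k) (t z : ℝ) :
    det3 (k.Y1 (1, t, z)) (k.Y2 (1, t, z))
      (k.DY1 (1, t, z) (k.Y2 (1, t, z)) - k.DY2 (1, t, z) (k.Y1 (1, t, z))) =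
      - z ^ 3 * (k.gI3 t + k.gI4 t * z + k.gI5 t * z ^ 2 + k.gI6 t * z ^ 3 + k.gI7 t * z ^ 4 + 0 * z ^ 5) := by
  simp only [det3, Y1, Y2, DY1, DY2, P, Q, J, Prod.fst_sub, Prod.snd_sub, Prod.smul_fst, Prod.smul_snd,
    Prod.fst_add, Prod.snd_add,
    smul_eq_mul, h.h4, h.g4, h.h3, h.g3, h.h7, h.h8, h.g7, h.g8, gI3, gI4, gI5, gI6, gI7]
  ring

theorem exc_coef (hF : k.Hyp F) (h : Exc k) (t : ℝ) : k.gI3 t = 0 ∧ k.gI4 t = 0 := by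
  have hcont : Continuous (fun z => k.gD t z) := by unfold gD; fun_prop
  have h0 : k.gD t 0 ≠ 0 := by
    have : k.gD t 0 = -3 * (1 + t ^ 2) ^ 2 := by unfold gD; ring
    rw [this]
    have : 0 < (1 + t ^ 2) ^ 2 := by positivity
    linarith
  have hev : ∀ᶠ z in 𝓝 (0 : ℝ), k.gD t z ≠ 0 := hcont.continuousAt.eventually_ne h0
  obtain ⟨δ, hδ, hδ2⟩ := Metric.eventually_nhds_iff.mp hev
  have := poly5_inf (c0 := k.gI3 t) (c1 := k.gI4 t) (c2 := k.gI5 t) (c3 := k.gI6 t) (c4 := k.gI7 t)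
    (c5 := 0) ((Set.Ioo_infinite hδ).mono ?_)
  · exact ⟨this.1, this.2.1⟩
  · intro z hz
    have hz0 : z ≠ 0 := hz.1.ne'
    have hd : det3 (k.Y1 (1, t, z)) (k.Y2 (1, t, z)) (1, t, z) ≠ 0 := by
      rw [exc_D h]
      refine mul_ne_zero hz0 (hδ2 ?_)
      rw [Real.dist_eq, sub_zero, abs_of_pos hz.1]; exact hz.2
    have i := integrQ hF.sl k.Y1_diff k.Y2_diff k.Y1_q k.Y2_q (fun x => by
        obtain ⟨p, a, b, c, d⟩ := hF.adm x
        exact ⟨p, a, b, c⟩) hd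
    rw [exc_I h] at i
    exact (mul_eq_zero.mp i).resolve_left (neg_ne_zero.mpr (pow_ne_zero 3 hz0))

theorem exc_pos (hF : k.Hyp F) (h : Exc k) (hne : k.p1 ≠ 0 ∨ k.q1 ≠ 0) :
    k.p9 = 3 * (k.q2 + k.p1) ∧ k.q9 = 3 * (k.q1 - k.p2) ∧
    k.p6 + k.q5 = -4 * (k.q1 * (k.q1 - k.p2) + k.p1 * (k.q2 + k.p1)) ∧
    24 * (k.q5 - k.p6) = 36 * ((k.q2 + k.p1) ^ 2 + (k.q1 - k.p2) ^ 2) + 12 * (k.p1 ^ 2 + k.q1 ^ 2) := by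
  have a := fun t => (exc_coef hF h t).1
  have b := fun t => (exc_coef hF h t).2
  unfold gI3 at a
  unfold gI4 at b
  obtain ⟨a0, a1, a2, a3, a4⟩ := poly4t a
  obtain ⟨b0, b1, b2, b3⟩ := poly3t b
  have hpq : 0 < k.p1 ^ 2 + k.q1 ^ 2 := by
    rcases hne with h | h <;> positivity
  have u1 : k.p1 * (3 * (k.q1 - k.p2) - k.q9) + k.q1 * (3 * (k.q2 + k.p1) - k.p9) = 0 := by
    linear_combination (a0 + a4 - a2) / 8
  have u2 : k.p1 * (3 * (k.q2 + k.p1) - k.p9) - k.q1 * (3 * (k.q1 - k.p2) - k.q9) = 0 := by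
    linear_combination (a3 - a1) / 8
  have v1 : k.p9 = 3 * (k.q2 + k.p1) := by
    have : (k.p1 ^ 2 + k.q1 ^ 2) * (3 * (k.q2 + k.p1) - k.p9) = 0 := by
      linear_combination k.q1 * u1 + k.p1 * u2
    have := (mul_eq_zero.mp this).resolve_left hpq.ne'
    linarith
  have v2 : k.q9 = 3 * (k.q1 - k.p2) := by
    have : (k.p1 ^ 2 + k.q1 ^ 2) * (3 * (k.q1 - k.p2) - k.q9) = 0 := by
      linear_combination k.p1 * u1 - k.q1 * u2
    have := (mul_eq_zero.mp this).resolve_left hpq.ne'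
    linarith
  have v3 : k.p6 = - k.q5 -4 * (k.q1 * (k.q1 - k.p2) + k.p1 * (k.q2 + k.p1)) := by
    rw [v1, v2] at a1
    linear_combination a1 / 12
  have v4 : k.p5 = 2 * k.q1 * (k.q2 + k.p1) - 2 * k.p1 * (k.q1 - k.p2) := by
    rw [v1, v2] at a0 a4
    linear_combination (a0 * 5 - a4) / 72
  have v5 : k.q6 = -(2 * k.q1 * (k.q2 + k.p1) - 2 * k.p1 * (k.q1 - k.p2)) := by
    rw [v1, v2] at a0 a4
    linear_combination (a4 * 5 - a0) / 72
  refine ⟨v1, v2, by linarith, ?_⟩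
  rw [v1, v2, v3, v4, v5] at b0 b1 b2 b3
  rw [v3]
  rcases hne with hn | hn
  · refine mul_left_cancel₀ hn ?_
    linear_combination (b2 - b0) / 2
  · refine mul_left_cancel₀ hn ?_
    linear_combination (b3 - b1) / 2

end Par


theorem SL.second_order {V : Type*} [NormedAddCommGroup V] [NormedSpace ℝ V]
    [FiniteDimensional ℝ V] {F : V → ℝ}
    (h : SL F) {Y : V → V} (hY : Continuous Y) {DY : V → V → V}
    (hDY : ∀ x v (t : ℝ), Y (x + t • v) = Y x + t • DY x v + t ^ 2 • Y v)
    (hlin : ∀ x v w (t : ℝ), DY x (v + t • w) = DY x v + t • DY x w)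
    (hp : ∀ x, ∃ p, IsSub F x p ∧ p (Y x) = 0) {l : V →L[ℝ] ℝ} (hl : ∀ x, l x ≤ F x) {x0 : V}
    (h0 : l x0 = F x0) (h1 : l (Y x0) = 0) : l (DY x0 (Y x0)) ≤ 0 := by
  obtain ⟨C, hC, hC2⟩ := h.sub_bound
  choose p hp1 hp2 using hp
  set Y0 := Y x0 with hY0
  set D := DY x0 Y0 with hD
  set c : ℝ → V := fun t => x0 + t • (Y0 + (t / 2) • D) with hc
  set R : ℝ → V := fun t => (1 / 2 : ℝ) • DY x0 D + Y (Y0 + (t / 2) • D) with hR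
  have hYc : ∀ t, Y (c t) = Y0 + t • D + t ^ 2 • R t := by
    intro t
    simp only [hc, hR]
    rw [hDY, hlin, ← hY0, ← hD]
    module
  have hRc : Continuous R := by
    simp only [hR]
    fun_prop
  have hcc : Continuous c := by simp only [hc]; fun_prop
  obtain ⟨M, hM⟩ := (isCompact_Icc (a := (0 : ℝ)) (b := 1)).exists_bound_of_continuousOn hRc.continuousOn
  have hM0 : 0 ≤ M := (norm_nonneg _).trans (hM 0 (by simp))
  set N := C * M with hN
  have hN0 : 0 ≤ N := by positivity
  have hpv : ∀ s ∈ Set.Icc (0 : ℝ) 1, p (c s) (Y0 + s • D) ≤ N * s ^ 2 := by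
    intro s hs
    have e := hp2 (c s)
    rw [hYc, map_add, map_smul, smul_eq_mul] at e
    have e2 : |p (c s) (R s)| ≤ C * M := by
      refine ((p (c s)).le_opNorm _).trans ?_
      gcongr
      · exact hC2 _ _ (hp1 _)
      · exact hM s hs
    rw [abs_le] at e2
    have : 0 ≤ s ^ 2 := by positivity
    nlinarith
  have hbd : ∀ x ∈ Set.Icc (0 : ℝ) 1, F (c x) ≤ F x0 + N / 3 * x ^ 3 := by
    have := image_le_of_liminf_slope_right_le_deriv_boundary (f := fun t => F (c t)) (a := 0) (b := 1)
      (h.cont.comp hcc).continuousOn (B := fun x => F x0 + N / 3 * x ^ 3) (B' := fun x => N * x ^ 2)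
      (by simp [hc]) (by fun_prop) ?_ ?_
    · exact fun x hx => this hx
    · intro x hx
      have h3 : HasDerivAt (fun x : ℝ => F x0 + N / 3 * x ^ 3) (N / 3 * (3 * x ^ 2)) x := by
        simpa using ((hasDerivAt_pow 3 x).const_mul (N / 3)).const_add (F x0)
      have e : N / 3 * (3 * x ^ 2) = N * x ^ 2 := by ring
      rw [e] at h3
      exact h3.hasDerivWithinAt
    · intro t ht r hr
      set C' := C * ‖D‖ with hC'
      have hlim : Tendsto (fun s : ℝ => N * s ^ 2 + C' * (s - t)) (𝓝[>] t) (𝓝 (N * t ^ 2)) := by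
        have : ContinuousAt (fun s : ℝ => N * s ^ 2 + C' * (s - t)) t := by fun_prop
        have h4 := this.tendsto
        simp only [sub_self, mul_zero, add_zero] at h4
        exact h4.mono_left nhdsWithin_le_nhds
      have hev := hlim.eventually (gt_mem_nhds hr)
      have h5 : Set.Ioc t 1 ∈ 𝓝[>] t := Ioc_mem_nhdsGT ht.2
      refine Eventually.frequently ?_
      filter_upwards [hev, h5] with s hs hs2
      have hst : 0 < s - t := by linarith [hs2.1]
      refine lt_of_le_of_lt ?_ hs
      rw [slope_def_field, div_le_iff₀ hst]
      have i := hp1 (c s) (c t)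
      have e : c t - c s = -((s - t) • (Y0 + s • D)) + ((s - t) ^ 2 / 2) • D := by
        simp only [hc]; module
      rw [e, map_add, map_neg, map_smul, map_smul, smul_eq_mul, smul_eq_mul] at i
      have i2 := hpv s ⟨by linarith [ht.1], hs2.2⟩
      have i3 : |p (c s) D| ≤ C' := ((p (c s)).le_opNorm _).trans (by
        rw [hC']; gcongr; exact hC2 _ _ (hp1 _))
      rw [abs_le] at i3
      have i4 : (s - t) * p (c s) (Y0 + s • D) ≤ (s - t) * (N * s ^ 2) := by gcongr
      have i5 : (s - t) ^ 2 / 2 * (-C') ≤ (s - t) ^ 2 / 2 * p (c s) D := by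
        gcongr; exact i3.1
      have i6 : 0 ≤ C' := by positivity
      nlinarith [mul_nonneg i6 (sq_nonneg (s - t))]
  have hfin : ∀ t ∈ Set.Ioc (0 : ℝ) 1, l D ≤ 2 * N / 3 * t := by
    intro t ht
    have i1 := hbd t ⟨ht.1.le, ht.2⟩
    have i2 := hl (c t)
    have e : l (c t) = F x0 + t * (t / 2 * l D) := by
      simp only [hc, map_add, map_smul, h1, h0, smul_eq_mul]; ring
    rw [e] at i2
    have : t ^ 2 * l D ≤ t ^ 2 * (2 * N / 3 * t) := by nlinarith
    exact le_of_mul_le_mul_left this (by have := ht.1; positivity)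
  by_contra hneg
  push Not at hneg
  have hN1 : 0 < 2 * N / 3 + 1 + l D := by positivity
  have := hfin (l D / (2 * N / 3 + 1 + l D)) ⟨by positivity, by
    rw [div_le_one hN1]; linarith [show 0 ≤ 2 * N / 3 by positivity]⟩
  rw [mul_div_assoc', le_div_iff₀ hN1] at this
  nlinarith

namespace Par
variable {k : Par} {F : V3 → ℝ}

theorem pole_min (hF : k.Hyp F) (h7 : k.p7 = 0) (h8 : k.p8 = -3) (g7 : k.q7 = 3) (g8 : k.q8 = 0)
    (h9 : k.p9 = 0) (g9 : k.q9 = 0) (x : V3) : F (0, 0, 1) * x.2.2 ≤ F x := by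
  have hcont : ContinuousOn (fun x : V3 => x.2.2 / F x) (Metric.sphere 0 1) := by
    refine ContinuousOn.div (by fun_prop) hF.sl.cont.continuousOn ?_
    intro x hx h0
    have : x ≠ 0 := by rintro rfl; simp at hx
    exact (hF.sl.pos x this).ne' h0
  obtain ⟨X, hX, hmax⟩ := (isCompact_sphere (0 : V3) 1).exists_isMaxOn
    (NormedSpace.sphere_nonempty.mpr zero_le_one) hcont
  have hX0 : X ≠ 0 := by rintro rfl; simp at hX
  have hFX := hF.sl.pos X hX0
  have hm : ∀ y : V3, y ≠ 0 → y.2.2 / F y ≤ X.2.2 / F X := by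
    intro y hy
    have hn : 0 < ‖y‖ := norm_pos_iff.mpr hy
    have h1 : (‖y‖⁻¹ • y) ∈ Metric.sphere (0 : V3) 1 := by
      simp [norm_smul, hn.ne']
    have h2 : (‖y‖⁻¹ • y).2.2 / F (‖y‖⁻¹ • y) ≤ X.2.2 / F X := hmax h1
    rw [hF.sl.smul _ _ (by positivity)] at h2
    have := hF.sl.pos y hy
    have e : (‖y‖⁻¹ • y).2.2 / (‖y‖⁻¹ * F y) = y.2.2 / F y := by
      simp only [Prod.smul_snd, smul_eq_mul]; field_simp
    rwa [e] at h2
  have hXz : 0 < X.2.2 := by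
    have h1 := hm (0, 0, 1) (by simp)
    have h2 := hF.sl.pos (0, 0, 1) (by simp)
    have h3 : 0 < X.2.2 / F X := lt_of_lt_of_le (by simpa using h2) h1
    by_contra hc
    push Not at hc
    exact absurd h3 (not_lt.mpr (div_nonpos_of_nonpos_of_nonneg hc hFX.le))
  have hq : HasFDerivAt (fun y : V3 => y.2.2 ^ 2) (fun3 0 0 (2 * X.2.2)) X := by
    have h3 : HasFDerivAt (fun x : V3 => x.2.2) (fun3 0 0 1) X := by
      exact ((fun3 0 0 1).hasFDerivAt (x := X)).congr_of_eventuallyEq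
        (Eventually.of_forall fun y => by simp)
    refine (h3.pow 2).congr_fderiv ?_
    refine ContinuousLinearMap.ext fun v => ?_
    simp
  have hl : IsLocalExtr (fun y : V3 => y.2.2 ^ 2 * F X ^ 2 - X.2.2 ^ 2 * F y ^ 2) X := by
    right
    have hev : ∀ᶠ y : V3 in 𝓝 X, 0 < y.2.2 := by
      have : Continuous (fun y : V3 => y.2.2) := by fun_prop
      exact this.continuousAt.eventually (lt_mem_nhds hXz)
    filter_upwards [hev] with y hy
    have hy0 : y ≠ 0 := by rintro rfl; simp at hy
    have h1 := hm y hy0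
    have hFy := hF.sl.pos y hy0
    rw [div_le_div_iff₀ hFy hFX] at h1
    have h2 : (y.2.2 * F X) ^ 2 ≤ (X.2.2 * F y) ^ 2 := by gcongr
    nlinarith
  have i1 := hF.sl.extremal (Y := k.Y1) (x := X) k.Y1_diff.differentiableAt (fun x => by
    obtain ⟨p, a, b, c, d⟩ := hF.adm x
    exact ⟨p, a, b⟩) hq hX0 (Or.inr hl)
  have i2 := hF.sl.extremal (Y := k.Y2) (x := X) k.Y2_diff.differentiableAt (fun x => by
    obtain ⟨p, a, b, c, d⟩ := hF.adm x
    exact ⟨p, a, c⟩) hq hX0 (Or.inr hl)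
  simp [Y1, Y2, P, Q, J, h7, h8, g7, g8, h9, g9, hXz.ne'] at i1 i2
  have e : X = X.2.2 • (0, 0, 1) := by ext <;> simp [i1, i2]
  have hFe : F X = X.2.2 * F (0, 0, 1) := by
    conv_lhs => rw [e]
    exact hF.sl.smul _ _ hXz.le
  by_cases hx : x = 0
  · simp [hx, hF.sl.zero]
  have h1 := hm x hx
  have hFx := hF.sl.pos x hx
  rw [div_le_div_iff₀ hFx hFX, hFe] at h1
  refine le_of_mul_le_mul_left ?_ hXz
  linarith

theorem pole_sign (hF : k.Hyp F) (h7 : k.p7 = 0) (h8 : k.p8 = -3) (g7 : k.q7 = 3) (g8 : k.q8 = 0)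
    (h9 : k.p9 = 0) (g9 : k.q9 = 0) : 0 ≤ k.p6 ∧ k.q5 ≤ 0 := by
  have hh := hF.sl.pos (0, 0, 1) (by simp)
  have hl : ∀ x, fun3 0 0 (F (0, 0, 1)) x ≤ F x := by
    intro x
    have := pole_min hF h7 h8 g7 g8 h9 g9 x
    simpa using this
  have i1 := hF.sl.second_order (Y := k.Y1) k.Y1_diff.continuous k.Y1_q
    (fun x v w t => by ext <;> simp [DY1, P, J] <;> ring) (fun x => by
    obtain ⟨p, a, b, c, d⟩ := hF.adm x
    exact ⟨p, a, b⟩) hl (x0 := (0, 0, 1)) (by simp) (by simp [Y1, P, J, h9])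
  have i2 := hF.sl.second_order (Y := k.Y2) k.Y2_diff.continuous k.Y2_q
    (fun x v w t => by ext <;> simp [DY2, Q, J] <;> ring) (fun x => by
    obtain ⟨p, a, b, c, d⟩ := hF.adm x
    exact ⟨p, a, c⟩) hl (x0 := (0, 0, 1)) (by simp) (by simp [Y2, Q, J, g9])
  simp [DY1, DY2, Y1, Y2, P, Q, J, h7, h8, g7, g8, h9, g9] at i1 i2
  constructor <;> nlinarith

theorem exc_false (hF : k.Hyp F) (h : Exc k) (hne : k.p1 ≠ 0 ∨ k.q1 ≠ 0) : False := by
  obtain ⟨v1, v2, v3, v4⟩ := exc_pos hF h hne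
  set r := k.q2 + k.p1 with hr
  set s := k.q1 - k.p2 with hs
  have hpq : 0 < k.p1 ^ 2 + k.q1 ^ 2 := by
    rcases hne with h | h <;> positivity
  have R := shear_rel k (-s) r
  obtain ⟨i1, i2⟩ := pole_sign (R.hyp hF) (by simp [shearP, h.h7]) (by simp [shearP, h.h8])
    (by simp [shearP, h.g7]) (by simp [shearP, h.g8]) (by simp [shearP, h.h7, h.h8, v1])
    (by simp [shearP, h.g7, h.g8, v2])
  simp only [shearP, h.h7, h.h8, h.g7, h.g8, h.h3, h.g3, h.h4, h.g4, v1, v2] at i1 i2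
  have : k.p2 = k.q1 - s := by rw [hs]; ring
  have h3 : k.q2 = r - k.p1 := by rw [hr]; ring
  rw [this] at i1
  rw [h3] at i2
  nlinarith [sq_nonneg r, sq_nonneg s]

end Par


namespace Par
variable {k : Par} {F : V3 → ℝ}

theorem nf_a (hF : k.Hyp F) (h7 : k.q7 = 0) (h8 : k.p8 = 0) (h78 : k.p7 = k.q8) :
    IsQuad F ∨ k.Kak F := by
  have hb : ∀ x y, k.bet x y = 0 := fun x y => by simp only [bet, h7, h8, h78]; ring
  have hg := circ_gam hF hb
  have g1 := hg 1 0
  have g2 := hg 0 1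
  have g3 := hg 1 1
  have g4 := hg 1 (-1)
  simp only [gam, f1, f2] at g1 g2 g3 g4
  have hq1 : k.q1 = 0 := by linarith
  have hp4 : k.p4 = 0 := by linarith
  have ha : k.p1 = k.q2 + k.q3 := by linarith
  have hc : k.p2 + k.p3 = k.q4 := by linarith
  set b := k.q8 with hbd
  have hpos : (1 + b ^ 2) ≠ 0 := by positivity
  set m := (k.q4 + b * k.p1) / (1 + b ^ 2) with hm
  set n := (k.q4 * b - k.p1) / (1 + b ^ 2) with hn
  have hm' : m * (1 + b ^ 2) = k.q4 + b * k.p1 := by rw [hm]; field_simp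
  have hn' : n * (1 + b ^ 2) = k.q4 * b - k.p1 := by rw [hn]; field_simp
  have r1 : n - m * b = - k.p1 := by
    apply mul_right_cancel₀ hpos; linear_combination hn' - b * hm'
  have r2 : m + n * b = k.q4 := by
    apply mul_right_cancel₀ hpos; linear_combination b * hn' + hm'
  have R := shear_rel k m n
  have hL : Lin (k.shearP m n) := by
    constructor <;> simp only [shearP, h7, h8, h78, hq1, hp4, ← hbd] <;> linarith
  rcases lin_case hL (R.hyp hF) with h | h
  · exact Or.inl (Rel.quad h)
  · exact Or.inr (R.kak h)

theorem alg9 {b c d e1 e2 e3 e6 : ℝ} (hc : c ≠ 0) (h0 : c ^ 2 * e1 = 0)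
    (h1 : -2 * c * e2 + 2 * c * e6 + c ^ 2 * e2 = 0)
    (h2 : -3 * c * e3 - 2 * c * d * e1 - b * c * e6 + b * c * e2 + c ^ 2 * e3 = 0)
    (h3 : - c * e2 + c * e6 - c * d * e6 - c * d * e2 + b * c * e3 = 0)
    (h4 : d * e3 - 2 * c * e3 + d ^ 2 * e1 + b * d * e6 - b * d * e2 - c * d * e3 = 0)
    (h5 : - d * e2 + d * e6 + d ^ 2 * e6 - b * d * e3 = 0) :
    e1 = 0 ∧ ((e2 = 0 ∧ e3 = 0 ∧ e6 = 0) ∨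
      (b = 0 ∧ c = 3 ∧ d = -3 ∧ e6 = - e2 / 2)) := by
  have he1 : e1 = 0 := by
    rcases mul_eq_zero.mp h0 with h | h
    · exact absurd (pow_eq_zero_iff (two_ne_zero) |>.mp h) hc
    · exact h
  subst he1
  refine ⟨rfl, ?_⟩
  have h6 : e6 = e2 - c * e2 / 2 := by
    apply mul_left_cancel₀ hc; linear_combination h1 / 2
  subst h6
  have k2 : (c - 3) * e3 + b * (c * e2 / 2) = 0 := by
    apply mul_left_cancel₀ hc; linear_combination h2
  have k3 : - c * e2 / 2 - d * (2 * e2 - c * e2 / 2) + b * e3 = 0 := by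
    apply mul_left_cancel₀ hc; linear_combination h3
  have k4 : e3 * (c + d) = 0 := by linear_combination (-1/2) * h4 - (1/2) * d * k2
  have k5 : d * (c + d) * e2 = 0 := by linear_combination - d * k3 - h5
  by_cases hcd : c + d = 0
  · have hd : d = - c := by linarith
    subst hd
    have k6 : ((c - 3) ^ 2 + b ^ 2) * (c * e2 / 2) = 0 := by
      linear_combination b * k2 - (c - 3) * k3
    have k7 : ((c - 3) ^ 2 + b ^ 2) * e3 = 0 := by
      linear_combination (c - 3) * k2 + b * k3
    by_cases hz : (c - 3) ^ 2 + b ^ 2 = 0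
    · right
      have hb : b = 0 := by nlinarith [sq_nonneg (c - 3), sq_nonneg b]
      have hc3 : c - 3 = 0 := by nlinarith [sq_nonneg (c - 3), sq_nonneg b]
      have hc3 : c = 3 := by linarith
      refine ⟨hb, hc3, by rw [hc3], by rw [hc3]; ring⟩
    · left
      have a1 := (mul_eq_zero.mp k6).resolve_left hz
      have a2 := (mul_eq_zero.mp k7).resolve_left hz
      have a3 : e2 = 0 := by
        apply mul_left_cancel₀ hc; linear_combination 2 * a1
      refine ⟨a3, a2, by rw [a3]; ring⟩
  · left
    have a2 := (mul_eq_zero.mp k4).resolve_right hcd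
    have a1 : e2 = 0 := by
      by_contra h
      have hd : d = 0 := by
        rcases mul_eq_zero.mp k5 with h' | h'
        · exact (mul_eq_zero.mp h').resolve_right hcd
        · exact absurd h' h
      rw [hd, a2] at k3
      have : c * e2 = 0 := by linear_combination -2 * k3
      rcases mul_eq_zero.mp this with h' | h'
      · exact hc h'
      · exact h h'
    exact ⟨a1, a2, by rw [a1]; ring⟩

theorem nf_b0 (hF : k.Hyp F) (h7 : k.q7 ≠ 0) (h78 : k.p7 = k.q8) (h1 : k.q1 = 0)
    (h2 : k.q3 = k.p1 - k.q2) : IsQuad F ∨ k.Kak F := by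
  have hinf : {t : ℝ | k.bet 1 t ≠ 0}.Infinite := by
    refine infinite_of_mem_nhds (0 : ℝ) (IsOpen.mem_nhds ?_ ?_)
    · refine isOpen_ne_fun ?_ continuous_const
      unfold bet; fun_prop
    · simp [bet, h7]
  have hc := poly5_inf (c0 := k.q7 ^ 2 * k.p1)
    (c1 := -2 * k.q7 * (k.p2 + k.p3) + 2 * k.q7 * k.q4 + k.q7 ^ 2 * (k.p2 + k.p3))
    (c2 := -3 * k.q7 * k.p4 - 2 * k.q7 * k.p8 * k.p1 - k.q8 * k.q7 * k.q4 + k.q8 * k.q7 * (k.p2 + k.p3) + k.q7 ^ 2 * k.p4)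
    (c3 := - k.q7 * (k.p2 + k.p3) + k.q7 * k.q4 - k.q7 * k.p8 * k.q4 - k.q7 * k.p8 * (k.p2 + k.p3) + k.q8 * k.q7 * k.p4)
    (c4 := k.p8 * k.p4 - 2 * k.q7 * k.p4 + k.p8 ^ 2 * k.p1 + k.q8 * k.p8 * k.q4 - k.q8 * k.p8 * (k.p2 + k.p3) - k.q7 * k.p8 * k.p4)
    (c5 := - k.p8 * (k.p2 + k.p3) + k.p8 * k.q4 + k.p8 ^ 2 * k.q4 - k.q8 * k.p8 * k.p4)
    (hinf.mono (by
      intro t ht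
      have ht' : k.bet 1 t ≠ 0 := ht
      have := T_id hF 1 t one_ne_zero ht'
      show _ = _
      simp only [gam, bet, f1, f2, h78, h1, h2] at this
      linear_combination this))
  obtain ⟨c0, c1, c2, c3, c4, c5⟩ := hc
  obtain ⟨hp1, h | h⟩ := alg9 h7 c0 c1 c2 c3 c4 c5
  · obtain ⟨a1, a2, a3⟩ := h
    refine lin_case ⟨hp1, a2, by linarith, h1, a3, by rw [h2, hp1]; ring⟩ hF
  · obtain ⟨a1, a2, a3, a4⟩ := h
    by_cases hz : k.p2 + k.p3 = 0 ∧ k.p4 = 0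
    · refine lin_case ⟨hp1, hz.2, by linarith [hz.1], h1, by rw [a4, hz.1]; ring, by rw [h2, hp1]; ring⟩ hF
    · exfalso
      have R := shear_rel k (-(k.p2 + k.p3) / 8) (- k.p4 / 4)
      have h78' : k.p7 = 0 := h78.trans a1
      refine exc_false (R.hyp hF) ?_ ?_
      · constructor <;> simp only [shearP, h78', a1, a2, a3, a4, h1, h2, hp1] <;> ring
      · by_contra hcon
        push Not at hcon
        simp only [shearP, h78', a1, a2, a3, a4, h1, h2, hp1] at hcon
        apply hz
        constructor <;> linarith [hcon.1, hcon.2]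

theorem nf_b (hF : k.Hyp F) (h7 : k.q7 ≠ 0) (h78 : k.p7 = k.q8) : IsQuad F ∨ k.Kak F := by
  set m := k.q1 / k.q7 with hm
  set n := ((k.q2 + k.q3) - k.p1) / k.q7 with hn
  have hm' : m * k.q7 = k.q1 := by rw [hm]; field_simp
  have hn' : n * k.q7 = (k.q2 + k.q3) - k.p1 := by rw [hn]; field_simp
  have R := shear_rel k m n
  rcases nf_b0 (R.hyp hF) h7 h78 (by simp only [shearP]; linarith)
    (by simp only [shearP, h78]; linarith) with h | h
  · exact Or.inl (Rel.quad h)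
  · exact Or.inr (R.kak h)

theorem nf_c (hF : k.Hyp F) (h78 : k.p7 = k.q8) : IsQuad F ∨ k.Kak F := by
  by_cases h7 : k.q7 = 0
  · by_cases h8 : k.p8 = 0
    · exact nf_a hF h7 h8 h78
    · have R := rot_rel k 0 1 (by norm_num)
      rcases nf_b (R.hyp hF) (by simp [rotP, h8]) (by simp [rotP, h78]) with h | h
      · exact Or.inl (Rel.quad h)
      · exact Or.inr (R.kak h)
  · exact nf_b hF h7 h78

theorem exists_angle (a b : ℝ) : ∃ c s : ℝ, c ^ 2 + s ^ 2 = 1 ∧ (c ^ 2 - s ^ 2) * a + 2 * c * s * b = 0 := by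
  have hc : ContinuousOn (fun θ : ℝ => (Real.cos θ ^ 2 - Real.sin θ ^ 2) * a +
    2 * Real.cos θ * Real.sin θ * b) (Set.uIcc 0 (Real.pi / 2)) := by fun_prop
  have := intermediate_value_uIcc hc
  simp at this
  have h0 : (0 : ℝ) ∈ Set.uIcc a (-a) := by
    rw [Set.mem_uIcc]
    rcases le_total 0 a with h | h
    · right; constructor <;> linarith
    · left; constructor <;> linarith
  obtain ⟨θ, -, hθ⟩ := this h0
  exact ⟨Real.cos θ, Real.sin θ, by rw [add_comm]; exact Real.sin_sq_add_cos_sq θ, hθ⟩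

theorem nf (hF : k.Hyp F) : IsQuad F ∨ k.Kak F := by
  obtain ⟨c, s, h1, h2⟩ := exists_angle (k.p7 - k.q8) (k.p8 + k.q7)
  have R := rot_rel k c s h1
  rcases nf_c (R.hyp hF) (by simp only [rotP]; linear_combination h2) with h | h
  · exact Or.inl (Rel.quad h)
  · exact Or.inr (R.kak h)

end Par


theorem exp_lift {W : ℂ → ℂ} (hW : Continuous W) (h0 : ∀ w, W w ≠ 0) :
    ∃ l : ℂ → ℂ, Continuous l ∧ ∀ w, Complex.exp (l w) = W w := by
  obtain ⟨e0, he0⟩ : ∃ e0, Complex.exp e0 = W 0 := ⟨Complex.log (W 0), Complex.exp_log (h0 0)⟩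
  obtain ⟨l, ⟨-, hl⟩, -⟩ := Complex.isCoveringMap_exp.existsUnique_continuousMap_lifts
    (A := ℂ) (f := ⟨fun w => (⟨W w, h0 w⟩ : {z : ℂ // z ≠ 0}), by fun_prop⟩) 0 e0
    (by ext; simpa using he0)
  refine ⟨l, l.continuous, fun w => ?_⟩
  have := congrFun hl w
  simpa [Subtype.ext_iff] using this

theorem even_eig {Φ : V3 → V3} (hc : Continuous Φ) (he : ∀ x, Φ (-x) = Φ x) :
    ∃ l : V3, l ≠ 0 ∧ ∃ c : ℝ, Φ l = c • l := by
  set la : ℂ → V3 := fun w => (2 * w.re, 2 * w.im, 1 - w.re ^ 2 - w.im ^ 2) with hla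
  have hlac : Continuous la := by
    simp only [hla]; fun_prop
  set A : ℂ → ℝ := fun w => (Φ (la w)).1 * (1 - w.re ^ 2 + w.im ^ 2) +
    (Φ (la w)).2.1 * (-2 * w.re * w.im) + (Φ (la w)).2.2 * (-2 * w.re) with hA
  set B : ℂ → ℝ := fun w => (Φ (la w)).1 * (-2 * w.re * w.im) +
    (Φ (la w)).2.1 * (1 + w.re ^ 2 - w.im ^ 2) + (Φ (la w)).2.2 * (-2 * w.im) with hB
  by_contra hcon
  push Not at hcon
  have hne : ∀ w, ¬ (A w = 0 ∧ B w = 0) := by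
    rintro w ⟨h1, h2⟩
    have hs : (1 + w.re ^ 2 + w.im ^ 2) ≠ 0 := by positivity
    have hs2 : (1 + w.re ^ 2 + w.im ^ 2) ^ 2 ≠ 0 := by positivity
    refine hcon (la w) ?_ (((Φ (la w)).1 * (la w).1 + (Φ (la w)).2.1 * (la w).2.1 +
      (Φ (la w)).2.2 * (la w).2.2) / (1 + w.re ^ 2 + w.im ^ 2) ^ 2) ?_
    · intro h
      apply hs
      simp only [hla, Prod.ext_iff, Prod.fst_zero, Prod.snd_zero] at h
      obtain ⟨a, b, c⟩ := h
      exfalso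
      have a : w.re = 0 := by linarith
      have b : w.im = 0 := by linarith
      rw [a, b] at c
      norm_num at c
    · simp only [hA, hB] at h1 h2
      ext
      · simp only [Prod.smul_fst, smul_eq_mul]
        rw [div_mul_eq_mul_div, eq_div_iff hs2]
        simp only [hla] at h1 h2 ⊢
        linear_combination (1 - w.re ^ 2 + w.im ^ 2) * h1 + (-2 * w.re * w.im) * h2
      · simp only [Prod.smul_fst, Prod.smul_snd, smul_eq_mul]
        rw [div_mul_eq_mul_div, eq_div_iff hs2]
        simp only [hla] at h1 h2 ⊢
        linear_combination (-2 * w.re * w.im) * h1 + (1 + w.re ^ 2 - w.im ^ 2) * h2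
      · simp only [Prod.smul_snd, smul_eq_mul]
        rw [div_mul_eq_mul_div, eq_div_iff hs2]
        simp only [hla] at h1 h2 ⊢
        linear_combination (-2 * w.re) * h1 + (-2 * w.im) * h2
  have hΦc : Continuous fun w => Φ (la w) := hc.comp hlac
  have hAc : Continuous A := by simp only [hA]; fun_prop
  have hBc : Continuous B := by simp only [hB]; fun_prop
  obtain ⟨l, hl, hexp⟩ := exp_lift (W := fun w => (A w : ℂ) + B w * Complex.I) (by fun_prop)
    (by
      intro w h
      apply hne w
      have h1 := congrArg Complex.re h
      have h2 := congrArg Complex.im h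
      simp at h1 h2
      exact ⟨h1, h2⟩)
  set E : ℝ → ℂ := fun θ => Complex.exp (θ * Complex.I) with hE
  have hEc : Continuous E := by simp only [hE]; fun_prop
  have hEre : ∀ θ, (E θ).re = Real.cos θ := fun θ => Complex.exp_ofReal_mul_I_re θ
  have hEim : ∀ θ, (E θ).im = Real.sin θ := fun θ => Complex.exp_ofReal_mul_I_im θ
  set m : ℝ → ℂ := fun θ => l (E θ) - θ * Complex.I with hm
  have hmc : Continuous m := by simp only [hm]; fun_prop
  set p : ℝ → V3 := fun θ => Φ (la (E θ)) with hp
  have hme : ∀ θ, Complex.exp (m θ) = ((-2 * (p θ).2.2 : ℝ) : ℂ) +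
      ((-2 * (p θ).1 * Real.sin θ + 2 * (p θ).2.1 * Real.cos θ : ℝ) : ℂ) * Complex.I := by
    intro θ
    have hE0 : E θ ≠ 0 := Complex.exp_ne_zero _
    simp only [hm]
    rw [Complex.exp_sub, hexp, div_eq_iff (Complex.exp_ne_zero _)]
    change _ = _ * E θ
    have hE2 : E θ = (Real.cos θ : ℂ) + Real.sin θ * Complex.I := by
      rw [← hEre, ← hEim]; exact (Complex.re_add_im _).symm
    have hsc := Real.sin_sq_add_cos_sq θ
    have hre : ∀ a b : ℝ, ((a : ℂ) + b * Complex.I).re = a := by intro a b; simp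
    have him : ∀ a b : ℝ, ((a : ℂ) + b * Complex.I).im = b := by intro a b; simp
    apply Complex.ext
    · rw [Complex.mul_re, hEre, hEim]
      rw [hre, hre, him]
      simp only [hA, hEre, hEim]
      change (p θ).1 * _ + (p θ).2.1 * _ + (p θ).2.2 * _ = _
      linear_combination - (p θ).1 * hsc
    · rw [Complex.mul_im, hEre, hEim]
      rw [hre, him, him]
      simp only [hB, hEre, hEim]
      change (p θ).1 * _ + (p θ).2.1 * _ + (p θ).2.2 * _ = _
      linear_combination - (p θ).2.1 * hsc
  have hpp : ∀ θ, p (θ + Real.pi) = p θ := by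
    intro θ
    simp only [hp]
    rw [← he]
    congr 1
    simp only [hla, hEre, hEim, Real.cos_add_pi, Real.sin_add_pi]
    ext <;> simp
    linear_combination 2 * Real.sin_sq_add_cos_sq θ
  have hconj : ∀ θ, Complex.exp (m (θ + Real.pi)) = Complex.exp ((starRingEnd ℂ) (m θ)) := by
    intro θ
    rw [Complex.exp_conj, hme, hme, hpp, Real.cos_add_pi, Real.sin_add_pi]
    rw [map_add, map_mul, Complex.conj_ofReal, Complex.conj_ofReal, Complex.conj_I]
    push_cast
    ring
  have hintg : ∀ θ, ∃ n : ℤ, m (θ + Real.pi) - (starRingEnd ℂ) (m θ) = n * (2 * Real.pi * Complex.I) := by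
    intro θ
    obtain ⟨n, hn⟩ := Complex.exp_eq_exp_iff_exists_int.mp (hconj θ)
    exact ⟨n, by rw [hn]; ring⟩
  choose n hn using hintg
  have hnc : Continuous n := by
    have h1 : Continuous (fun θ => (n θ : ℝ)) := by
      have h2 : (fun θ => (n θ : ℝ)) = fun θ => (m (θ + Real.pi) - (starRingEnd ℂ) (m θ)).im / (2 * Real.pi) := by
        ext θ
        rw [hn]
        have := Real.pi_pos
        simp
      rw [h2]
      have : Continuous fun θ => (m (θ + Real.pi) - (starRingEnd ℂ) (m θ)) :=
        (hmc.comp (by fun_prop)).sub (Complex.continuous_conj.comp hmc)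
      exact (Complex.continuous_im.comp this).div_const _
    exact Int.isClosedEmbedding_coe_real.isEmbedding.continuous_iff.mpr h1
  have hconst : n Real.pi = n 0 := by
    exact PreconnectedSpace.constant inferInstance hnc
  have e1 := hn 0
  have e2 := hn Real.pi
  rw [hconst] at e2
  have e3 : m (Real.pi + Real.pi) = m 0 - 2 * Real.pi * Complex.I := by
    simp only [hm]
    have : E (Real.pi + Real.pi) = E 0 := by
      apply Complex.ext <;> simp [hEre, hEim]
    rw [this]; push_cast; ring
  rw [e3] at e2
  rw [zero_add] at e1
  have f1 := congrArg Complex.im e1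
  have f2 := congrArg Complex.im e2
  simp at f1 f2
  linarith [Real.pi_pos]


abbrev RMap := (V3 →L[ℝ] ℝ) →ₗ[ℝ] (V3 →L[ℝ] V3)

def AdmR (F : V3 → ℝ) (R : RMap) (x : V3) (p : V3 →L[ℝ] ℝ) : Prop :=
  IsSub F x p ∧ ∀ l m : V3 →L[ℝ] ℝ, l x * p (R m x) = m x * p (R l x)

structure HypR (F : V3 → ℝ) (R : RMap) : Prop where
  sl : SL F
  adm : ∀ x, ∃ p, AdmR F R x p

def KakR (F : V3 → ℝ) (R : RMap) : Prop := ∃ w : V3, ∃ D : Set V3, Dense D ∧ ∀ x ∈ D, ∀ p,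
  AdmR F R x p → ∀ l, p (R l x) = l x * p w

noncomputable def trR (S : V3 ≃L[ℝ] V3) (w : V3) (R : RMap) : RMap where
  toFun l := (S.symm : V3 →L[ℝ] V3).comp ((R (l.comp (S.symm : V3 →L[ℝ] V3))).comp (S : V3 →L[ℝ] V3))
    - l.smulRight w
  map_add' l m := by
    refine ContinuousLinearMap.ext fun x => ?_
    simp [ContinuousLinearMap.add_comp, add_smul]; abel
  map_smul' c l := by
    refine ContinuousLinearMap.ext fun x => ?_
    simp [ContinuousLinearMap.smul_comp, smul_sub, mul_smul]

theorem trR_apply (S : V3 ≃L[ℝ] V3) (w : V3) (R : RMap) (l : V3 →L[ℝ] ℝ) (x : V3) :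
    trR S w R l x = S.symm (R (l.comp (S.symm : V3 →L[ℝ] V3)) (S x)) - l x • w := rfl

variable {F : V3 → ℝ} {R : RMap}

theorem AdmR.tr {S : V3 ≃L[ℝ] V3} (w : V3) {x : V3} {p : V3 →L[ℝ] ℝ} (h : AdmR F R (S x) p) :
    AdmR (fun x => F (S x)) (trR S w R) x (p.comp (S : V3 →L[ℝ] V3)) := by
  obtain ⟨h1, h2⟩ := h
  refine ⟨?_, ?_⟩
  · intro y
    simpa using h1 (S y)
  · intro l m
    have := h2 (l.comp (S.symm : V3 →L[ℝ] V3)) (m.comp (S.symm : V3 →L[ℝ] V3))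
    simp only [trR_apply, ContinuousLinearMap.comp_apply, ContinuousLinearEquiv.coe_coe, map_sub,
      map_smul, ContinuousLinearEquiv.apply_symm_apply, ContinuousLinearEquiv.symm_apply_apply,
      smul_eq_mul] at this ⊢
    linear_combination this

theorem HypR.tr (h : HypR F R) (S : V3 ≃L[ℝ] V3) (w : V3) :
    HypR (fun x => F (S x)) (trR S w R) where
  sl := h.sl.comp (S : V3 →L[ℝ] V3) S.injective
  adm x := by
    obtain ⟨p, hp⟩ := h.adm (S x)
    exact ⟨_, hp.tr w⟩

theorem concl_tr (S : V3 ≃L[ℝ] V3) (w : V3)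
    (h : IsQuad (fun x => F (S x)) ∨ KakR (fun x => F (S x)) (trR S w R)) :
    IsQuad F ∨ KakR F R := by
  rcases h with h | ⟨w', D, hD, hK⟩
  · exact Or.inl (Par.Rel.quad h)
  · refine Or.inr ⟨S (w' + w), S '' D, S.surjective.denseRange.dense_image S.continuous hD, ?_⟩
    rintro _ ⟨x, hx, rfl⟩ p hp l
    have := hK x hx _ (hp.tr w) (l.comp (S : V3 →L[ℝ] V3))
    have e : (l.comp (S : V3 →L[ℝ] V3)).comp (S.symm : V3 →L[ℝ] V3) = l := by
      refine ContinuousLinearMap.ext fun x => ?_; simp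
    simp only [trR_apply, e, ContinuousLinearMap.comp_apply, ContinuousLinearEquiv.coe_coe, map_sub,
      map_smul, ContinuousLinearEquiv.apply_symm_apply, ContinuousLinearEquiv.symm_apply_apply,
      smul_eq_mul, map_add] at this ⊢
    linear_combination this

theorem R_expand (R : RMap) (l : V3 →L[ℝ] ℝ) (x : V3) :
    R l x = l (1,0,0) • R (fun3 1 0 0) x + l (0,1,0) • R (fun3 0 1 0) x + l (0,0,1) • R (fun3 0 0 1) x := by
  have : l = l (1,0,0) • fun3 1 0 0 + l (0,1,0) • fun3 0 1 0 + l (0,0,1) • fun3 0 0 1 := by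
    refine ContinuousLinearMap.ext fun x => ?_
    rw [clm3_apply l x]
    simp
  conv_lhs => rw [this]
  simp

theorem step4 (h : HypR F R) (hJ : ∀ x y, R (fun3 0 0 1) (x, y, 0) = (-y, x, 0))
    (hc : ∀ x y, F (x, y, 0) = √(x ^ 2 + y ^ 2)) : IsQuad F ∨ KakR F R := by
  set w := R (fun3 0 0 1) (0, 0, 1) with hw
  refine concl_tr (ContinuousLinearEquiv.refl ℝ V3) w ?_
  have h' := h.tr (ContinuousLinearEquiv.refl ℝ V3) w
  have hJ' : ∀ x, trR (ContinuousLinearEquiv.refl ℝ V3) w R (fun3 0 0 1) x = Par.J x := by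
    intro x
    rw [trR_apply]
    have e : x = (x.1, x.2.1, 0) + x.2.2 • ((0, 0, 1) : V3) := by ext <;> simp
    have e2 : R (fun3 0 0 1) x = (-x.2.1, x.1, 0) + x.2.2 • w := by
      conv_lhs => rw [e]
      rw [map_add, map_smul, hJ]
    have e3 : (fun3 0 0 1).comp ((ContinuousLinearEquiv.refl ℝ V3).symm : V3 →L[ℝ] V3) = fun3 0 0 1 := by
      refine ContinuousLinearMap.ext fun x => ?_; simp
    rw [e3]
    simp [e2, Par.J]
  set R' := trR (ContinuousLinearEquiv.refl ℝ V3) w R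
  simp only [ContinuousLinearEquiv.refl_apply] at h' ⊢
  clear_value R'
  set P := R' (fun3 1 0 0) with hP
  set Q := R' (fun3 0 1 0) with hQ
  let k : Par := ⟨(P (1,0,0)).1, (P (0,1,0)).1, (P (1,0,0)).2.1, (P (0,1,0)).2.1, (P (0,0,1)).1,
    (P (0,0,1)).2.1, (P (1,0,0)).2.2, (P (0,1,0)).2.2, (P (0,0,1)).2.2,
    (Q (1,0,0)).1, (Q (0,1,0)).1, (Q (1,0,0)).2.1, (Q (0,1,0)).2.1, (Q (0,0,1)).1,
    (Q (0,0,1)).2.1, (Q (1,0,0)).2.2, (Q (0,1,0)).2.2, (Q (0,0,1)).2.2⟩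
  have hexp : ∀ A : V3 →L[ℝ] V3, ∀ x : V3, A x = x.1 • A (1,0,0) + x.2.1 • A (0,1,0) + x.2.2 • A (0,0,1) := by
    intro A x
    have e : x = x.1 • ((1,0,0) : V3) + x.2.1 • ((0,1,0) : V3) + x.2.2 • ((0, 0, 1) : V3) := by
      ext <;> simp
    conv_lhs => rw [e]
    rw [map_add, map_add, map_smul, map_smul, map_smul]
  have kP : ∀ x, k.P x = P x := by
    intro x
    rw [hexp P x]
    ext <;> simp [k, Par.P] <;> ring
  have kQ : ∀ x, k.Q x = Q x := by
    intro x
    rw [hexp Q x]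
    ext <;> simp [k, Par.Q] <;> ring
  have hadm : ∀ x p, AdmR F R' x p → k.Adm F x p := by
    rintro x p ⟨h1, h2⟩
    refine ⟨h1, ?_, ?_, ?_⟩
    · have := h2 (fun3 0 0 1) (fun3 1 0 0)
      rw [hJ', ← hP] at this
      simp only [Par.Y1, kP, map_sub, map_smul, smul_eq_mul]
      simp at this
      linarith
    · have := h2 (fun3 0 0 1) (fun3 0 1 0)
      rw [hJ', ← hQ] at this
      simp only [Par.Y2, kQ, map_sub, map_smul, smul_eq_mul]
      simp at this
      linarith
    · have := h2 (fun3 1 0 0) (fun3 0 1 0)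
      rw [← hP, ← hQ] at this
      simp only [Par.Y3, kP, kQ, map_sub, map_smul, smul_eq_mul]
      simp at this
      linarith
  have hH : k.Hyp F := ⟨h'.sl, hc, fun x => by
    obtain ⟨p, hp⟩ := h'.adm x
    exact ⟨p, hadm x p hp⟩⟩
  rcases Par.nf hH with hq | ⟨w', D, hD, hK⟩
  · exact Or.inl hq
  · refine Or.inr ⟨w', D, hD, fun x hx p hp l => ?_⟩
    obtain ⟨e1, e2, e3⟩ := hK x hx p (hadm x p hp)
    rw [R_expand, hJ', ← hP, ← hQ, ← kP, ← kQ, clm3_apply l x]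
    simp only [map_add, map_smul, smul_eq_mul, e1, e2, e3]
    ring

theorem fun3_ext (l : V3 →L[ℝ] ℝ) (h : l = 0 → False) : l (1,0,0) ≠ 0 ∨ l (0,1,0) ≠ 0 ∨ l (0,0,1) ≠ 0 := by
  by_contra hc
  push Not at hc
  apply h
  refine ContinuousLinearMap.ext fun x => ?_
  rw [clm3_apply, hc.1, hc.2.1, hc.2.2]
  simp

theorem straighten (l : V3 →L[ℝ] ℝ) (h : l ≠ 0) : ∃ S : V3 ≃L[ℝ] V3, ∀ x, l (S x) = x.2.2 := by
  have hl := clm3_apply l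
  set a := l (1,0,0)
  set b := l (0,1,0)
  set c := l (0,0,1)
  rcases fun3_ext l h with ha | hb | hc
  · refine ⟨ContinuousLinearEquiv.equivOfInverse
      ((fun3 (-c / a) (-b / a) (1 / a)).prod ((fun3 0 1 0).prod (fun3 1 0 0)))
      ((fun3 0 0 1).prod ((fun3 0 1 0).prod (fun3 a b c))) (fun x => ?_) (fun x => ?_), fun x => ?_⟩
    · ext <;> simp
      change a * _ + _ + _ = _
      have : a ≠ 0 := ha
      field_simp; ring
    · ext <;> simp
      have : a ≠ 0 := ha
      field_simp; ring
    · rw [hl]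
      simp
      have : a ≠ 0 := ha
      field_simp; ring
  · refine ⟨ContinuousLinearEquiv.equivOfInverse
      ((fun3 1 0 0).prod ((fun3 (-a / b) (-c / b) (1 / b)).prod (fun3 0 1 0)))
      ((fun3 1 0 0).prod ((fun3 0 0 1).prod (fun3 a b c))) (fun x => ?_) (fun x => ?_), fun x => ?_⟩
    · have : b ≠ 0 := hb
      ext <;> simp
      field_simp; ring
    · have : b ≠ 0 := hb
      ext <;> simp
      field_simp; ring
    · rw [hl]
      have : b ≠ 0 := hb
      simp
      field_simp; ring
  · refine ⟨ContinuousLinearEquiv.equivOfInverse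
      ((fun3 1 0 0).prod ((fun3 0 1 0).prod (fun3 (-a / c) (-b / c) (1 / c))))
      ((fun3 1 0 0).prod ((fun3 0 1 0).prod (fun3 a b c))) (fun x => ?_) (fun x => ?_), fun x => ?_⟩
    · have : c ≠ 0 := hc
      ext <;> simp
      field_simp; ring
    · have : c ≠ 0 := hc
      ext <;> simp
      field_simp; ring
    · rw [hl]
      have : c ≠ 0 := hc
      simp
      field_simp; ring

theorem eigR (R : RMap) : ∃ l : V3 →L[ℝ] ℝ, l ≠ 0 ∧ ∃ c : ℝ, ∀ x, l (R l x) = c * l x := by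
  set Rl : V3 → V3 → V3 := fun a x => a.1 • R (fun3 1 0 0) x + a.2.1 • R (fun3 0 1 0) x + a.2.2 • R (fun3 0 0 1) x with hRl
  have hR : ∀ a x, R (fun3 a.1 a.2.1 a.2.2) x = Rl a x := by
    intro a x
    rw [R_expand]
    simp [hRl]
  set φ : V3 → V3 → ℝ := fun a y => a.1 * y.1 + a.2.1 * y.2.1 + a.2.2 * y.2.2 with hφ
  obtain ⟨a, ha, c, hc⟩ := even_eig (Φ := fun a => (φ a (Rl a (1,0,0)), φ a (Rl a (0,1,0)), φ a (Rl a (0,0,1))))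
    (by simp only [hφ, hRl]; fun_prop) (by
      intro x
      simp only [hφ, hRl]
      ext <;> simp <;> ring)
  refine ⟨fun3 a.1 a.2.1 a.2.2, ?_, c, fun x => ?_⟩
  · intro h
    apply ha
    ext
    · simpa using DFunLike.congr_fun h (1,0,0)
    · simpa using DFunLike.congr_fun h (0,1,0)
    · simpa using DFunLike.congr_fun h (0,0,1)
  · have e := clm3_apply ((fun3 a.1 a.2.1 a.2.2).comp (R (fun3 a.1 a.2.1 a.2.2))) x
    simp only [ContinuousLinearMap.comp_apply, hR, fun3_apply] at e ⊢
    simp only [Prod.ext_iff, hφ, Prod.smul_fst, Prod.smul_snd, smul_eq_mul] at hc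
    rw [e, hc.1, hc.2.1, hc.2.2]
    ring


theorem eigvec2 {a b c d r : ℝ} (h : (a - r) * (d - r) - b * c = 0) :
    ∃ x y : ℝ, (x ≠ 0 ∨ y ≠ 0) ∧ a * x + b * y = r * x ∧ c * x + d * y = r * y := by
  by_cases h1 : b ≠ 0 ∨ r - a ≠ 0
  · exact ⟨b, r - a, h1, by ring, by linear_combination -h⟩
  · push Not at h1
    by_cases h2 : r - d ≠ 0 ∨ c ≠ 0
    · exact ⟨r - d, c, h2, by linear_combination -h, by ring⟩
    · push Not at h2
      refine ⟨1, 0, by simp, ?_, ?_⟩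
      · linear_combination -h1.2
      · linear_combination h2.2

variable {F : V3 → ℝ} {R : RMap}

theorem step3_real {a b c d : ℝ} (h : SL F)
    (hk : ∀ x y : ℝ, ∃ p, IsSub F (x, y, 0) p ∧ p (a * x + b * y, c * x + d * y, 0) = 0)
    (hd : 0 ≤ (a - d) ^ 2 + 4 * b * c) : a = 0 ∧ b = 0 ∧ c = 0 ∧ d = 0 := by
  have heig : ∀ r, (a - r) * (d - r) - b * c = 0 → r = 0 := by
    intro r hr
    obtain ⟨x, y, hxy, h1, h2⟩ := eigvec2 hr
    obtain ⟨p, hp, hp2⟩ := hk x y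
    have e : ((a * x + b * y, c * x + d * y, 0) : V3) = r • ((x, y, 0) : V3) := by
      rw [h1, h2]; ext <;> simp
    rw [e, map_smul, hp.self h, smul_eq_mul] at hp2
    have hne : ((x, y, 0) : V3) ≠ 0 := by
      intro h0
      simp [Prod.ext_iff] at h0
      rcases hxy with h' | h'
      · exact h' h0.1
      · exact h' h0.2
    rcases mul_eq_zero.mp hp2 with h' | h'
    · exact h'
    · exact absurd h' (h.pos _ hne).ne'
  set s := √((a - d) ^ 2 + 4 * b * c) with hs
  have hs2 : s ^ 2 = (a - d) ^ 2 + 4 * b * c := Real.sq_sqrt hd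
  have r1 := heig ((a + d + s) / 2) (by linear_combination (1/4) * hs2)
  have r2 := heig ((a + d - s) / 2) (by linear_combination (1/4) * hs2)
  have had : d = - a := by linarith
  have hs0 : s = 0 := by linarith
  subst had
  have hdet : a ^ 2 + b * c = 0 := by rw [hs0] at hs2; linear_combination (-1/4) * hs2
  have hnil : ∀ x y : ℝ, a * x + b * y = 0 ∧ c * x - a * y = 0 := by
    intro x y
    set v : V3 := (a * x + b * y, c * x - a * y, 0) with hv
    have hv0 : v = 0 := by
      by_contra hne
      have hc : ∀ t : ℝ, HasDerivAt (fun t : ℝ => ((x, y, 0) : V3) + t • v) v t := by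
        intro t
        simpa using ((hasDerivAt_id t).smul_const v).const_add ((x, y, 0) : V3)
      have hcon := h.flow_const hc continuous_const (fun t => by
        obtain ⟨p, hp, hp2⟩ := hk (x + t * (a * x + b * y)) (y + t * (c * x - a * y))
        refine ⟨p, ?_, ?_⟩
        · convert hp using 1
          simp [hv]
        · convert hp2 using 2
          simp only [hv]
          ext
          · simp; linear_combination (-t * x) * hdet
          · simp; linear_combination (-t * y) * hdet
          · simp)
      have hpos := h.pos v hne
      obtain ⟨t, ht⟩ : ∃ t : ℝ, 0 ≤ t ∧ t * F v = F (x, y, 0) + F (-(x, y, 0)) + 1 := by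
        refine ⟨(F (x, y, 0) + F (-(x, y, 0)) + 1) / F v, ?_, ?_⟩
        · have := h.nonneg (x, y, 0)
          have := h.nonneg (-(x, y, 0))
          positivity
        · field_simp
      have h1 := h.add ((x, y, 0) + t • v) (-(x, y, 0))
      have h2 := hcon t 0
      simp only [zero_smul, add_zero] at h2
      rw [h2, add_neg_cancel_comm, h.smul t v ht.1] at h1
      linarith [ht.2]
    simp [hv, Prod.ext_iff] at hv0
    exact hv0
  have h1 := hnil 1 0
  have h2 := hnil 0 1
  simp at h1 h2
  exact ⟨h1.1, h2.1, h1.2, by simp [h1.1]⟩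

theorem step3_cplx {a b c d : ℝ} (h : HypR F R)
    (hA : ∀ x y : ℝ, R (fun3 0 0 1) (x, y, 0) = (a * x + b * y, c * x + d * y, 0))
    (hk : ∀ x y : ℝ, ∃ p, IsSub F (x, y, 0) p ∧ p (a * x + b * y, c * x + d * y, 0) = 0)
    (hd : (a - d) ^ 2 + 4 * b * c < 0) : IsQuad F ∨ KakR F R := by
  have hc0 : c ≠ 0 := by
    rintro rfl
    nlinarith [sq_nonneg (a - d)]
  set w := √(-((a - d) ^ 2 + 4 * b * c)) / 2 with hw
  have hw0 : 0 < w := by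
    rw [hw]; apply div_pos _ two_pos; apply Real.sqrt_pos.mpr; linarith
  have hw2 : 4 * w ^ 2 = -((a - d) ^ 2 + 4 * b * c) := by
    have := Real.sq_sqrt (show 0 ≤ -((a - d) ^ 2 + 4 * b * c) by linarith)
    rw [hw, div_pow, this]; ring
  set s := (a + d) / 2 with hs
  set A := R (fun3 0 0 1) with hAdef
  set e1 : V3 := (1, 0, 0) with he1
  set e2 : V3 := ((a - s) / w, c / w, 0) with he2
  have hA1 : A e1 = s • e1 + w • e2 := by
    rw [he1, hA, he2]
    ext <;> simp <;> field_simp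
    ring
  have hA2 : A e2 = s • e2 - w • e1 := by
    rw [he1, he2, hA]
    ext
    · simp only [hs]
      simp
      field_simp
      linear_combination hw2
    · simp only [hs]
      simp
      field_simp
      ring
    · simp
  have hcomb : ∀ x y : ℝ, x • e1 + y • e2 = (x + y * ((a - s) / w), y * (c / w), 0) := by
    intro x y; ext <;> simp [he1, he2]
  have hAc : ∀ x y : ℝ, ∃ p, IsSub F (x • e1 + y • e2) p ∧ p (A (x • e1 + y • e2)) = 0 := by
    intro x y
    rw [hcomb, hA]
    exact hk _ _
  set cv : ℝ → V3 := fun t => (Real.exp (s * t) * Real.cos (w * t)) • e1 + (Real.exp (s * t) * Real.sin (w * t)) • e2 with hcv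
  have hder : ∀ t, HasDerivAt cv (A (cv t)) t := by
    intro t
    have h1 : HasDerivAt (fun t => Real.exp (s * t)) (Real.exp (s * t) * s) t := by
      simpa using ((hasDerivAt_id t).const_mul s).exp
    have h2 : HasDerivAt (fun t => Real.cos (w * t)) (- Real.sin (w * t) * w) t := by
      simpa using ((hasDerivAt_id t).const_mul w).cos
    have h3 : HasDerivAt (fun t => Real.sin (w * t)) (Real.cos (w * t) * w) t := by
      simpa using ((hasDerivAt_id t).const_mul w).sin
    refine (((h1.mul h2).smul_const e1).add ((h1.mul h3).smul_const e2)).congr_deriv ?_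
    simp only [hcv]
    rw [map_add, map_smul, map_smul, hA1, hA2]
    module
  have hcvc : Continuous cv := by simp only [hcv]; fun_prop
  have hconst := h.sl.flow_const hder (A.continuous.comp hcvc) (fun t => hAc _ _)
  have hF1 : 0 < F e1 := h.sl.pos _ (by simp [he1])
  have hs0 : s = 0 := by
    have h1 := hconst (2 * Real.pi / w) 0
    have e : w * (2 * Real.pi / w) = 2 * Real.pi := by field_simp
    simp only [hcv, e, Real.cos_two_pi, Real.sin_two_pi, mul_zero, Real.cos_zero, Real.sin_zero,
      Real.exp_zero, zero_smul, add_zero, mul_one] at h1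
    rw [h.sl.smul _ _ (Real.exp_pos _).le, one_smul] at h1
    have h2 : Real.exp (s * (2 * Real.pi / w)) = 1 := by
      apply mul_right_cancel₀ hF1.ne'; rw [h1, one_mul]
    rw [Real.exp_eq_one_iff] at h2
    have : 2 * Real.pi / w ≠ 0 := by have := Real.pi_pos; positivity
    exact (mul_eq_zero.mp h2).resolve_right this
  have hrot : ∀ x y : ℝ, F (x • e1 + y • e2) = √(x ^ 2 + y ^ 2) * F e1 := by
    intro x y
    set z : ℂ := ⟨x, y⟩ with hz
    have hn : ‖z‖ = √(x ^ 2 + y ^ 2) := by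
      rw [Complex.norm_def, Complex.normSq_mk]; ring_nf
    have hx : x = ‖z‖ * Real.cos z.arg := by
      rw [Complex.norm_mul_cos_arg]
    have hy : y = ‖z‖ * Real.sin z.arg := by
      rw [Complex.norm_mul_sin_arg]
    have e : w * (z.arg / w) = z.arg := by field_simp
    have h1 := hconst (z.arg / w) 0
    simp only [hcv, e, hs0, zero_mul, mul_zero, Real.cos_zero, Real.sin_zero,
      Real.exp_zero, zero_smul, add_zero, mul_one, one_mul, one_smul] at h1
    rw [← hn, ← h1, ← h.sl.smul _ _ (norm_nonneg z), smul_add, smul_smul, smul_smul, ← hx, ← hy]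
  set r := (F e1)⁻¹ with hr
  have hr0 : 0 < r := inv_pos.mpr hF1
  have hrF : r * F e1 = 1 := inv_mul_cancel₀ hF1.ne'
  rw [hs0] at hA1 hA2 hcomb
  obtain ⟨S, hS⟩ : ∃ S : V3 ≃L[ℝ] V3, ∀ x, S x = (r * x.1 + r * a / w * x.2.1, r * c / w * x.2.1, w * x.2.2) := by
    refine ⟨ContinuousLinearEquiv.equivOfInverse
      ((fun3 r (r * a / w) 0).prod ((fun3 0 (r * c / w) 0).prod (fun3 0 0 w)))
      ((fun3 (1 / r) (- a / (r * c)) 0).prod ((fun3 0 (w / (r * c)) 0).prod (fun3 0 0 (1 / w))))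
      (fun x => ?_) (fun x => ?_), fun x => ?_⟩
    · ext <;> simp <;> field_simp
      ring
    · ext <;> simp <;> field_simp
      ring
    · ext <;> simp
  have hSe : ∀ x y : ℝ, S (x, y, 0) = (r * x) • e1 + (r * y) • e2 := by
    intro x y
    rw [hS, hcomb]
    ext <;> simp
    · ring
    · ring
  refine concl_tr S 0 (step4 (h.tr S 0) ?_ ?_)
  · intro x y
    rw [trR_apply]
    apply S.injective
    have e : (fun3 0 0 1).comp (S.symm : V3 →L[ℝ] V3) = w⁻¹ • fun3 0 0 1 := by
      refine ContinuousLinearMap.ext fun y => ?_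
      obtain ⟨x, rfl⟩ := S.surjective y
      have h2 : (S x).2.2 = w * x.2.2 := by rw [hS]
      simp [h2, hw0.ne']
    rw [e, map_smul, smul_zero, sub_zero, S.apply_symm_apply, smul_apply, ← hAdef, hSe, hSe, map_add, map_smul, map_smul,
      hA1, hA2]
    match_scalars <;> field_simp
    all_goals ring
  · intro x y
    rw [hSe, hrot]
    have : (r * x) ^ 2 + (r * y) ^ 2 = r ^ 2 * (x ^ 2 + y ^ 2) := by ring
    rw [this, Real.sqrt_mul (sq_nonneg r), Real.sqrt_sq hr0.le]
    linear_combination √(x ^ 2 + y ^ 2) * hrF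

theorem step3 (h : HypR F R) (hinv : ∀ x y : ℝ, (R (fun3 0 0 1) (x, y, 0)).2.2 = 0) :
    IsQuad F ∨ KakR F R := by
  set A := R (fun3 0 0 1) with hAdef
  have hA : ∀ x y : ℝ, A (x, y, 0) = ((A (1,0,0)).1 * x + (A (0,1,0)).1 * y,
      (A (1,0,0)).2.1 * x + (A (0,1,0)).2.1 * y, 0) := by
    intro x y
    have e : ((x, y, 0) : V3) = x • ((1,0,0) : V3) + y • ((0,1,0) : V3) := by ext <;> simp
    have e3 := hinv x y
    ext
    · rw [e, map_add, map_smul, map_smul]; simp; ring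
    · rw [e, map_add, map_smul, map_smul]; simp; ring
    · rw [e3]
  have hk : ∀ x y : ℝ, ∃ p, IsSub F (x, y, 0) p ∧ p (A (x, y, 0)) = 0 := by
    intro x y
    obtain ⟨p, hp, hp2⟩ := h.adm (x, y, 0)
    refine ⟨p, hp, ?_⟩
    have h1 := hp2 (fun3 1 0 0) (fun3 0 0 1)
    have h2 := hp2 (fun3 0 1 0) (fun3 0 0 1)
    rw [← hAdef] at h1 h2
    simp at h1 h2
    by_cases hx : x = 0
    · by_cases hy : y = 0
      · subst hx hy
        have : ((0, 0, 0) : V3) = 0 := rfl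
        rw [this]; simp
      · exact h2.resolve_left hy
    · exact h1.resolve_left hx
  replace hk : ∀ x y : ℝ, ∃ p, IsSub F (x, y, 0) p ∧ p ((A (1,0,0)).1 * x + (A (0,1,0)).1 * y,
      (A (1,0,0)).2.1 * x + (A (0,1,0)).2.1 * y, 0) = 0 := by
    intro x y
    obtain ⟨p, hp, hp2⟩ := hk x y
    rw [hA] at hp2
    exact ⟨p, hp, hp2⟩
  by_cases hd : 0 ≤ ((A (1,0,0)).1 - (A (0,1,0)).2.1) ^ 2 + 4 * (A (0,1,0)).1 * (A (1,0,0)).2.1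
  · obtain ⟨h1, h2, h3, h4⟩ := step3_real h.sl hk hd
    right
    refine ⟨A (0,0,1), {x | x.2.2 ≠ 0}, ?_, ?_⟩
    · intro x
      rw [mem_closure_iff_seq_limit]
      by_cases hx : x.2.2 = 0
      · refine ⟨fun n => x + (1 / ((n : ℝ) + 1)) • ((0, 0, 1) : V3), fun n => ?_, ?_⟩
        · have : (0:ℝ) < n + 1 := by positivity
          simp [hx, this.ne']
        · have := (tendsto_one_div_add_atTop_nhds_zero_nat (𝕜 := ℝ)).smul_const ((0,0,1) : V3)
          simpa using this.const_add x
      · exact ⟨fun _ => x, fun _ => hx, tendsto_const_nhds⟩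
    · intro x hx p hp l
      have hx' : x.2.2 ≠ 0 := hx
      have e : A x = x.2.2 • A (0,0,1) := by
        have e0 : x = (x.1, x.2.1, 0) + x.2.2 • ((0, 0, 1) : V3) := by ext <;> simp
        conv_lhs => rw [e0]
        rw [map_add, map_smul, hA, h1, h2, h3, h4]
        ext <;> simp
      have := hp.2 (fun3 0 0 1) l
      rw [← hAdef, e, map_smul] at this
      simp at this
      apply mul_left_cancel₀ hx'
      linear_combination this
  · push Not at hd
    exact step3_cplx h hA hk hd

theorem prop_main (h : HypR F R) : IsQuad F ∨ KakR F R := by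
  obtain ⟨l, hl, c, hc⟩ := eigR R
  obtain ⟨S, hS⟩ := straighten l hl
  refine concl_tr S 0 (step3 (h.tr S 0) ?_)
  intro x y
  have e : (fun3 0 0 1).comp (S.symm : V3 →L[ℝ] V3) = l := by
    refine ContinuousLinearMap.ext fun y => ?_
    obtain ⟨x, rfl⟩ := S.surjective y
    simp [hS]
  rw [trR_apply, e, smul_zero, sub_zero, ← hS, S.apply_symm_apply, hc, hS]
  simp


section C
variable {E : Type*} [NormedAddCommGroup E] [NormedSpace ℝ E] [FiniteDimensional ℝ E]
  {F : E → ℝ}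

theorem SL.lipschitz (h : SL F) : ∃ K : NNReal, LipschitzWith K F := by
  obtain ⟨C, hC, hC2⟩ := h.upper
  refine ⟨⟨C, hC.le⟩, LipschitzWith.of_le_add_mul _ fun x y => ?_⟩
  have := (h.sub_le x y).trans (hC2 _)
  rw [dist_eq_norm]
  change _ ≤ _ + C * _
  linarith

theorem SL.generic [MeasurableSpace E] [BorelSpace E] (h : SL F) (T : V3 →L[ℝ] E) {ε : ℝ} (hε : 0 < ε) :
    ∃ T' : V3 →L[ℝ] E, ‖T' - T‖ < ε ∧ ∃ D : Set V3, Dense D ∧ ∀ x ∈ D, DifferentiableAt ℝ F (T' x) := by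
  set l : V3 →L[ℝ] ℝ := fun3 1 0 0 with hl
  have hl0 : l ≠ 0 := by
    intro h0; have := DFunLike.congr_fun h0 (1,0,0); simp [hl] at this
  obtain ⟨s, hsc, hsd⟩ := TopologicalSpace.exists_countable_dense V3
  have hsd' : Dense (s ∩ {x | l x ≠ 0}) := hsd.inter_of_isOpen_right (dense_ne l hl0)
    (isOpen_ne_fun l.continuous continuous_const)
  obtain ⟨K, hK⟩ := h.lipschitz
  let μ : MeasureTheory.Measure E := MeasureTheory.Measure.addHaar
  have hae := hK.ae_differentiableAt (μ := μ)
  have h1 : ∀ᵐ v ∂μ, ∀ x ∈ s ∩ {x | l x ≠ 0}, DifferentiableAt ℝ F (T x + l x • v) := by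
    rw [MeasureTheory.ae_ball_iff (hsc.mono Set.inter_subset_left)]
    intro x hx
    have hx2 : l x ≠ 0 := hx.2
    rw [MeasureTheory.ae_iff] at hae ⊢
    have e : {v | ¬ DifferentiableAt ℝ F (T x + l x • v)} =
      (fun v => l x • v) ⁻¹' ((fun v => T x + v) ⁻¹' {y | ¬ DifferentiableAt ℝ F y}) := rfl
    rw [e, MeasureTheory.Measure.addHaar_preimage_smul _ hx2, MeasureTheory.measure_preimage_add, hae, mul_zero]
  have h2 := MeasureTheory.Measure.dense_of_ae h1
  obtain ⟨v, hv1, hv2⟩ := h2.exists_dist_lt (0 : E) (show 0 < ε / (‖l‖ + 1) by positivity)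
  refine ⟨T + l.smulRight v, ?_, _, hsd', fun x hx => ?_⟩
  · rw [add_sub_cancel_left, ContinuousLinearMap.norm_smulRight_apply]
    rw [dist_zero_left, lt_div_iff₀ (by positivity)] at hv2
    nlinarith [norm_nonneg v, norm_nonneg l]
  · simpa using hv1 x hx

theorem exp_flow (h : SL F) {T : V3 →L[ℝ] E} (hT : Function.Injective T) {A : V3 →L[ℝ] V3}
    (hall : ∀ x, ∃ p, IsSub (fun x => F (T x)) x p ∧ p (A x) = 0) (t : ℝ) (x : V3) :
    F (T (NormedSpace.exp (t • A) x)) = F (T x) := by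
  have hF0 : SL (fun x => F (T x)) := h.comp T hT
  have hd : ∀ t : ℝ, HasDerivAt (fun t : ℝ => NormedSpace.exp (t • A) x) (A (NormedSpace.exp (t • A) x)) t := by
    intro t
    have h1 := hasDerivAt_exp_smul_const' (𝕂 := ℝ) A t
    have h2 := (ContinuousLinearMap.apply ℝ V3 x).hasFDerivAt.comp_hasDerivAt t h1
    exact h2
  have hc : Continuous (fun t : ℝ => NormedSpace.exp (t • A) x) :=
    continuous_iff_continuousAt.mpr fun t => (hd t).continuousAt
  have := hF0.flow_const hd (A.continuous.comp hc) (fun t => hall _) t 0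
  simpa using this

theorem exp_sym (h : SL F) {T : V3 →L[ℝ] E} (hT : Function.Injective T) {D : Set V3} (hD : Dense D)
    (hdiff : ∀ x ∈ D, DifferentiableAt ℝ F (T x)) {A : V3 →L[ℝ] V3}
    (hder : ∀ x ∈ D, fderiv ℝ F (T x) (T (A x)) = 0) (t : ℝ) (x : V3) :
    F (T (NormedSpace.exp (t • A) x)) = F (T x) := by
  have hF0 : SL (fun x => F (T x)) := h.comp T hT
  refine exp_flow h hT (fun x => ?_) t x
  obtain ⟨u, hu, hux⟩ := mem_closure_iff_seq_limit.mp (hD x)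
  have hsub : ∀ n, IsSub (fun x => F (T x)) (u n) ((fderiv ℝ F (T (u n))).comp T) := by
    intro n y
    have := h.sub_of_hasFDerivAt (hdiff _ (hu n)).hasFDerivAt (T y)
    simpa using this
  obtain ⟨p, hp, χ, hχ, hpt⟩ := hF0.sub_subseq hsub hux
  refine ⟨p, hp, ?_⟩
  have h1 : Tendsto (fun n => ((fderiv ℝ F (T (u (χ n)))).comp T) (A (u (χ n)))) atTop (𝓝 (p (A x))) := by
    have h2 : Tendsto (fun n => A (u (χ n))) atTop (𝓝 (A x)) :=
      (A.continuous.tendsto _).comp (hux.comp hχ.tendsto_atTop)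
    exact ((isBoundedBilinearMap_apply (𝕜 := ℝ) (E := V3) (F := ℝ)).continuous.tendsto (p, A x)).comp
      (hpt.prodMk_nhds h2)
  have h3 : ∀ n, ((fderiv ℝ F (T (u (χ n)))).comp T) (A (u (χ n))) = 0 := fun n => hder _ (hu (χ n))
  simp only [h3] at h1
  exact (tendsto_nhds_unique tendsto_const_nhds h1).symm

theorem exp_corr {R : Type*} [NormedRing R] [NormedAlgebra ℝ R] [CompleteSpace R] {A : R} {b : ℕ → ℝ} {S : ℕ → R}
    (hbp : ∀ n, 0 < b n) (hbt : Tendsto b atTop (𝓝 0))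
    (hlimA : Tendsto (fun n => (b n)⁻¹ • (S n - 1)) atTop (𝓝 A))
    (hSt : Tendsto (fun n => S n - 1) atTop (𝓝 0)) :
    Tendsto (fun n => (b n)⁻¹ • (S n * NormedSpace.exp ((- b n) • A) - 1)) atTop (𝓝 0) := by
  have h1 : Tendsto (fun n => (b n)⁻¹ • (NormedSpace.exp ((- b n) • A) - 1)) atTop (𝓝 (-A)) := by
    have h2 := hasDerivAt_exp_smul_const (𝕂 := ℝ) (-A) 0
    rw [hasDerivAt_iff_tendsto_slope_zero] at h2
    simp only [zero_add, zero_smul, NormedSpace.exp_zero, one_mul] at h2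
    have h3 : Tendsto b atTop (𝓝[≠] 0) := by
      rw [tendsto_nhdsWithin_iff]
      exact ⟨hbt, Eventually.of_forall fun n => (hbp n).ne'⟩
    have h4 := h2.comp h3
    refine h4.congr fun n => ?_
    simp
  have h5 : Tendsto (fun n => (b n)⁻¹ • (S n - 1) + S n * ((b n)⁻¹ • (NormedSpace.exp ((- b n) • A) - 1)))
      atTop (𝓝 (A + 1 * (-A))) := by
    refine hlimA.add (Tendsto.mul ?_ h1)
    simpa using hSt.add_const 1
  simp only [one_mul, add_neg_cancel] at h5
  refine h5.congr fun n => ?_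
  rw [mul_smul_comm, ← smul_add]
  congr 1
  noncomm_ring

set_option maxHeartbeats 2000000 in
theorem exists_A (h : SL F) {T : V3 →L[ℝ] E} (hT : Function.Injective T) {e : E}
    (he : ∀ x, T x ≠ e) (l : V3 →L[ℝ] ℝ) {D : Set V3} (hD : Dense D)
    (hdiff : ∀ x ∈ D, DifferentiableAt ℝ F (T x))
    (heq : ∀ ε : ℝ, ∃ S : V3 →L[ℝ] V3, ∀ x, F (T (S x) + (ε * l (S x)) • e) = F (T x)) :
    ∃ A : V3 →L[ℝ] V3, ∀ x ∈ D, fderiv ℝ F (T x) (T (A x) + l x • e) = 0 := by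
  have : ProperSpace (V3 →L[ℝ] V3) := FiniteDimensional.proper ℝ _
  have hF0 : SL (fun x => F (T x)) := h.comp T hT
  -- uniform lower bound
  obtain ⟨c, hc, hlow⟩ : ∃ c > 0, ∀ (x : V3) (s : ℝ), c * ‖x‖ ≤ F (T x + s • e) := by
    let Ψ : (V3 × ℝ) →L[ℝ] E := T.comp (ContinuousLinearMap.fst ℝ V3 ℝ) +
      (ContinuousLinearMap.snd ℝ V3 ℝ).smulRight e
    have hΨ : Function.Injective Ψ := by
      rw [injective_iff_map_eq_zero]
      rintro ⟨x, s⟩ hx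
      simp [Ψ] at hx
      have hs : s = 0 := by
        by_contra hs
        apply he (-s⁻¹ • x)
        have : T x = - (s • e) := eq_neg_of_add_eq_zero_left hx
        rw [map_smul, this, smul_neg, neg_smul, neg_neg, smul_smul, inv_mul_cancel₀ hs, one_smul]
      subst hs
      simp only [zero_smul, add_zero] at hx
      have : x = 0 := hT (by simpa using hx)
      simp [this]
    obtain ⟨c, hc, hc2⟩ := (h.comp Ψ hΨ).lower
    refine ⟨c, hc, fun x s => ?_⟩
    have h1 := hc2 (x, s)
    simp [Ψ] at h1
    refine le_trans ?_ h1
    gcongr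
    exact le_max_left _ _
  obtain ⟨C, hC, hup⟩ := hF0.upper
  set 𝒮 : ℝ → Set (V3 →L[ℝ] V3) := fun ε => {S | ∀ x, F (T (S x) + (ε * l (S x)) • e) = F (T x)} with h𝒮
  have hbd : ∀ ε, ∀ S ∈ 𝒮 ε, ‖S‖ ≤ C / c := by
    intro ε S hS
    refine ContinuousLinearMap.opNorm_le_bound _ (by positivity) fun x => ?_
    have h1 := hlow (S x) (ε * l (S x))
    rw [hS x] at h1
    have h2 := h1.trans (hup x)
    rw [div_mul_eq_mul_div, le_div_iff₀ hc]
    linarith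
  have happ : ∀ x : V3, Continuous fun S : V3 →L[ℝ] V3 => S x := fun x =>
    (ContinuousLinearMap.apply ℝ V3 x).continuous
  have hclosed : ∀ ε, IsClosed (𝒮 ε) := by
    intro ε
    have : 𝒮 ε = ⋂ x, {S | F (T (S x) + (ε * l (S x)) • e) = F (T x)} := by
      ext S; simp [h𝒮]
    rw [this]
    refine isClosed_iInter fun x => isClosed_eq ?_ continuous_const
    have := happ x
    refine h.cont.comp ?_
    fun_prop
  have hcpt : ∀ ε, IsCompact (𝒮 ε) := fun ε =>
    (isCompact_closedBall (0 : V3 →L[ℝ] V3) (C / c)).of_isClosed_subset (hclosed ε)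
      (fun S hS => by simpa using hbd ε S hS)
  have hmin : ∀ ε, ∃ S ∈ 𝒮 ε, ∀ S' ∈ 𝒮 ε, ‖S - 1‖ ≤ ‖S' - 1‖ := by
    intro ε
    obtain ⟨S, hS, hm⟩ := (hcpt ε).exists_isMinOn (f := fun S : V3 →L[ℝ] V3 => ‖S - 1‖) (heq ε) (by fun_prop)
    exact ⟨S, hS, fun S' hS' => hm hS'⟩
  choose S hS hSmin using hmin
  -- symmetries can be composed
  have hsym : ∀ ε, ∀ S ∈ 𝒮 ε, ∀ g : V3 →L[ℝ] V3, (∀ x, F (T (g x)) = F (T x)) → S * g ∈ 𝒮 ε := by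
    intro ε S hS g hg x
    have := hS (g x)
    rw [hg] at this
    simpa using this
  set ε0 : ℕ → ℝ := fun n => 1 / ((n : ℝ) + 1) with hε0
  have hε0p : ∀ n, 0 < ε0 n := fun n => by simp only [hε0]; positivity
  have hε0t : Tendsto ε0 atTop (𝓝 0) := tendsto_one_div_add_atTop_nhds_zero_nat
  obtain ⟨S1, -, φ, hφ, hlim⟩ := (isCompact_closedBall (0 : V3 →L[ℝ] V3) (C / c)).tendsto_subseq
    (x := fun n => S (ε0 n)) (fun n => by simpa using hbd _ _ (hS (ε0 n)))
  have hS1 : ∀ x, F (T (S1 x)) = F (T x) := by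
    intro x
    have h1 : Tendsto (fun n => F (T (S (ε0 (φ n)) x) + (ε0 (φ n) * l (S (ε0 (φ n)) x)) • e)) atTop
        (𝓝 (F (T (S1 x) + (0 * l (S1 x)) • e))) := by
      refine (h.cont.tendsto _).comp ?_
      have h2 : Tendsto (fun n => S (ε0 (φ n)) x) atTop (𝓝 (S1 x)) := ((happ x).tendsto _).comp hlim
      refine ((T.continuous.tendsto _).comp h2).add (Tendsto.smul_const ?_ e)
      exact (hε0t.comp hφ.tendsto_atTop).mul ((l.continuous.tendsto _).comp h2)
    simp only [hS _ x, zero_mul, zero_smul, add_zero] at h1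
    exact (tendsto_nhds_unique tendsto_const_nhds h1).symm
  have hS1inj : Function.Injective S1 := by
    rw [injective_iff_map_eq_zero]
    intro x hx
    by_contra hne
    have h1 := hS1 x
    rw [hx, map_zero, h.zero] at h1
    exact (hF0.pos x hne).ne h1
  obtain ⟨g, hg1, hg2⟩ : ∃ g : V3 →L[ℝ] V3, S1 * g = 1 ∧ ∀ x, F (T (g x)) = F (T x) := by
    let G := (LinearEquiv.ofInjectiveEndo (S1 : V3 →ₗ[ℝ] V3) hS1inj).toContinuousLinearEquiv
    have hG : ∀ x, S1 (G.symm x) = x := fun x => G.apply_symm_apply x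
    refine ⟨(G.symm : V3 →L[ℝ] V3), ContinuousLinearMap.ext fun x => hG x, fun x => ?_⟩
    rw [← hS1]
    change F (T (S1 (G.symm x))) = _
    rw [hG]
  have hDt : Tendsto (fun n => ‖S (ε0 (φ n)) - 1‖) atTop (𝓝 0) := by
    have h1 : Tendsto (fun n => ‖S (ε0 (φ n)) * g - 1‖) atTop (𝓝 ‖S1 * g - 1‖) :=
      ((hlim.mul_const g).sub_const 1).norm
    rw [hg1, sub_self, norm_zero] at h1
    exact squeeze_zero (fun n => norm_nonneg _) (fun n => hSmin _ _ (hsym _ _ (hS _) g hg2)) h1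
  set a : ℕ → ℝ := fun n => max ‖S (ε0 (φ n)) - 1‖ (ε0 (φ n)) with ha
  have hap : ∀ n, 0 < a n := fun n => lt_max_of_lt_right (hε0p _)
  have hat : Tendsto a atTop (𝓝 0) := by
    simpa using hDt.max (hε0t.comp hφ.tendsto_atTop)
  obtain ⟨⟨A, κ⟩, -, ψ, hψ, hlim2⟩ := (isCompact_closedBall (0 : (V3 →L[ℝ] V3) × ℝ) 1).tendsto_subseq
    (x := fun n => ((a n)⁻¹ • (S (ε0 (φ n)) - 1), (a n)⁻¹ * ε0 (φ n))) (fun n => by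
      rw [mem_closedBall_zero_iff, Prod.norm_def]
      refine max_le ?_ ?_
      · simp only [norm_smul, norm_inv, Real.norm_eq_abs, abs_of_pos (hap n)]
        rw [inv_mul_le_iff₀ (hap n), mul_one]; exact le_max_left _ _
      · simp only [norm_mul, norm_inv, Real.norm_eq_abs, abs_of_pos (hap n), abs_of_pos (hε0p _)]
        rw [inv_mul_le_iff₀ (hap n), mul_one]; exact le_max_right _ _)
  set θ : ℕ → ℕ := fun n => φ (ψ n) with hθ
  set b : ℕ → ℝ := fun n => a (ψ n) with hb
  have hbp : ∀ n, 0 < b n := fun n => hap _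
  have hbt : Tendsto b atTop (𝓝 0) := hat.comp hψ.tendsto_atTop
  have hlimA : Tendsto (fun n => (b n)⁻¹ • (S (ε0 (θ n)) - 1)) atTop (𝓝 A) :=
    (continuous_fst.tendsto _).comp hlim2
  have hlimκ : Tendsto (fun n => (b n)⁻¹ * ε0 (θ n)) atTop (𝓝 κ) :=
    (continuous_snd.tendsto _).comp hlim2
  have hSt : Tendsto (fun n => S (ε0 (θ n)) - 1) atTop (𝓝 0) :=
    tendsto_zero_iff_norm_tendsto_zero.mpr (hDt.comp hψ.tendsto_atTop)
  have hκ0 : 0 ≤ κ := ge_of_tendsto' hlimκ fun n => by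
    have := hbp n; have := hε0p (θ n); positivity
  have hder : ∀ x ∈ D, fderiv ℝ F (T x) (T (A x) + (κ * l x) • e) = 0 := by
    intro x hx
    set d : ℕ → E := fun n => T ((S (ε0 (θ n)) - 1) x) + (ε0 (θ n) * l (S (ε0 (θ n)) x)) • e with hd
    have hSx : Tendsto (fun n => S (ε0 (θ n)) x) atTop (𝓝 x) := by
      have := ((happ x).tendsto _).comp hSt
      simpa using this.add_const x
    have hcd : Tendsto (fun n => (b n)⁻¹ • d n) atTop (𝓝 (T (A x) + (κ * l x) • e)) := by
      have h1 : ∀ n, (b n)⁻¹ • d n = T (((b n)⁻¹ • (S (ε0 (θ n)) - 1)) x) +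
          (((b n)⁻¹ * ε0 (θ n)) * l (S (ε0 (θ n)) x)) • e := by
        intro n
        simp only [hd, smul_add, smul_smul, smul_apply, map_smul, mul_assoc]
      simp only [h1]
      refine ((T.continuous.tendsto _).comp (((happ x).tendsto _).comp hlimA)).add (Tendsto.smul_const ?_ e)
      exact hlimκ.mul ((l.continuous.tendsto _).comp hSx)
    have hd0 : Tendsto d atTop (𝓝 0) := by
      have h1 := hbt.smul hcd
      rw [zero_smul] at h1
      refine h1.congr fun n => ?_
      rw [smul_smul, mul_inv_cancel₀ (hbp n).ne', one_smul]
    have h3 := HasFDerivWithinAt.lim (s := Set.univ) (hdiff x hx).hasFDerivAt.hasFDerivWithinAt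
      (l := atTop) (c := fun n => (b n)⁻¹) (d := d) hd0 (by simp) hcd
    have h4 : ∀ n, F (T x + d n) = F (T x) := by
      intro n
      have := hS (ε0 (θ n)) x
      rw [← this]
      congr 1
      simp only [hd, sub_apply, map_sub, one_apply_eq_self]
      abel
    simp only [h4, sub_self, smul_zero] at h3
    exact (tendsto_nhds_unique tendsto_const_nhds h3).symm
  by_cases hκ : κ = 0
  · exfalso
    subst hκ
    -- eventually `b n = ‖S - 1‖`
    have hbn : ∀ᶠ n in atTop, b n = ‖S (ε0 (θ n)) - 1‖ := by
      filter_upwards [hlimκ.eventually (gt_mem_nhds (zero_lt_one))] with n hn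
      have h1 : ε0 (θ n) < b n := by
        rw [inv_mul_lt_iff₀ (hbp n), mul_one] at hn; exact hn
      have h2 : b n = max ‖S (ε0 (θ n)) - 1‖ (ε0 (θ n)) := rfl
      rcases max_choice ‖S (ε0 (θ n)) - 1‖ (ε0 (θ n)) with h3 | h3
      · rw [h2, h3]
      · rw [h2, h3] at h1; exact absurd h1 (lt_irrefl _)
    have hder' : ∀ x ∈ D, fderiv ℝ F (T x) (T (A x)) = 0 := fun x hx => by
      simpa only [zero_mul, zero_smul, add_zero] using hder x hx
    have hexp : ∀ (t : ℝ) x, F (T (NormedSpace.exp (t • A) x)) = F (T x) :=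
      exp_sym h hT hD hdiff hder'
    have hle : ∀ n, ‖S (ε0 (θ n)) - 1‖ ≤ ‖S (ε0 (θ n)) * NormedSpace.exp ((- b n) • A) - 1‖ :=
      fun n => hSmin _ _ (hsym _ _ (hS _) _ (fun x => hexp _ x))
    have hz : Tendsto (fun n => (b n)⁻¹ • (S (ε0 (θ n)) * NormedSpace.exp ((- b n) • A) - 1)) atTop (𝓝 0) :=
      exp_corr hbp hbt hlimA hSt
    have h1 : ∀ᶠ n in atTop, (1 : ℝ) ≤ ‖(b n)⁻¹ • (S (ε0 (θ n)) * NormedSpace.exp ((- b n) • A) - 1)‖ := by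
      filter_upwards [hbn] with n hn
      rw [norm_smul, norm_inv, Real.norm_eq_abs, abs_of_pos (hbp n), ← div_eq_inv_mul, le_div_iff₀ (hbp n), one_mul]
      exact hn.le.trans (hle n)
    have h2 := ge_of_tendsto hz.norm h1
    rw [norm_zero] at h2
    linarith
  · refine ⟨κ⁻¹ • A, fun x hx => ?_⟩
    have h1 := hder x hx
    have e1 : T ((κ⁻¹ • A) x) + l x • e = κ⁻¹ • (T (A x) + (κ * l x) • e) := by
      rw [smul_add, smul_smul, ← mul_assoc, inv_mul_cancel₀ hκ, one_mul]
      simp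
    rw [e1, map_smul, h1, smul_zero]

end C


section C2
variable {E : Type*} [NormedAddCommGroup E] [NormedSpace ℝ E] [FiniteDimensional ℝ E]
  {F : E → ℝ}

structure Ban {E : Type*} [NormedAddCommGroup E] [NormedSpace ℝ E] (F : E → ℝ) : Prop where
  sl : SL F
  eqv : ∀ T T' : V3 →L[ℝ] E, Function.Injective T → Function.Injective T' →
    ∃ g : V3 ≃L[ℝ] V3, ∀ x, F (T' (g x)) = F (T x)

theorem exists_compl (hE : Module.finrank ℝ E = 4) (T : V3 →L[ℝ] E) : ∃ e, ∀ x, T x ≠ e := by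
  by_contra hc
  push Not at hc
  have h1 : Function.Surjective T := hc
  have h2 := LinearMap.finrank_le_finrank_of_surjective (f := (T : V3 →ₗ[ℝ] E)) h1
  rw [hE] at h2
  simp at h2

theorem inj_pert {T : V3 →L[ℝ] E} (hT : Function.Injective T) {e : E} (he : ∀ x, T x ≠ e) (l : V3 →L[ℝ] ℝ) :
    Function.Injective (T + l.smulRight e) := by
  rw [injective_iff_map_eq_zero]
  intro x hx
  simp only [add_apply, ContinuousLinearMap.smulRight_apply] at hx
  have hs : l x = 0 := by
    by_contra hs
    apply he (-(l x)⁻¹ • x)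
    have : T x = - (l x • e) := eq_neg_of_add_eq_zero_left hx
    rw [map_smul, this, smul_neg, neg_smul, neg_neg, smul_smul, inv_mul_cancel₀ hs, one_smul]
  rw [hs, zero_smul, add_zero] at hx
  exact hT (by simpa using hx)

noncomputable def mkR (A1 A2 A3 : V3 →L[ℝ] V3) : RMap where
  toFun l := l (1,0,0) • A1 + l (0,1,0) • A2 + l (0,0,1) • A3
  map_add' l m := by simp only [add_apply]; module
  map_smul' c l := by simp only [smul_apply, smul_eq_mul, RingHom.id_apply]; module

theorem exists_R (h : Ban F) {T : V3 →L[ℝ] E} (hT : Function.Injective T) {e : E}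
    (he : ∀ x, T x ≠ e) {D : Set V3} (hD : Dense D)
    (hdiff : ∀ x ∈ D, DifferentiableAt ℝ F (T x)) :
    ∃ R : RMap, ∀ x ∈ D, ∀ l : V3 →L[ℝ] ℝ, fderiv ℝ F (T x) (T (R l x) + l x • e) = 0 := by
  have key : ∀ l : V3 →L[ℝ] ℝ, ∃ A : V3 →L[ℝ] V3, ∀ x ∈ D, fderiv ℝ F (T x) (T (A x) + l x • e) = 0 := by
    intro l
    refine exists_A h.sl hT he l hD hdiff fun ε => ?_
    obtain ⟨g, hg⟩ := h.eqv T (T + (ε • l).smulRight e) hT (inj_pert hT he _)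
    exact ⟨(g : V3 →L[ℝ] V3), fun x => by simpa using hg x⟩
  obtain ⟨A1, h1⟩ := key (fun3 1 0 0)
  obtain ⟨A2, h2⟩ := key (fun3 0 1 0)
  obtain ⟨A3, h3⟩ := key (fun3 0 0 1)
  refine ⟨mkR A1 A2 A3, fun x hx l => ?_⟩
  have e1 : T (mkR A1 A2 A3 l x) + l x • e = l (1,0,0) • (T (A1 x) + (fun3 1 0 0 x) • e) +
    l (0,1,0) • (T (A2 x) + (fun3 0 1 0 x) • e) + l (0,0,1) • (T (A3 x) + (fun3 0 0 1 x) • e) := by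
    have e2 : mkR A1 A2 A3 l x = l (1,0,0) • A1 x + l (0,1,0) • A2 x + l (0,0,1) • A3 x := rfl
    rw [e2, clm3_apply l x]
    simp only [map_add, map_smul, fun3_apply]
    module
  rw [e1, map_add, map_add, map_smul, map_smul, map_smul, h1 x hx, h2 x hx, h3 x hx]
  simp

theorem gen_alt (h : Ban F) (hE : Module.finrank ℝ E = 4) {T : V3 →L[ℝ] E} (hT : Function.Injective T)
    {D : Set V3} (hD : Dense D)
    (hdiff : ∀ x ∈ D, DifferentiableAt ℝ F (T x)) :
    IsQuad (fun x => F (T x)) ∨ ∃ u : E, u ≠ 0 ∧ ∀ x (t : ℝ), F (T x) ≤ F (T x + t • u) := by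
  obtain ⟨e, he⟩ := exists_compl hE T
  obtain ⟨R, hR⟩ := exists_R h hT he hD hdiff
  have hF0 : SL (fun x => F (T x)) := h.sl.comp T hT
  have hall : ∀ x, ∃ P, IsSub F (T x) P ∧ ∀ l : V3 →L[ℝ] ℝ, P (T (R l x)) + l x * P e = 0 := by
    intro x
    obtain ⟨u, hu, hux⟩ := mem_closure_iff_seq_limit.mp (hD x)
    have hsub : ∀ n, IsSub F (T (u n)) (fderiv ℝ F (T (u n))) :=
      fun n => h.sl.sub_of_hasFDerivAt (hdiff _ (hu n)).hasFDerivAt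
    obtain ⟨P, hP, χ, hχ, hpt⟩ := h.sl.sub_subseq hsub ((T.continuous.tendsto _).comp hux)
    refine ⟨P, hP, fun l => ?_⟩
    have hux2 : Tendsto (fun n => u (χ n)) atTop (𝓝 x) := hux.comp hχ.tendsto_atTop
    have h1 : Tendsto (fun n => (fderiv ℝ F (T (u (χ n)))) (T (R l (u (χ n))) + l (u (χ n)) • e)) atTop
        (𝓝 (P (T (R l x) + l x • e))) := by
      have h2 : Tendsto (fun n => T (R l (u (χ n))) + l (u (χ n)) • e) atTop (𝓝 (T (R l x) + l x • e)) := by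
        have hc : Continuous fun y => T (R l y) + l y • e := by fun_prop
        exact (hc.tendsto x).comp hux2
      exact ((isBoundedBilinearMap_apply (𝕜 := ℝ) (E := E) (F := ℝ)).continuous.tendsto (P, _)).comp
        (hpt.prodMk_nhds h2)
    simp only [hR _ (hu (χ _)) l] at h1
    have := (tendsto_nhds_unique tendsto_const_nhds h1).symm
    simpa using this
  have hsubc : ∀ x P, IsSub F (T x) P → IsSub (fun x => F (T x)) x (P.comp T) := by
    intro x P hP y
    have := hP (T y)
    simpa using this
  have hadm : ∀ x P, IsSub F (T x) P → (∀ l : V3 →L[ℝ] ℝ, P (T (R l x)) + l x * P e = 0) →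
      AdmR (fun x => F (T x)) R x (P.comp T) := by
    intro x P hP hl
    refine ⟨hsubc x P hP, fun l m => ?_⟩
    simp only [ContinuousLinearMap.comp_apply]
    linear_combination l x * hl m - m x * hl l
  have hyp : HypR (fun x => F (T x)) R := ⟨hF0, fun x => by
    obtain ⟨P, hP, hl⟩ := hall x
    exact ⟨_, hadm x P hP hl⟩⟩
  rcases prop_main hyp with hq | ⟨w, D', hD', hK⟩
  · exact Or.inl hq
  · refine Or.inr ⟨T w + e, ?_, ?_⟩
    · intro h0
      apply he (-w)
      rw [map_neg]; exact neg_eq_of_add_eq_zero_right h0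
    · have hD2 : ∀ x ∈ D', ∀ t : ℝ, F (T x) ≤ F (T x + t • (T w + e)) := by
        intro x hx t
        by_cases hx0 : x = 0
        · rw [hx0, map_zero, h.sl.zero]; exact h.sl.nonneg _
        obtain ⟨P, hP, hl⟩ := hall x
        have h1 := hK x hx _ (hadm x P hP hl)
        obtain ⟨l, hl0⟩ : ∃ l : V3 →L[ℝ] ℝ, l x ≠ 0 := by
          by_contra hc
          push Not at hc
          apply hx0
          have a1 := hc (fun3 1 0 0)
          have a2 := hc (fun3 0 1 0)
          have a3 := hc (fun3 0 0 1)
          simp at a1 a2 a3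
          ext <;> simp [a1, a2, a3]
        have h2 := h1 l
        have h3 := hl l
        simp only [ContinuousLinearMap.comp_apply] at h2
        have h4 : P (T w + e) = 0 := by
          have : l x * P (T w + e) = 0 := by rw [map_add]; linear_combination h3 - h2
          exact (mul_eq_zero.mp this).resolve_left hl0
        have h5 := hP (T x + t • (T w + e))
        rw [add_sub_cancel_left, map_smul, h4] at h5
        simpa using h5
      intro x t
      have hcl : IsClosed {x : V3 | F (T x) ≤ F (T x + t • (T w + e))} := by
        have := h.sl.cont
        exact isClosed_le (by fun_prop) (by fun_prop)
      have := hD'.closure_eq ▸ hcl.closure_subset_iff.mpr (fun x hx => hD2 x hx t)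
      exact this (Set.mem_univ x)

theorem inj_open (T : V3 →L[ℝ] E) (hT : Function.Injective T) : ∃ ε > 0, ∀ T' : V3 →L[ℝ] E,
    ‖T' - T‖ < ε → Function.Injective T' := by
  obtain ⟨K, hK, hA⟩ := (T : V3 →ₗ[ℝ] E).exists_antilipschitzWith (LinearMap.ker_eq_bot.mpr hT)
  refine ⟨(K : ℝ)⁻¹, by positivity, fun T' h => ?_⟩
  rw [injective_iff_map_eq_zero]
  intro x hx
  by_contra hne
  have h1 : ‖x‖ ≤ K * ‖T x‖ := by
    have := hA.le_mul_dist x 0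
    simpa [dist_eq_norm] using this
  have h2 : ‖T x‖ ≤ ‖T' - T‖ * ‖x‖ := by
    have := (T' - T).le_opNorm x
    simpa [hx] using this
  have hp : 0 < ‖x‖ := norm_pos_iff.mpr hne
  have hK' : (0 : ℝ) < K := hK
  have h3 : K * ‖T' - T‖ < 1 := by
    rw [← mul_inv_cancel₀ hK'.ne']; gcongr
  nlinarith

/-- Theorem C -/
theorem thmC (h : Ban F) (hE : Module.finrank ℝ E = 4) :
    (∃ T : V3 →L[ℝ] E, Function.Injective T ∧ IsQuad (fun x => F (T x))) ∨
    ∀ T : V3 →L[ℝ] E, Function.Injective T → ∃ u : E, u ≠ 0 ∧ ∀ x (t : ℝ), F (T x) ≤ F (T x + t • u) := by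
  by_cases hq : ∃ T : V3 →L[ℝ] E, Function.Injective T ∧ IsQuad (fun x => F (T x))
  · exact Or.inl hq
  refine Or.inr fun T hT => ?_
  letI : MeasurableSpace E := borel E
  haveI : BorelSpace E := ⟨rfl⟩
  have : ProperSpace E := FiniteDimensional.proper ℝ E
  obtain ⟨ε, hε, hinj⟩ := inj_open T hT
  have key : ∀ n : ℕ, ∃ T' : V3 →L[ℝ] E, ‖T' - T‖ ≤ 1 / ((n : ℝ) + 1) ∧ ∃ u ∈ Metric.sphere (0 : E) 1,
      ∀ x (t : ℝ), F (T' x) ≤ F (T' x + t • u) := by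
    intro n
    obtain ⟨T', hT', D, hD, hdiff⟩ := h.sl.generic T (show 0 < min ε (1 / ((n : ℝ) + 1)) by positivity)
    have hT'i := hinj T' (hT'.trans_le (min_le_left _ _))
    refine ⟨T', (hT'.trans_le (min_le_right _ _)).le, ?_⟩
    rcases gen_alt h hE hT'i hD hdiff with h1 | ⟨u, hu, h1⟩
    · exact absurd ⟨T', hT'i, h1⟩ hq
    · refine ⟨‖u‖⁻¹ • u, by simp [norm_smul, hu], fun x t => ?_⟩
      rw [smul_smul]; exact h1 x _
  choose T' hT' u hu hle using key
  obtain ⟨v, hv, φ, hφ, hlim⟩ := (isCompact_sphere (0 : E) 1).tendsto_subseq hu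
  have hTt : Tendsto T' atTop (𝓝 T) := by
    rw [tendsto_iff_norm_sub_tendsto_zero]
    exact squeeze_zero (fun n => norm_nonneg _) hT' tendsto_one_div_add_atTop_nhds_zero_nat
  refine ⟨v, ?_, fun x t => ?_⟩
  · intro h0; rw [h0] at hv; simp at hv
  have h1 : Tendsto (fun n => T' (φ n) x) atTop (𝓝 (T x)) :=
    ((ContinuousLinearMap.apply ℝ E x).continuous.tendsto T).comp (hTt.comp hφ.tendsto_atTop)
  exact le_of_tendsto_of_tendsto' ((h.sl.cont.tendsto _).comp h1)
    ((h.sl.cont.tendsto _).comp (h1.add (hlim.const_smul t))) (fun n => hle (φ n) x t)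

end C2


/-- numerical lemma -/
theorem num_lim {g s : ℝ → ℝ} {c : ℝ} (hc : 0 < c) (hg : ∀ a, 0 ≤ a → a ≤ 1 → c ≤ g a)
    (hs : ∀ a b, 0 ≤ a → a ≤ 1 → 0 ≤ b → b ≤ 1 → g a + s a * (b - a) ≤ g b) :
    ∃ N0 : ℕ, 0 < N0 ∧ (∀ N ≥ N0, ∀ i < N, 0 < g (i / N) + s (i / N) * (1 / N)) ∧
    Tendsto (fun N : ℕ => ∏ i ∈ Finset.range N, g (i / N) / (g (i / N) + s (i / N) * (1 / N))) atTop
      (𝓝 (g 0 / g 1)) := by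
  have hmono : ∀ a b, 0 ≤ a → a ≤ b → b ≤ 1 → s a ≤ s b := by
    intro a b ha hab hb
    rcases hab.eq_or_lt with rfl | hlt
    · exact le_rfl
    have h1 := hs a b ha (hab.trans hb) (ha.trans hab) hb
    have h2 := hs b a (ha.trans hab) hb ha (hab.trans hb)
    nlinarith
  set K := |s 0| + |s 1| with hK
  have hKs : ∀ a, 0 ≤ a → a ≤ 1 → -K ≤ s a := by
    intro a ha ha1
    have := hmono 0 a le_rfl ha ha1
    have h1 := neg_abs_le (s 0)
    have h2 := abs_nonneg (s 1)
    linarith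
  have hK0 : 0 ≤ K := by positivity
  obtain ⟨N0, hN0⟩ := exists_nat_gt (2 * K / c)
  have hlow : ∀ N ≥ N0 + 1, ∀ i < N, c / 2 ≤ g (i / N) + s (i / N) * (1 / N) := by
    intro N hN i hi
    have hNp : (0 : ℝ) < N := by
      have : 0 < N := by omega
      exact_mod_cast this
    have hi0 : (0 : ℝ) ≤ (i : ℝ) / N := by positivity
    have hi1 : (i : ℝ) / N ≤ 1 := by
      rw [div_le_one hNp]; exact_mod_cast hi.le
    have h1 := hg _ hi0 hi1
    have h2 := hKs _ hi0 hi1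
    have h3 : K * (1 / N) ≤ c / 2 := by
      have h4 : (N0 : ℝ) ≤ N := by exact_mod_cast (by omega : N0 ≤ N)
      have h5 : 2 * K / c < N := hN0.trans_le h4
      rw [div_lt_iff₀ hc] at h5
      rw [mul_one_div, div_le_iff₀ hNp]
      linarith
    have h4 : (0 : ℝ) ≤ 1 / N := by positivity
    nlinarith
  refine ⟨N0 + 1, by omega, fun N hN i hi => (by positivity : 0 < c / 2).trans_le (hlow N hN i hi), ?_⟩
  have hg0 : 0 < g 0 := hc.trans_le (hg 0 le_rfl zero_le_one)
  have hg1 : 0 < g 1 := hc.trans_le (hg 1 zero_le_one le_rfl)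
  -- bounds
  have hb : ∀ N ≥ N0 + 1, g 0 / g 1 ≤ ∏ i ∈ Finset.range N, g (i / N) / (g (i / N) + s (i / N) * (1 / N)) ∧
      ∏ i ∈ Finset.range N, g (i / N) / (g (i / N) + s (i / N) * (1 / N)) ≤
        g 0 / g 1 * Real.exp ((s 1 - s 0) / (c / 2) * (1 / N)) := by
    intro N hN
    have hNn : 0 < N := by omega
    have hNp : (0 : ℝ) < N := by exact_mod_cast hNn
    have hin : ∀ i ≤ N, 0 ≤ (i : ℝ) / N ∧ (i : ℝ) / N ≤ 1 := fun i hi =>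
      ⟨by positivity, by rw [div_le_one hNp]; exact_mod_cast hi⟩
    have hgp : ∀ i ≤ N, 0 < g (i / N) := fun i hi => hc.trans_le (hg _ (hin i hi).1 (hin i hi).2)
    have htel : ∀ n ≤ N, ∏ i ∈ Finset.range n, (g (i / N) / g ((i + 1 : ℕ) / N)) = g 0 / g (n / N) := by
      intro n hn
      induction n with
      | zero => simp [hg0.ne']
      | succ n ih =>
        rw [Finset.prod_range_succ, ih (by omega)]
        have h1 := (hgp n (by omega)).ne'
        have h2 := (hgp (n+1) hn).ne'
        field_simp
    have htelN := htel N le_rfl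
    rw [div_self hNp.ne'] at htelN
    have hd : ∀ i < N, 0 < g (i / N) + s (i / N) * (1 / N) := fun i hi =>
      (by positivity : 0 < c / 2).trans_le (hlow N hN i hi)
    have hstep : ∀ i : ℕ, ((i + 1 : ℕ) : ℝ) / N - i / N = 1 / N := by
      intro i; push_cast; field_simp; ring
    constructor
    · rw [← htelN]
      refine Finset.prod_le_prod (fun i hi => ?_) (fun i hi => ?_)
      · have hi := Finset.mem_range.mp hi
        have h1 := hgp i hi.le
        have h2 := hgp (i+1) hi
        positivity
      · have hi := Finset.mem_range.mp hi
        have h1 := hgp i hi.le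
        have h2 := hs (i / N) ((i + 1 : ℕ) / N) (hin i hi.le).1 (hin i hi.le).2 (hin (i+1) hi).1 (hin (i+1) hi).2
        rw [hstep] at h2
        exact div_le_div_of_nonneg_left h1.le (hd i hi) h2
    · have hexp : ∀ i < N, g (i / N) / (g (i / N) + s (i / N) * (1 / N)) ≤
          (g (i / N) / g ((i + 1 : ℕ) / N)) *
            Real.exp ((s ((i+1 : ℕ) / N) - s (i / N)) / (c / 2) * (1 / N)) := by
        intro i hi
        have h1 := hgp i hi.le
        have h2 := hgp (i+1) hi
        have h3 := hs ((i + 1 : ℕ) / N) (i / N) (hin (i+1) hi).1 (hin (i+1) hi).2 (hin i hi.le).1 (hin i hi.le).2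
        have h4 : (i : ℝ) / N - (i + 1 : ℕ) / N = - (1 / N) := by linarith [hstep i]
        rw [h4] at h3
        have h5 := hd i hi
        have h6 := hlow N hN i hi
        have h7 := Real.add_one_le_exp ((s ((i+1 : ℕ) / N) - s (i / N)) / (c / 2) * (1 / N))
        have hm := hmono (i / N) ((i+1 : ℕ)/N) (hin i hi.le).1 (by have := hstep i; have : (0:ℝ) ≤ 1 / N := by positivity
                                                                   linarith) (hin (i+1) hi).2
        set A := g (i / N)
        set B := g ((i + 1 : ℕ) / N)
        set p := s (i / N)
        set q := s ((i + 1 : ℕ) / N)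
        set hh : ℝ := 1 / N
        have hhp : 0 < hh := by positivity
        set X := Real.exp ((q - p) / (c / 2) * hh)
        have h8 : B ≤ X * (A + p * hh) := by
          have h9 : ((q - p) / (c / 2) * hh) * (c / 2) = (q - p) * hh := by field_simp
          have h10 : 0 ≤ (q - p) / (c / 2) * hh := by
            have : 0 ≤ q - p := by linarith
            positivity
          calc B ≤ A + q * hh := by linarith
            _ = (A + p * hh) + ((q - p) / (c / 2) * hh) * (c / 2) := by rw [h9]; ring
            _ ≤ (A + p * hh) + ((q - p) / (c / 2) * hh) * (A + p * hh) := by gcongr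
            _ = ((q - p) / (c / 2) * hh + 1) * (A + p * hh) := by ring
            _ ≤ X * (A + p * hh) := by gcongr
        rw [div_mul_eq_mul_div, div_le_div_iff₀ h5 h2]
        nlinarith
      calc _ ≤ ∏ i ∈ Finset.range N, (g (i / N) / g ((i + 1 : ℕ) / N)) *
            Real.exp ((s ((i+1 : ℕ) / N) - s (i / N)) / (c / 2) * (1 / N)) := by
            refine Finset.prod_le_prod (fun i hi => ?_) (fun i hi => hexp i (Finset.mem_range.mp hi))
            have hi := Finset.mem_range.mp hi
            exact (div_pos (hgp i hi.le) (hd i hi)).le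
        _ = _ := by
            rw [Finset.prod_mul_distrib, htelN, ← Real.exp_sum, ← Finset.sum_mul, ← Finset.sum_div,
              Finset.sum_range_sub (fun i : ℕ => s (i / N))]
            simp [div_self hNp.ne']
  refine tendsto_of_tendsto_of_tendsto_of_le_of_le' tendsto_const_nhds ?_
    ((eventually_ge_atTop (N0 + 1)).mono fun N hN => (hb N hN).1)
    ((eventually_ge_atTop (N0 + 1)).mono fun N hN => (hb N hN).2)
  have h1 : Tendsto (fun N : ℕ => g 0 / g 1 * Real.exp ((s 1 - s 0) / (c / 2) * (1 / (N : ℝ)))) atTop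
      (𝓝 (g 0 / g 1 * Real.exp ((s 1 - s 0) / (c / 2) * 0))) := by
    refine Tendsto.const_mul _ ((Real.continuous_exp.tendsto _).comp (Tendsto.const_mul _ ?_))
    exact tendsto_one_div_atTop_nhds_zero_nat
  simpa using h1

section Kak
variable {U : Type*} [NormedAddCommGroup U] [NormedSpace ℝ U] [FiniteDimensional ℝ U]
  {G : U × ℝ × ℝ → ℝ}

def KK (G : U × ℝ × ℝ → ℝ) : Prop := ∀ m : ℝ × ℝ, m ≠ 0 → ∃ e : U × ℝ × ℝ, e ≠ 0 ∧
  ∀ (w : U) (t s : ℝ), G (w, t • m) ≤ G ((w, t • m) + s • e)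

noncomputable def gam (G : U × ℝ × ℝ → ℝ) (m : ℝ × ℝ) : ℝ := ⨅ w : U, G (w, m)

theorem gam_le (h : SL G) (m : ℝ × ℝ) (w : U) : gam G m ≤ G (w, m) :=
  ciInf_le ⟨0, by rintro _ ⟨w, rfl⟩; exact h.nonneg _⟩ w

theorem gam_lower (h : SL G) : ∃ c > 0, ∀ m, c * ‖m‖ ≤ gam G m := by
  obtain ⟨c, hc, hl⟩ := h.lower
  refine ⟨c, hc, fun m => le_ciInf fun w => le_trans ?_ (hl _)⟩
  gcongr
  exact le_max_right _ _

theorem gam_pos (h : SL G) {m : ℝ × ℝ} (hm : m ≠ 0) : 0 < gam G m := by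
  obtain ⟨c, hc, hl⟩ := gam_lower h
  exact lt_of_lt_of_le (mul_pos hc (norm_pos_iff.mpr hm)) (hl m)

theorem gam_scale (h : SL G) {t : ℝ} (ht : 0 < t) (m : ℝ × ℝ) (w : U) : t * gam G m ≤ G (w, t • m) := by
  have h1 := gam_le h m (t⁻¹ • w)
  have h2 : (w, t • m) = t • ((t⁻¹ • w, m) : U × ℝ × ℝ) := by
    refine Prod.ext ?_ rfl
    change w = t • t⁻¹ • w
    rw [smul_smul, mul_inv_cancel₀ ht.ne', one_smul]
  rw [h2, h.smul _ _ ht.le]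
  gcongr

theorem gam_mono (h : SL G) {m m' : ℝ × ℝ} {ρ : ℝ} (hρ : 0 < ρ) (u : U)
    (hle : ∀ w, G (w, m) ≤ G (w + u, ρ • m')) : gam G m ≤ ρ * gam G m' := by
  rw [← div_le_iff₀' hρ]
  refine le_ciInf fun w => ?_
  rw [div_le_iff₀' hρ]
  refine (gam_le h m (ρ • w - u)).trans ((hle _).trans ?_)
  rw [sub_add_cancel, ← Prod.smul_mk, h.smul _ _ hρ.le]

def mm (a : ℝ) : ℝ × ℝ := (1 - a, a)

theorem mm_ne (a : ℝ) : mm a ≠ 0 := by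
  intro h
  have h1 := congrArg Prod.fst h
  have h2 := congrArg Prod.snd h
  simp [mm] at h1 h2
  linarith

theorem kk_norm (h : SL G) (hk : KK G) (a : ℝ) : ∃ (κ : ℝ) (u : U), ∀ (w : U) (t s : ℝ),
    G (w, t • mm a) ≤ G (w + s • u, t • mm a + s • ((-1, 1) + κ • mm a)) := by
  obtain ⟨⟨w0, e1, e2⟩, he0, he⟩ := hk (mm a) (mm_ne a)
  set κ := e1 + e2 with hκ
  set β := e2 - a * κ with hβ
  have hdec : ((e1, e2) : ℝ × ℝ) = β • (-1, 1) + κ • mm a := by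
    ext <;> simp [mm, hβ, hκ] <;> ring
  have hβ0 : β ≠ 0 := by
    intro h0
    rw [h0, zero_smul, zero_add] at hdec
    have h1 := he (-w0) (-κ) 1
    rw [hdec] at he0 h1
    have h2 : ((-w0, (-κ) • mm a) : U × ℝ × ℝ) + (1 : ℝ) • (w0, κ • mm a) = 0 := by
      simp
    rw [h2, h.zero] at h1
    have h3 : ((-w0, (-κ) • mm a) : U × ℝ × ℝ) = - (w0, κ • mm a) := by simp
    rw [h3] at h1
    exact absurd (h.pos _ (neg_ne_zero.mpr he0)) (not_lt.mpr h1)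
  refine ⟨β⁻¹ * κ, β⁻¹ • w0, fun w t s => ?_⟩
  have h1 := he w t (s * β⁻¹)
  rw [hdec] at h1
  have e : ((w + s • β⁻¹ • w0, t • mm a + s • ((-1, 1) + (β⁻¹ * κ) • mm a)) : U × ℝ × ℝ) =
      (w, t • mm a) + (s * β⁻¹) • (w0, β • (-1, 1) + κ • mm a) := by
    refine Prod.ext ?_ ?_
    · change w + s • β⁻¹ • w0 = w + (s * β⁻¹) • w0
      rw [smul_smul]
    · change t • mm a + s • ((-1, 1) + (β⁻¹ * κ) • mm a) = t • mm a + (s * β⁻¹) • (β • (-1, 1) + κ • mm a)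
      congr 1
      rw [smul_add, smul_add, smul_smul, smul_smul, smul_smul, mul_assoc, inv_mul_cancel₀ hβ0, mul_one, mul_assoc]
  rw [e]
  exact h1

def Mv (G : U × ℝ × ℝ → ℝ) (a b ρ : ℝ) : Prop := ∃ u : U, ∀ (w : U) (t : ℝ),
  G (w, t • mm a) ≤ G (w + t • u, (t * ρ) • mm b)

theorem Mv.refl (a : ℝ) : Mv G a a 1 := ⟨0, fun w t => by simp⟩

theorem Mv.trans {a b c ρ σ : ℝ} (h1 : Mv G a b ρ) (h2 : Mv G b c σ) : Mv G a c (ρ * σ) := by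
  obtain ⟨u, hu⟩ := h1
  obtain ⟨v, hv⟩ := h2
  refine ⟨u + ρ • v, fun w t => (hu w t).trans ((hv _ _).trans (le_of_eq ?_))⟩
  congr 2
  · rw [smul_add, smul_smul, add_assoc]
  · rw [mul_assoc]

theorem mm_sub (a b : ℝ) : mm b = mm a + (b - a) • (-1, 1) := by
  ext <;> simp [mm]

theorem Mv.closed (h : SL G) {a b : ℝ} {r : ℕ → ℝ} {ρ : ℝ} (hr : ∀ᶠ n in atTop, Mv G a b (r n))
    (hlim : Tendsto r atTop (𝓝 ρ)) : Mv G a b ρ := by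
  have : ProperSpace U := FiniteDimensional.proper ℝ U
  obtain ⟨c, hc, hlow⟩ := h.lower
  obtain ⟨C, hC, hup⟩ := h.upper
  obtain ⟨n0, hn0⟩ := eventually_atTop.mp (hr.and (hlim.norm.eventually (ge_mem_nhds (lt_add_one ‖ρ‖))))
  have hall : ∀ n, Mv G a b (r (n + n0)) := fun n => (hn0 _ (by omega)).1
  have hbd : ∀ n, ‖r (n + n0)‖ ≤ ‖ρ‖ + 1 := fun n => (hn0 _ (by omega)).2
  choose u hu using hall
  have hub : ∀ n, ‖u n‖ ≤ C * ((‖ρ‖ + 1) * ‖mm b‖) / c := by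
    intro n
    have h1 := hu n (- u n) 1
    rw [one_smul, one_smul, neg_add_cancel, one_mul] at h1
    have h2 := (hlow _).trans (h1.trans (hup _))
    rw [le_div_iff₀' hc]
    refine le_trans ?_ (h2.trans ?_)
    · gcongr; rw [← norm_neg]; exact le_max_left _ _
    · gcongr
      rw [Prod.norm_def]
      simp only [norm_zero]
      rw [max_eq_right (norm_nonneg _), norm_smul]
      gcongr
      exact hbd n
  obtain ⟨v, -, φ, hφ, hv⟩ := (isCompact_closedBall (0 : U) _).tendsto_subseq
    (x := u) (fun n => by simpa using hub n)
  refine ⟨v, fun w t => ?_⟩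
  have h1 : Tendsto (fun n => r (φ n + n0)) atTop (𝓝 ρ) :=
    ((tendsto_add_atTop_iff_nat n0).mpr hlim).comp hφ.tendsto_atTop
  have h2 : Tendsto (fun n => G (w + t • u (φ n), (t * r (φ n + n0)) • mm b)) atTop
      (𝓝 (G (w + t • v, (t * ρ) • mm b))) :=
    (h.cont.tendsto _).comp ((hv.const_smul t).const_add w |>.prodMk_nhds ((h1.const_mul t).smul_const _))
  exact ge_of_tendsto' h2 fun n => hu (φ n) w t

theorem Mv.main (h : SL G) (hk : KK G) : Mv G 0 1 (gam G (mm 0) / gam G (mm 1)) := by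
  choose κ u hku using kk_norm h hk
  obtain ⟨c, hc, hlow⟩ := gam_lower h
  set g : ℝ → ℝ := fun a => gam G (mm a) with hg
  have hgp : ∀ a, 0 < g a := fun a => gam_pos h (mm_ne a)
  have hcg : ∀ a, 0 ≤ a → a ≤ 1 → c / 2 ≤ g a := by
    intro a ha ha1
    refine le_trans ?_ (hlow (mm a))
    have : 1 / 2 ≤ ‖mm a‖ := by
      rw [Prod.norm_def]
      simp only [mm, Real.norm_eq_abs, abs_of_nonneg ha, abs_of_nonneg (sub_nonneg.mpr ha1)]
      rcases le_total a (1/2) with h1 | h1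
      · exact le_max_of_le_left (by linarith)
      · exact le_max_of_le_right h1
    nlinarith
  set s : ℝ → ℝ := fun a => - κ a * g a with hs
  have hsub : ∀ a b, g a + s a * (b - a) ≤ g b := by
    intro a b
    have e : g a + s a * (b - a) = (1 - (b - a) * κ a) * g a := by simp only [hs]; ring
    rw [e]
    rcases le_or_gt (1 - (b - a) * κ a) 0 with h0 | h0
    · exact (mul_nonpos_of_nonpos_of_nonneg h0 (hgp a).le).trans (hgp b).le
    refine le_ciInf fun w => ?_
    have h1 := hku a (w - (b - a) • u a) (1 - (b - a) * κ a) (b - a)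
    have h2 := (gam_scale h h0 (mm a) (w - (b - a) • u a)).trans h1
    convert h2 using 3
    · rw [sub_add_cancel]
    · rw [mm_sub a b]; module
  obtain ⟨N0, hN0, hpos, hlim⟩ := num_lim (c := c / 2) (by positivity) hcg (fun a b _ _ _ _ => hsub a b)
  refine Mv.closed h ?_ hlim
  filter_upwards [eventually_ge_atTop N0] with N hN
  have hNp : (0 : ℝ) < N := by exact_mod_cast (by omega : 0 < N)
  have hstep : ∀ i < N, Mv G (i / N) ((i + 1 : ℕ) / N) (g (i / N) / (g (i / N) + s (i / N) * (1 / N))) := by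
    intro i hi
    have h1 := hpos N hN i hi
    have hst : ((i + 1 : ℕ) : ℝ) / N - i / N = 1 / N := by push_cast; field_simp; ring
    set a : ℝ := i / N
    set b : ℝ := (i + 1 : ℕ) / N
    have e : g a + s a * (1 / N) = (1 - (1 / N) * κ a) * g a := by simp only [hs]; ring
    rw [e] at h1 ⊢
    have h2 : 0 < 1 - (1 / N) * κ a := pos_of_mul_pos_left h1 (hgp a).le
    set d := 1 - (1 / N) * κ a with hd
    have e2 : g a / (d * g a) = d⁻¹ := by
      have := (hgp a).ne'
      field_simp
    rw [e2]
    refine ⟨(d⁻¹ * (1 / N)) • u a, fun w t => ?_⟩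
    have h3 := hku a w t (t * (d⁻¹ * (1 / N)))
    convert h3 using 3
    · rw [smul_smul]
    · rw [mm_sub a b, hst]
      have e3 : t = t * d⁻¹ * d := by rw [mul_assoc, inv_mul_cancel₀ h2.ne', mul_one]
      have e4 : t • mm a = (t * d⁻¹ * (1 - (1 / N) * κ a)) • mm a := by rw [← hd, ← e3]
      rw [e4]
      module
  have hind : ∀ n ≤ N, Mv G 0 (n / N) (∏ i ∈ Finset.range n, g (i / N) / (g (i / N) + s (i / N) * (1 / N))) := by
    intro n hn
    induction n with
    | zero => simpa using Mv.refl 0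
    | succ n ih =>
      rw [Finset.prod_range_succ]
      exact (ih (by omega)).trans (hstep n hn)
  have := hind N le_rfl
  rwa [div_self hNp.ne'] at this

theorem kk_iso (h : SL G) (hk : KK G) (hs : SL fun x : U × ℝ × ℝ => G (x.1, x.2.2, x.2.1)) :
    ∃ (u : U) (ρ : ℝ), 0 < ρ ∧ ∀ (w : U) (t : ℝ), G (w, t, 0) = G (w + t • u, 0, t * ρ) := by
  set G' : U × ℝ × ℝ → ℝ := fun x => G (x.1, x.2.2, x.2.1) with hG'
  have hk' : KK G' := by
    intro m hm
    obtain ⟨e, he0, he⟩ := hk (m.2, m.1) (by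
      intro h0; apply hm
      have h1 := congrArg Prod.fst h0
      have h2 := congrArg Prod.snd h0
      exact Prod.ext h2 h1)
    refine ⟨(e.1, e.2.2, e.2.1), ?_, fun w t s => he w t s⟩
    intro h0
    apply he0
    have h1 := congrArg Prod.fst h0
    have h2 := congrArg (fun x => x.2.1) h0
    have h3 := congrArg (fun x => x.2.2) h0
    exact Prod.ext h1 (Prod.ext h3 h2)
  obtain ⟨u, hu⟩ := Mv.main h hk
  obtain ⟨u', hu'⟩ := Mv.main hs hk'
  have e0 : gam G' (mm 0) = gam G (mm 1) := by simp [gam, hG', mm]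
  have e1 : gam G' (mm 1) = gam G (mm 0) := by simp [gam, hG', mm]
  rw [e0, e1] at hu'
  have p0 := gam_pos h (mm_ne 0)
  have p1 := gam_pos h (mm_ne 1)
  set ρ := gam G (mm 0) / gam G (mm 1) with hρ
  have hρp : 0 < ρ := by positivity
  have hρ' : gam G (mm 1) / gam G (mm 0) = ρ⁻¹ := by rw [hρ, inv_div]
  rw [hρ'] at hu'
  have f1 : ∀ (w : U) (t : ℝ), G (w, t, 0) ≤ G (w + t • u, 0, t * ρ) := by
    intro w t; simpa [mm] using hu w t
  have f2 : ∀ (w : U) (t : ℝ), G (w, 0, t) ≤ G (w + t • u', t * ρ⁻¹, 0) := by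
    intro w t; simpa [mm, hG'] using hu' w t
  set v := u + ρ • u' with hv
  have f3 : ∀ (w : U) (t : ℝ), G (w, t, 0) ≤ G (w + t • v, t, 0) := by
    intro w t
    refine (f1 w t).trans ((f2 _ _).trans (le_of_eq ?_))
    congr 2
    · rw [hv]; module
    · rw [mul_assoc, mul_inv_cancel₀ hρp.ne', mul_one]
  have hv0 : v = 0 := by
    by_contra hne
    have h1 : ∀ k : ℕ, G (-((k : ℝ) • v), 1, 0) ≤ G (0, 1, 0) := by
      intro k
      induction k with
      | zero => simp
      | succ k ih =>
        refine (f3 _ 1).trans (le_trans (le_of_eq ?_) ih)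
        congr 2
        push_cast
        module
    obtain ⟨c, hc, hlow⟩ := h.lower
    obtain ⟨k, hk⟩ := exists_nat_gt (G (0, 1, 0) / (c * ‖v‖))
    have hvp : 0 < ‖v‖ := norm_pos_iff.mpr hne
    rw [div_lt_iff₀ (by positivity)] at hk
    have h2 := (hlow _).trans (h1 k)
    have h3 : (k : ℝ) * ‖v‖ ≤ ‖((-((k : ℝ) • v), 1, 0) : U × ℝ × ℝ)‖ := by
      refine le_trans ?_ (le_max_left _ _)
      simp [norm_smul]
    nlinarith
  refine ⟨u, ρ, hρp, fun w t => le_antisymm (f1 w t) ?_⟩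
  refine (f2 _ _).trans (le_of_eq ?_)
  have e : w + t • u + (t * ρ) • u' = w + t • v := by rw [hv]; module
  rw [e, hv0, smul_zero, add_zero, mul_assoc, mul_inv_cancel₀ hρp.ne', mul_one]

/-- the reflection -/
theorem kk_refl (h : SL G) (hk : KK G) : ∃ v : U, ∀ (w : U) (t : ℝ), G (w + t • v, -t, 0) = G (w, t, 0) := by
  have hperm : ∀ A : (ℝ × ℝ) ≃L[ℝ] (ℝ × ℝ), SL (fun x : U × ℝ × ℝ => G (x.1, A x.2)) ∧ KK (fun x : U × ℝ × ℝ => G (x.1, A x.2)) := by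
    intro A
    refine ⟨h.comp (((ContinuousLinearEquiv.refl ℝ U).prodCongr A : (U × ℝ × ℝ) ≃L[ℝ] (U × ℝ × ℝ)) : (U × ℝ × ℝ) →L[ℝ] (U × ℝ × ℝ))
      (ContinuousLinearEquiv.injective _), ?_⟩
    intro m hm
    obtain ⟨e, he0, he⟩ := hk (A m) (by simpa using hm)
    refine ⟨(e.1, A.symm e.2), ?_, fun w t s => ?_⟩
    · intro h0
      apply he0
      have h1 := congrArg Prod.fst h0
      have h2 := congrArg Prod.snd h0
      exact Prod.ext h1 (by simpa using h2)
    · have e1 : A ((w, t • m) + s • ((e.1, A.symm e.2) : U × ℝ × ℝ)).2 = t • A m + s • e.2 := by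
        change A (t • m + s • A.symm e.2) = _
        rw [map_add, map_smul, map_smul, A.apply_symm_apply]
      have e2 : A ((w, t • m) : U × ℝ × ℝ).2 = t • A m := map_smul A t m
      change G (w, A ((w, t • m) : U × ℝ × ℝ).2) ≤ G (w + s • e.1, A ((w, t • m) + s • ((e.1, A.symm e.2) : U × ℝ × ℝ)).2)
      rw [e1, e2]
      exact he w t s
  let sw : (ℝ × ℝ) ≃L[ℝ] (ℝ × ℝ) := ContinuousLinearEquiv.prodComm ℝ ℝ ℝ
  let ng : (ℝ × ℝ) ≃L[ℝ] (ℝ × ℝ) := (ContinuousLinearEquiv.neg ℝ).prodCongr (ContinuousLinearEquiv.refl ℝ ℝ)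
  obtain ⟨u, ρ, hρ, h1⟩ := kk_iso h hk (hperm sw).1
  obtain ⟨u', ρ', hρ', h2⟩ := kk_iso (hperm (sw.trans ng)).1 (hperm (sw.trans ng)).2
    (hperm (sw.trans (sw.trans ng))).1
  have h2' : ∀ (w : U) (t : ℝ), G (w, 0, t) = G (w + t • u', - (t * ρ'), 0) := by
    intro w t
    have := h2 w t
    simpa [sw, ng] using this
  set c := ρ * ρ' with hc
  have hcp : 0 < c := by positivity
  set v := u + ρ • u' with hv
  have key : ∀ (w : U) (t : ℝ), G (w, t, 0) = G (w + t • v, - (c * t), 0) := by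
    intro w t
    rw [h1, h2']
    congr 2
    · rw [hv]; module
    · congr 1; rw [hc]; ring
  have hc1 : c = 1 := by
    have p1 : 0 < gam G (1, 0) := gam_pos h (by simp)
    have a1 : gam G (1, 0) ≤ c * gam G (-1, 0) := gam_mono h hcp v fun w => by
      have := key w 1
      simp only [one_smul, mul_one] at this
      rw [this]; simp
    have a2 : gam G (-1, 0) ≤ c * gam G (1, 0) := gam_mono h hcp (-v) fun w => by
      have := key w (-1)
      simp only [neg_smul, one_smul] at this
      rw [this]; simp
    have a3 : gam G (-1, 0) ≤ c⁻¹ * gam G (1, 0) := gam_mono h (inv_pos.mpr hcp) (-(c⁻¹ • v)) fun w => by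
      have := key (w - c⁻¹ • v) (c⁻¹)
      rw [sub_add_cancel, mul_inv_cancel₀ hcp.ne'] at this
      rw [← this]; simp [sub_eq_add_neg]
    have a4 : gam G (1, 0) ≤ c⁻¹ * gam G (-1, 0) := gam_mono h (inv_pos.mpr hcp) (c⁻¹ • v) fun w => by
      have := key (w + c⁻¹ • v) (-c⁻¹)
      rw [neg_smul, add_neg_cancel_right, mul_neg, neg_neg, mul_inv_cancel₀ hcp.ne'] at this
      rw [← this]; simp
    rw [inv_mul_eq_div, le_div_iff₀ hcp] at a3 a4
    have b1 : 1 ≤ c ^ 2 := by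
      by_contra hlt
      push Not at hlt
      nlinarith
    have b2 : c ^ 2 ≤ 1 := by
      by_contra hlt
      push Not at hlt
      nlinarith
    have : (c - 1) * (c + 1) = 0 := by nlinarith
    rcases mul_eq_zero.mp this with h | h <;> linarith
  refine ⟨v, fun w t => ?_⟩
  rw [key w t, hc1, one_mul]

end Kak


section refl
open MeasureTheory
variable {F : V3 → ℝ}

theorem volV3 : (volume : Measure V3).IsAddHaarMeasure :=
  have : (volume : Measure (ℝ × ℝ)).IsAddHaarMeasure :=
    inferInstanceAs ((volume : Measure ℝ).prod (volume : Measure ℝ)).IsAddHaarMeasure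
  inferInstanceAs ((volume : Measure ℝ).prod (volume : Measure (ℝ × ℝ))).IsAddHaarMeasure

noncomputable def fun3L : V3 →ₗ[ℝ] (V3 →L[ℝ] ℝ) where
  toFun a := fun3 a.1 a.2.1 a.2.2
  map_add' a b := by
    refine ContinuousLinearMap.ext fun x => ?_
    simp; ring
  map_smul' c a := by
    refine ContinuousLinearMap.ext fun x => ?_
    simp; ring

theorem refl_invol {l : V3 →L[ℝ] ℝ} {S : V3 →L[ℝ] V3} (h1 : ∀ x, l x = 0 → S x = x)
    (h2 : ∀ x, l (S x) = - l x) (x : V3) : S (S x) = x := by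
  have := h1 (x + S x) (by rw [map_add, h2]; ring)
  rw [map_add, add_comm x] at this
  exact add_left_cancel this

theorem invol_mp {S : V3 →L[ℝ] V3} (h : ∀ x, S (S x) = x) :
    MeasurePreserving S (volume : Measure V3) volume := by
  have := volV3
  refine ⟨S.continuous.measurable, ?_⟩
  have hd : LinearMap.det (S : V3 →ₗ[ℝ] V3) * LinearMap.det (S : V3 →ₗ[ℝ] V3) = 1 := by
    rw [← LinearMap.det_comp]
    have : (S : V3 →ₗ[ℝ] V3) ∘ₗ (S : V3 →ₗ[ℝ] V3) = LinearMap.id := LinearMap.ext h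
    rw [this, LinearMap.det_id]
  have hne : LinearMap.det (S : V3 →ₗ[ℝ] V3) ≠ 0 := by
    intro h0; rw [h0] at hd; simp at hd
  have habs : |(LinearMap.det (S : V3 →ₗ[ℝ] V3))⁻¹| = 1 := by
    rw [abs_inv, inv_eq_one]
    have : |LinearMap.det (S : V3 →ₗ[ℝ] V3)| * |LinearMap.det (S : V3 →ₗ[ℝ] V3)| = 1 := by
      rw [← abs_mul, hd, abs_one]
    nlinarith [abs_nonneg (LinearMap.det (S : V3 →ₗ[ℝ] V3))]
  have := Measure.map_linearMap_addHaar_eq_smul_addHaar (volume : Measure V3) hne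
  rw [habs] at this
  simpa using this

set_option maxHeartbeats 2000000 in
theorem quad_of_refl (h : SL F) (hS : ∀ l : V3 →L[ℝ] ℝ, l ≠ 0 → ∃ S : V3 →L[ℝ] V3, (∀ x, F (S x) = F x) ∧
    (∀ x, l x = 0 → S x = x) ∧ ∀ x, l (S x) = - l x) : IsQuad F := by
  have := volV3
  set K : Set V3 := {x | F x ≤ 1} with hK
  have hKc : IsCompact K := by
    obtain ⟨c, hc, hl⟩ := h.lower
    refine (isCompact_closedBall (0 : V3) (1 / c)).of_isClosed_subset (isClosed_le h.cont continuous_const) ?_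
    intro x hx
    have hx : F x ≤ 1 := hx
    rw [mem_closedBall_zero_iff, le_div_iff₀' hc]
    exact (hl x).trans hx
  have hintg : ∀ {Y : Type} [NormedAddCommGroup Y] (f : V3 → Y), Continuous f → IntegrableOn f K := fun f hf =>
    hf.continuousOn.integrableOn_compact hKc
  set ι : (V3 →L[ℝ] ℝ) → V3 := fun l => ∫ x in K, l x • x with hι
  have hpair : ∀ l m : V3 →L[ℝ] ℝ, m (ι l) = ∫ x in K, l x * m x := by
    intro l m
    have := m.integral_comp_comm (hintg (fun x => l x • x) (by fun_prop))
    rw [hι, ← this]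
    simp
  have hpos : ∀ l : V3 →L[ℝ] ℝ, l ≠ 0 → 0 < l (ι l) := by
    intro l hl
    rw [hpair]
    rw [setIntegral_pos_iff_support_of_nonneg_ae (Eventually.of_forall fun x => mul_self_nonneg (l x))
      (hintg _ (by fun_prop))]
    have ho : IsOpen ({x | F x < 1} ∩ {x | l x ≠ 0}) :=
      (isOpen_lt h.cont continuous_const).inter (isOpen_ne_fun l.continuous continuous_const)
    have hn : ({x | F x < 1} ∩ {x | l x ≠ 0}).Nonempty :=
      (dense_ne l hl).inter_open_nonempty _ (isOpen_lt h.cont continuous_const) ⟨0, by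
        change F 0 < 1; rw [h.zero]; exact one_pos⟩
    refine (ho.measure_pos volume hn).trans_le (measure_mono ?_)
    rintro x ⟨hx1, hx2⟩
    have hx1 : F x < 1 := hx1
    have hx2 : l x ≠ 0 := hx2
    refine ⟨?_, hx1.le⟩
    simp [hx2]
  set J : V3 →ₗ[ℝ] V3 :=
    { toFun := fun a => ι (fun3L a)
      map_add' := by
        intro a b
        simp only [hι, map_add, add_apply, add_smul]
        exact integral_add (hintg _ (by fun_prop)) (hintg _ (by fun_prop))
      map_smul' := by
        intro c a
        simp only [hι, map_smul, smul_apply, smul_eq_mul, mul_smul, RingHom.id_apply]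
        exact integral_smul _ _ } with hJ
  have hJ' : ∀ a, J a = ι (fun3L a) := fun a => rfl
  have hf3 : ∀ a, fun3L a = 0 → a = 0 := by
    intro a ha
    have h1 := DFunLike.congr_fun ha (1,0,0)
    have h2 := DFunLike.congr_fun ha (0,1,0)
    have h3 := DFunLike.congr_fun ha (0,0,1)
    simp [fun3L] at h1 h2 h3
    ext <;> simp [h1, h2, h3]
  have hJi : Function.Injective J := by
    rw [injective_iff_map_eq_zero]
    intro a ha
    by_contra hne
    have := hpos (fun3L a) (fun h0 => hne (hf3 a h0))
    rw [← hJ', ha, map_zero] at this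
    exact lt_irrefl _ this
  let Je := LinearEquiv.ofInjectiveEndo J hJi
  have hJe : ∀ x, ι (fun3L (Je.symm x)) = x := fun x => Je.apply_symm_apply x
  let B : V3 →ₗ[ℝ] V3 →ₗ[ℝ] ℝ := (ContinuousLinearMap.coeLM ℝ).comp (fun3L.comp (Je.symm : V3 →ₗ[ℝ] V3))
  have hB : ∀ x y, B x y = fun3L (Je.symm x) y := fun x y => rfl
  have hBs : ∀ x y, B x y = B y x := by
    intro x y
    rw [hB, hB]
    conv_lhs => rw [← hJe y]
    conv_rhs => rw [← hJe x]
    rw [hpair, hpair]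
    exact integral_congr_ae (Eventually.of_forall fun z => mul_comm _ _)
  have hBp : ∀ x, x ≠ 0 → 0 < B x x := by
    intro x hx
    rw [hB]
    conv_rhs => rw [← hJe x]
    rw [hJe]
    have := hpos (fun3L (Je.symm x)) (fun h0 => hx (by simpa using hf3 _ h0))
    rwa [hJe] at this
  have hιS : ∀ (l : V3 →L[ℝ] ℝ) (S : V3 →L[ℝ] V3), (∀ x, F (S x) = F x) → (∀ x, l x = 0 → S x = x) →
      (∀ x, l (S x) = - l x) → S (ι l) = - ι l := by
    intro l S h1 h2 h3
    have hinv := refl_invol h2 h3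
    have hmp := invol_mp hinv
    have hemb : MeasurableEmbedding S :=
      (ContinuousLinearEquiv.equivOfInverse S S hinv hinv).toHomeomorph.measurableEmbedding
    have h4 := hmp.setIntegral_preimage_emb hemb (fun x => l x • x) K
    have h5 : S ⁻¹' K = K := by
      ext x
      change F (S x) ≤ 1 ↔ F x ≤ 1
      rw [h1]
    rw [h5] at h4
    simp only [h3, neg_smul] at h4
    rw [integral_neg] at h4
    have h6 := S.integral_comp_comm (hintg (fun x => l x • x) (by fun_prop))
    simp only [map_smul] at h6
    rw [h6] at h4
    change - S (ι l) = ι l at h4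
    exact neg_eq_iff_eq_neg.mp h4
  have hmain : ∀ x y, B x x = B y y → F x = F y := by
    intro x y hxy
    by_cases hne : x = y
    · rw [hne]
    have hne' : x - y ≠ 0 := sub_ne_zero.mpr hne
    set l := fun3L (Je.symm (x - y)) with hl
    have hl0 : l ≠ 0 := fun h0 => hne' (by rw [← hJe (x - y), ← hl, h0]; simp [hι])
    obtain ⟨S, h1, h2, h3⟩ := hS l hl0
    have h4 := hιS l S h1 h2 h3
    rw [hl, hJe] at h4
    have h5 : l (x + y) = 0 := by
      rw [hl, ← hB]
      simp only [map_sub, map_add, LinearMap.sub_apply]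
      rw [hBs y x]; linarith
    have h6 := h2 _ h5
    have h7 : S x = y := by
      have e : x = (1/2 : ℝ) • ((x + y) + (x - y)) := by module
      conv_lhs => rw [e]
      rw [map_smul, map_add S (x + y), h6, h4]
      module
    rw [← h1 x, h7]
  set x0 : V3 := (1, 0, 0) with hx0
  have hx0n : x0 ≠ 0 := by simp [hx0]
  have hb0 := hBp x0 hx0n
  refine ⟨(F x0 ^ 2 / B x0 x0) • B, fun x => ?_⟩
  by_cases hx : x = 0
  · simp [hx, h.zero]
  have hbx := hBp x hx
  set r := √(B x x / B x0 x0) with hr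
  have hr2 : r ^ 2 = B x x / B x0 x0 := Real.sq_sqrt (by positivity)
  have h1 : F x = F (r • x0) := by
    apply hmain
    simp only [map_smul, LinearMap.smul_apply, smul_eq_mul]
    rw [← mul_assoc, ← pow_two, hr2]
    field_simp
  rw [h1, h.smul _ _ (Real.sqrt_nonneg _), mul_pow, hr2]
  simp only [LinearMap.smul_apply, smul_eq_mul]
  field_simp

end refl

section F
variable {E : Type*} [NormedAddCommGroup E] [NormedSpace ℝ E] [FiniteDimensional ℝ E]
  {F : E → ℝ}

theorem thmF (h : SL F) (hE : Module.finrank ℝ E = 4)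
    (hk : ∀ T : V3 →L[ℝ] E, Function.Injective T → ∃ u : E, u ≠ 0 ∧ ∀ x (t : ℝ), F (T x) ≤ F (T x + t • u))
    (T : V3 →L[ℝ] E) (hT : Function.Injective T) : IsQuad (fun x => F (T x)) := by
  refine quad_of_refl (h.comp T hT) fun l hl => ?_
  obtain ⟨S0, hS0⟩ := straighten l hl
  obtain ⟨e, he⟩ := exists_compl hE T
  let q : ((ℝ × ℝ) × ℝ × ℝ) →L[ℝ] V3 :=
    ((ContinuousLinearMap.fst ℝ ℝ ℝ).comp (ContinuousLinearMap.fst ℝ (ℝ × ℝ) (ℝ × ℝ))).prod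
    (((ContinuousLinearMap.snd ℝ ℝ ℝ).comp (ContinuousLinearMap.fst ℝ (ℝ × ℝ) (ℝ × ℝ))).prod
     ((ContinuousLinearMap.fst ℝ ℝ ℝ).comp (ContinuousLinearMap.snd ℝ (ℝ × ℝ) (ℝ × ℝ))))
  have hq : ∀ x y s t, q ((x, y), s, t) = (x, y, s) := fun x y s t => rfl
  let q2 : ((ℝ × ℝ) × ℝ × ℝ) →L[ℝ] ℝ :=
    (ContinuousLinearMap.snd ℝ ℝ ℝ).comp (ContinuousLinearMap.snd ℝ (ℝ × ℝ) (ℝ × ℝ))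
  let Ψ : ((ℝ × ℝ) × ℝ × ℝ) →L[ℝ] E := (T.comp (S0 : V3 →L[ℝ] V3)).comp q + q2.smulRight e
  have hΨ : ∀ x y s t, Ψ ((x, y), s, t) = T (S0 (x, y, s)) + t • e := fun x y s t => rfl
  have hΨi : Function.Injective Ψ := by
    rw [injective_iff_map_eq_zero]
    rintro ⟨⟨x, y⟩, s, t⟩ hx
    rw [hΨ] at hx
    have ht : t = 0 := by
      by_contra hs
      apply he (-t⁻¹ • S0 (x, y, s))
      have : T (S0 (x, y, s)) = - (t • e) := eq_neg_of_add_eq_zero_left hx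
      rw [map_smul, this, smul_neg, neg_smul, neg_neg, smul_smul, inv_mul_cancel₀ hs, one_smul]
    subst ht
    rw [zero_smul, add_zero] at hx
    have h1 : S0 (x, y, s) = 0 := hT (by simpa using hx)
    have h2 : ((x, y, s) : V3) = 0 := by simpa using h1
    simp at h2
    simp [h2]
  have hΨs : Function.Surjective Ψ := by
    have := LinearMap.injective_iff_surjective_of_finrank_eq_finrank (K := ℝ)
      (f := (Ψ : ((ℝ × ℝ) × ℝ × ℝ) →ₗ[ℝ] E)) (by rw [hE]; simp)
    exact this.mp hΨi
  have hG := h.comp Ψ hΨi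
  have hKK : KK (fun x => F (Ψ x)) := by
    intro m hm
    let j : V3 →L[ℝ] ((ℝ × ℝ) × ℝ × ℝ) :=
      ((ContinuousLinearMap.fst ℝ ℝ (ℝ × ℝ)).prod
        ((ContinuousLinearMap.fst ℝ ℝ ℝ).comp (ContinuousLinearMap.snd ℝ ℝ (ℝ × ℝ)))).prod
      (((ContinuousLinearMap.snd ℝ ℝ ℝ).comp (ContinuousLinearMap.snd ℝ ℝ (ℝ × ℝ))).smulRight m)
    have hj : ∀ x y t, j (x, y, t) = ((x, y), t • m) := fun x y t => rfl
    have hji : Function.Injective j := by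
      rw [injective_iff_map_eq_zero]
      rintro ⟨x, y, t⟩ hx
      rw [hj] at hx
      have h1 := congrArg (fun z => z.1.1) hx
      have h2 := congrArg (fun z => z.1.2) hx
      have h3 : t • m = 0 := congrArg Prod.snd hx
      have h4 := (smul_eq_zero.mp h3).resolve_right hm
      simp only [Prod.fst_zero, Prod.snd_zero] at h1 h2
      simp [h1, h2, h4]
    obtain ⟨u, hu0, hu⟩ := hk (Ψ.comp j) (hΨi.comp hji)
    obtain ⟨e', he'⟩ := hΨs u
    refine ⟨e', ?_, fun w t s => ?_⟩
    · intro h0; apply hu0; rw [← he', h0, map_zero]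
    · have := hu (w.1, w.2, t) s
      rw [ContinuousLinearMap.comp_apply, hj, ← he'] at this
      change F (Ψ (w, t • m)) ≤ F (Ψ ((w, t • m) + s • e'))
      rw [map_add Ψ, map_smul Ψ]
      exact this
  obtain ⟨v, hv⟩ := kk_refl hG hKK
  have hv' : ∀ x y t, F (T (S0 (x + t * v.1, y + t * v.2, -t))) = F (T (S0 (x, y, t))) := by
    intro x y t
    have h1 := hv (x, y) t
    have e1 : ((x, y) : ℝ × ℝ) + t • v = (x + t * v.1, y + t * v.2) := rfl
    simp only [e1, hΨ, zero_smul, add_zero] at h1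
    exact h1
  let S1 : V3 →L[ℝ] V3 := ContinuousLinearMap.id ℝ V3 + (fun3 0 0 1).smulRight ((v.1, v.2, -2) : V3)
  have hS1 : ∀ x y t, S1 (x, y, t) = (x + t * v.1, y + t * v.2, -t) := by
    intro x y t
    simp [S1]
    ring
  have hz : ∀ x, l x = (S0.symm x).2.2 := by
    intro x
    rw [← hS0, S0.apply_symm_apply]
  refine ⟨(S0 : V3 →L[ℝ] V3).comp (S1.comp (S0.symm : V3 →L[ℝ] V3)), fun x => ?_, fun x hx => ?_, fun x => ?_⟩
  · change F (T (S0 (S1 (S0.symm x)))) = F (T x)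
    rcases hy : S0.symm x with ⟨a, b, c⟩
    rw [hS1, hv', ← hy, S0.apply_symm_apply]
  · change S0 (S1 (S0.symm x)) = x
    rw [hz] at hx
    rcases hy : S0.symm x with ⟨a, b, c⟩
    rw [hy] at hx
    simp only at hx
    rw [hS1, hx]
    simp only [zero_mul, add_zero, neg_zero]
    rw [hx] at hy
    rw [← hy, S0.apply_symm_apply]
  · change l (S0 (S1 (S0.symm x))) = - l x
    rw [hS0, hz]
    rcases hy : S0.symm x with ⟨a, b, c⟩
    rw [hS1]

/-- all sections quadratic -/
theorem all_quad (h : Ban F) (hE : Module.finrank ℝ E = 4) (T : V3 →L[ℝ] E) (hT : Function.Injective T) :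
    IsQuad (fun x => F (T x)) := by
  rcases thmC h hE with ⟨T0, hT0, B, hB⟩ | hk
  · obtain ⟨g, hg⟩ := h.eqv T T0 hT hT0
    refine ⟨B.compl₁₂ (g : V3 →ₗ[ℝ] V3) (g : V3 →ₗ[ℝ] V3), fun x => ?_⟩
    change F (T x) ^ 2 = B (g x) (g x)
    rw [← hg, ← hB (g x)]
  · exact thmF h.sl hE hk T hT

end F


section quadB
variable {E : Type*} [NormedAddCommGroup E] [NormedSpace ℝ E] [FiniteDimensional ℝ E]

theorem exists_inj_of_sub (W : Submodule ℝ E) (hW : Module.finrank ℝ W = 3) :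
    ∃ T : V3 →L[ℝ] E, Function.Injective T ∧ LinearMap.range (T : V3 →ₗ[ℝ] E) = W := by
  have h3 : Module.finrank ℝ V3 = Module.finrank ℝ W := by
    rw [hW]; simp [V3]
  let e : V3 ≃ₗ[ℝ] W := LinearEquiv.ofFinrankEq V3 W h3
  refine ⟨LinearMap.toContinuousLinearMap (W.subtype ∘ₗ (e : V3 →ₗ[ℝ] W)), ?_, ?_⟩
  · intro x y hxy
    have : W.subtype (e x) = W.subtype (e y) := hxy
    exact e.injective (W.injective_subtype this)
  · ext x
    constructor
    · rintro ⟨y, rfl⟩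
      exact (e y).2
    · intro hx
      refine ⟨e.symm ⟨x, hx⟩, ?_⟩
      change ((e (e.symm ⟨x, hx⟩) : W) : E) = x
      rw [e.apply_symm_apply]

theorem exists_inj3 (hE : Module.finrank ℝ E = 4) (x y z : E) :
    ∃ T : V3 →L[ℝ] E, Function.Injective T ∧ (∃ a, T a = x) ∧ (∃ b, T b = y) ∧ ∃ c, T c = z := by
  have h1 : Module.finrank ℝ (Submodule.span ℝ ({x, y, z} : Set E)) ≤ 3 := by
    classical
    have := finrank_span_finset_le_card (R := ℝ) ({x, y, z} : Finset E)
    have h2 := this.trans Finset.card_le_three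
    have h3 : ((({x, y, z} : Finset E)) : Set E) = {x, y, z} := by push_cast; rfl
    rw [Set.finrank, h3] at h2
    exact h2
  obtain ⟨W, hW1, hW2⟩ : ∃ W : Submodule ℝ E, Submodule.span ℝ ({x, y, z} : Set E) ≤ W ∧
      Module.finrank ℝ W = 3 := by
    have hlt : Submodule.span ℝ ({x, y, z} : Set E) < ⊤ := by
      rw [lt_top_iff_ne_top]
      intro h
      rw [h, finrank_top, hE] at h1
      omega
    obtain ⟨f, hf, hle⟩ := Submodule.exists_le_ker_of_lt_top _ hlt
    refine ⟨LinearMap.ker f, hle, ?_⟩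
    have := Module.Dual.finrank_ker_add_one_of_ne_zero hf
    omega
  obtain ⟨T, hT, hr⟩ := exists_inj_of_sub W hW2
  have hm : ∀ v ∈ ({x, y, z} : Set E), ∃ a, T a = v := by
    intro v hv
    have : v ∈ LinearMap.range (T : V3 →ₗ[ℝ] E) := by
      rw [hr]; exact hW1 (Submodule.subset_span hv)
    exact this
  exact ⟨T, hT, hm x (by simp), hm y (by simp), hm z (by simp)⟩

theorem quad_global {F : E → ℝ} (h : Ban F) (hE : Module.finrank ℝ E = 4) :
    ∃ f : E →ₗ[ℝ] E →ₗ[ℝ] ℝ, (∀ x y, f x y = f y x) ∧ (∀ x, f x x = F x ^ 2) := by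
  have key : ∀ x y z : E, ∃ T : V3 →L[ℝ] E, ∃ B : V3 →ₗ[ℝ] V3 →ₗ[ℝ] ℝ,
      (∀ v, F (T v) ^ 2 = B v v) ∧ (∃ a, T a = x) ∧ (∃ b, T b = y) ∧ ∃ c, T c = z := by
    intro x y z
    obtain ⟨T, hT, h1⟩ := exists_inj3 hE x y z
    obtain ⟨B, hB⟩ := all_quad h hE T hT
    exact ⟨T, B, hB, h1⟩
  let f : E → E → ℝ := fun x y => (F (x + y) ^ 2 - F (x - y) ^ 2) / 4
  have hneg : ∀ x, F (-x) ^ 2 = F x ^ 2 := by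
    intro x
    obtain ⟨T, B, hB, ⟨a, rfl⟩, -⟩ := key x 0 0
    rw [← map_neg, hB, hB]; simp
  have hsym : ∀ x y, f x y = f y x := by
    intro x y
    change (_ - _) / 4 = (_ - _) / 4
    rw [add_comm x y, ← neg_sub y x, hneg]
  have hadd : ∀ x y z, f (x + y) z = f x z + f y z := by
    intro x y z
    obtain ⟨T, B, hB, ⟨a, rfl⟩, ⟨b, rfl⟩, ⟨c, rfl⟩⟩ := key x y z
    change (_ - _) / 4 = (_ - _) / 4 + (_ - _) / 4
    simp only [← map_add, ← map_sub, hB]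
    simp only [map_add, map_sub, LinearMap.add_apply, LinearMap.sub_apply]
    ring
  have hsm : ∀ (t : ℝ) x z, f (t • x) z = t * f x z := by
    intro t x z
    obtain ⟨T, B, hB, ⟨a, rfl⟩, ⟨c, rfl⟩, -⟩ := key x z 0
    change (_ - _) / 4 = t * ((_ - _) / 4)
    simp only [← map_smul, ← map_add, ← map_sub, hB]
    simp only [map_add, map_sub, LinearMap.add_apply, LinearMap.sub_apply, map_smul,
      LinearMap.smul_apply, smul_eq_mul]
    ring
  refine ⟨LinearMap.mk₂ ℝ f hadd hsm ?_ ?_, ?_, ?_⟩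
  · intro x y z
    rw [hsym, hadd, hsym y, hsym z]
  · intro t x y
    rw [hsym, hsm, hsym y]; rfl
  · intro x y
    exact hsym x y
  · intro x
    change (F (x + x) ^ 2 - F (x - x) ^ 2) / 4 = _
    rw [sub_self, h.sl.zero, ← two_smul ℝ x, h.sl.smul 2 x (by norm_num)]
    ring
end quadB


section originA
variable {E : Type*} [NormedAddCommGroup E] [NormedSpace ℝ E] [FiniteDimensional ℝ E]

theorem fun_ker_le {V : Type*} [NormedAddCommGroup V] [NormedSpace ℝ V] {f g : V →L[ℝ] ℝ} (hf : f ≠ 0)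
    (h : ∀ x, f x = 0 → g x = 0) : ∃ c : ℝ, g = c • f := by
  obtain ⟨z, hz⟩ : ∃ z, f z ≠ 0 := by
    by_contra hc
    push Not at hc
    exact hf (ContinuousLinearMap.ext hc)
  refine ⟨g z / f z, ContinuousLinearMap.ext fun x => ?_⟩
  have h1 := h (x - (f x / f z) • z) (by simp [hz])
  rw [map_sub, map_smul, smul_eq_mul] at h1
  rw [smul_apply, smul_eq_mul]
  field_simp at h1 ⊢
  linarith

theorem exists_inj_ker (hE : Module.finrank ℝ E = 4) {u : E →L[ℝ] ℝ} (hu : u ≠ 0) :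
    ∃ T : V3 →L[ℝ] E, Function.Injective T ∧ ∀ x, u x = 0 ↔ ∃ y, T y = x := by
  have hu' : (u : E →ₗ[ℝ] ℝ) ≠ 0 := by
    intro h; apply hu
    ext x; exact LinearMap.congr_fun h x
  have := Module.Dual.finrank_ker_add_one_of_ne_zero hu'
  obtain ⟨T, hT, hr⟩ := exists_inj_of_sub (LinearMap.ker (u : E →ₗ[ℝ] ℝ)) (by omega)
  refine ⟨T, hT, fun x => ?_⟩
  have : x ∈ LinearMap.ker (u : E →ₗ[ℝ] ℝ) ↔ x ∈ LinearMap.range (T : V3 →ₗ[ℝ] E) := by rw [hr]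
  exact this

structure Hy (B : Set E) : Prop where
  hE : Module.finrank ℝ E = 4
  hc : IsCompact B
  hv : Convex ℝ B
  hi : (interior B).Nonempty
  heq : ∀ T T' : V3 →L[ℝ] E, Function.Injective T → Function.Injective T' →
    ∃ g : V3 ≃L[ℝ] V3, ∀ x, T x ∈ B ↔ T' (g x) ∈ B
  hsp : ∀ T : V3 →L[ℝ] E, Function.Injective T → Submodule.span ℝ {x | T x ∈ B} = ⊤

theorem Hy.van {B : Set E} (h : Hy B) {T : V3 →L[ℝ] E} (hT : Function.Injective T) {Y : Type*}
    [NormedAddCommGroup Y] [NormedSpace ℝ Y] {f : V3 →L[ℝ] Y}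
    (hf : ∀ x, T x ∈ B → f x = 0) : f = 0 := by
  have h1 : Submodule.span ℝ {x | T x ∈ B} ≤ LinearMap.ker (f : V3 →ₗ[ℝ] Y) := by
    rw [Submodule.span_le]
    intro x hx
    exact hf x hx
  rw [h.hsp T hT] at h1
  refine ContinuousLinearMap.ext fun x => ?_
  exact h1 (Submodule.mem_top (x := x))

theorem Hy.zero_mem {B : Set E} (h : Hy B) : (0 : E) ∈ B := by
  by_contra h0
  obtain ⟨f, s, hs1, hs2⟩ := geometric_hahn_banach_point_closed h.hv h.hc.isClosed h0
  rw [map_zero] at hs1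
  obtain ⟨b, hb⟩ := h.hi
  have hf : f ≠ 0 := by
    rintro rfl
    have := hs2 b (interior_subset hb)
    simp at this
    linarith
  obtain ⟨T, hT, hk⟩ := exists_inj_ker h.hE hf
  have h1 : ContinuousLinearMap.id ℝ V3 = 0 := by
    refine h.van hT fun x hx => ?_
    have h2 := (hk (T x)).mpr ⟨x, rfl⟩
    have := hs2 _ hx
    linarith
  have := DFunLike.congr_fun h1 ((1, 0, 0) : V3)
  simp at this

theorem Hy.uniq {B : Set E} (h : Hy B) {u : E →L[ℝ] ℝ} (hu : u ≠ 0) (hu0 : ∀ x ∈ B, 0 ≤ u x)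
    {v : E →L[ℝ] ℝ} (hv0 : ∀ x ∈ B, 0 ≤ v x) : ∃ c : ℝ, v = c • u := by
  by_cases hw : u + v = 0
  · exact ⟨(-1 : ℝ), by rw [neg_one_smul ℝ u]; exact (neg_eq_of_add_eq_zero_right hw).symm⟩
  obtain ⟨T, hT, hk⟩ := exists_inj_ker h.hE hw
  have h1 : u.comp T = 0 := by
    refine h.van hT fun x hx => ?_
    have h2 := (hk (T x)).mpr ⟨x, rfl⟩
    rw [add_apply] at h2
    have h3 := hu0 _ hx
    have h4 := hv0 _ hx
    change u (T x) = 0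
    linarith
  obtain ⟨c, hc⟩ := fun_ker_le (g := u) hw (fun x hx => by
    obtain ⟨y, rfl⟩ := (hk x).mp hx
    exact DFunLike.congr_fun h1 y)
  have hc0 : c ≠ 0 := by
    rintro rfl
    rw [zero_smul] at hc
    exact hu hc
  refine ⟨(1 - c) / c, ContinuousLinearMap.ext fun x => ?_⟩
  have h5 := DFunLike.congr_fun hc x
  rw [smul_apply, add_apply, smul_eq_mul] at h5
  rw [smul_apply, smul_eq_mul]
  field_simp
  linarith

/-- uniqueness of supporting functionals for sections transversal to the kernel. -/
theorem Hy.uniqT {B : Set E} (h : Hy B) {u : E →L[ℝ] ℝ} (hu : u ≠ 0) (hu0 : ∀ x ∈ B, 0 ≤ u x)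
    {T : V3 →L[ℝ] E} (hT : Function.Injective T) (huT : u.comp T ≠ 0) {ν : V3 →L[ℝ] ℝ}
    (hν : ∀ x, T x ∈ B → 0 ≤ ν x) : ∃ c : ℝ, ν = c • u.comp T := by
  by_cases hν0 : ν = 0
  · exact ⟨0, by simp [hν0]⟩
  obtain ⟨z, hz⟩ : ∃ z, ν z < 0 := by
    obtain ⟨z, hz⟩ : ∃ z, ν z ≠ 0 := by
      by_contra hc
      push Not at hc
      exact hν0 (ContinuousLinearMap.ext hc)
    rcases lt_or_gt_of_ne hz with h1 | h1
    · exact ⟨z, h1⟩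
    · exact ⟨-z, by rw [map_neg]; linarith⟩
  have hNc : Convex ℝ (T '' {y | ν y < 0}) := by
    have h1 : Convex ℝ {y | ν y < 0} := convex_halfSpace_lt (ν : V3 →ₗ[ℝ] ℝ).isLinear 0
    exact h1.linear_image (T : V3 →ₗ[ℝ] E)
  have hdis : Disjoint (interior B) (T '' {y | ν y < 0}) := by
    rw [Set.disjoint_left]
    rintro _ hx ⟨y, hy, rfl⟩
    have h1 := hν y (interior_subset hx)
    have h2 : ν y < 0 := hy
    linarith
  obtain ⟨f, s, hs1, hs2⟩ := geometric_hahn_banach_open h.hv.interior isOpen_interior hNc hdis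
  have hcl : ∀ x ∈ B, f x ≤ s := by
    intro x hx
    have h1 : x ∈ closure (interior B) := by
      rw [h.hv.closure_interior_eq_closure_of_nonempty_interior h.hi]
      exact subset_closure hx
    have h2 : closure (interior B) ⊆ {x | f x ≤ s} :=
      closure_minimal (fun y hy => (hs1 y hy).le) (isClosed_le f.continuous continuous_const)
    exact h2 h1
  have hs0 : 0 ≤ s := by simpa using hcl 0 h.zero_mem
  have hsc : ∀ y, ν y < 0 → ∀ t > 0, s ≤ t * f (T y) := by
    intro y hy t ht
    have := hs2 (T (t • y)) ⟨t • y, by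
      change ν (t • y) < 0
      rw [map_smul, smul_eq_mul]
      exact mul_neg_of_pos_of_neg ht hy, rfl⟩
    rwa [map_smul, map_smul, smul_eq_mul] at this
  have hs : s ≤ 0 := by
    by_contra hc
    push Not at hc
    have h1 := hsc z hz 1 one_pos
    have h2 : 0 < f (T z) := by linarith
    have h3 := hsc z hz (s / 2 / f (T z)) (by positivity)
    rw [div_mul_cancel₀ _ h2.ne'] at h3
    linarith
  obtain ⟨c, hc⟩ := h.uniq hu hu0 (v := -f) (fun x hx => by
    have := hcl x hx
    simp; linarith)
  have hc0 : c ≠ 0 := by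
    rintro rfl
    rw [zero_smul, neg_eq_zero] at hc
    obtain ⟨b, hb⟩ := h.hi
    have := hs1 b hb
    rw [hc] at this
    simp at this
    linarith
  have hf : ∀ x, f x = - (c * u x) := by
    intro x
    have := DFunLike.congr_fun hc x
    simp at this
    linarith
  have hN : ∀ y, ν y < 0 → 0 ≤ f (T y) := fun y hy => by
    have := hsc y hy 1 one_pos
    linarith
  obtain ⟨d, hd⟩ := fun_ker_le (g := u.comp T) hν0 (fun y hy => by
    change u (T y) = 0
    by_contra hne
    have hne' : f (T y) ≠ 0 := by
      rw [hf]
      exact neg_ne_zero.mpr (mul_ne_zero hc0 hne)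
    have h1 := hN (z + (-(f (T z) + 1) / f (T y)) • y) (by
      rw [map_add, map_smul, hy, smul_zero, add_zero]; exact hz)
    rw [map_add, map_add, map_smul, map_smul, smul_eq_mul, div_mul_cancel₀ _ hne'] at h1
    linarith)
  have hd0 : d ≠ 0 := by
    rintro rfl
    rw [zero_smul] at hd
    exact huT hd
  refine ⟨d⁻¹, ?_⟩
  rw [hd, smul_smul, inv_mul_cancel₀ hd0, one_smul]

theorem exists_indep (μ : V3 →L[ℝ] ℝ) : ∃ ρ : V3 →L[ℝ] ℝ, ∀ c : ℝ, ρ ≠ c • μ := by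
  by_contra hc
  push Not at hc
  obtain ⟨a, ha⟩ := hc (ContinuousLinearMap.fst ℝ ℝ (ℝ × ℝ))
  obtain ⟨b, hb⟩ := hc ((ContinuousLinearMap.fst ℝ ℝ ℝ).comp (ContinuousLinearMap.snd ℝ ℝ (ℝ × ℝ)))
  have h1 := DFunLike.congr_fun ha ((1, 0, 0) : V3)
  have h2 := DFunLike.congr_fun ha ((0, 1, 0) : V3)
  have h3 := DFunLike.congr_fun hb ((0, 1, 0) : V3)
  rw [smul_apply, smul_eq_mul] at h1 h2 h3
  change (1 : ℝ) = _ at h1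
  change (0 : ℝ) = _ at h2
  change (1 : ℝ) = _ at h3
  rcases mul_eq_zero.mp h2.symm with h | h
  · rw [h] at h1; simp at h1
  · rw [h] at h3; simp at h3
end originA


section originB
variable {E : Type*} [NormedAddCommGroup E] [NormedSpace ℝ E] [FiniteDimensional ℝ E]

theorem Hy.zero_int {B : Set E} (h : Hy B) : (0 : E) ∈ interior B := by
  by_contra h0
  have : ProperSpace E := FiniteDimensional.proper ℝ E
  obtain ⟨f, hf⟩ := geometric_hahn_banach_open_point h.hv.interior isOpen_interior h0
  rw [map_zero] at hf
  obtain ⟨b, hb⟩ := h.hi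
  have hbB := interior_subset hb
  let u : E →L[ℝ] ℝ := -f
  have hub : 0 < u b := by
    have := hf b hb
    change 0 < - f b
    linarith
  have hu : u ≠ 0 := by
    intro hc
    rw [hc] at hub
    simp at hub
  have hu0 : ∀ x ∈ B, 0 ≤ u x := by
    intro x hx
    have h1 : x ∈ closure (interior B) := by
      rw [h.hv.closure_interior_eq_closure_of_nonempty_interior h.hi]
      exact subset_closure hx
    have h2 : closure (interior B) ⊆ {x | f x ≤ 0} :=
      closure_minimal (fun y hy => (hf y hy).le) (isClosed_le f.continuous continuous_const)
    have h3 : f x ≤ 0 := h2 h1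
    change 0 ≤ - f x
    linarith
  obtain ⟨T0, hT0, hk⟩ := exists_inj_ker h.hE hu
  have huT0 : ∀ x, u (T0 x) = 0 := fun x => (hk _).mpr ⟨x, rfl⟩
  -- the supporting functional of the section by the kernel
  obtain ⟨μ, hμ0, hμ, hμu⟩ : ∃ μ : V3 →L[ℝ] ℝ, μ ≠ 0 ∧ (∀ x, T0 x ∈ B → 0 ≤ μ x) ∧
      ∀ ν : V3 →L[ℝ] ℝ, (∀ x, T0 x ∈ B → 0 ≤ ν x) → ∃ c : ℝ, ν = c • μ := by
    obtain ⟨T, hT, ⟨a, ha⟩, -⟩ := exists_inj3 h.hE b 0 0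
    obtain ⟨g, hg⟩ := h.heq T0 T hT0 hT
    have huT : u.comp T ≠ 0 := by
      intro hc
      have h1 : u (T a) = 0 := DFunLike.congr_fun hc a
      rw [ha] at h1
      linarith
    refine ⟨(u.comp T).comp (g : V3 →L[ℝ] V3), ?_, ?_, ?_⟩
    · intro hc
      apply huT
      refine ContinuousLinearMap.ext fun x => ?_
      have h1 : u (T (g (g.symm x))) = 0 := DFunLike.congr_fun hc (g.symm x)
      rw [g.apply_symm_apply] at h1
      exact h1
    · intro x hx
      exact hu0 _ ((hg x).mp hx)
    · intro ν hν
      obtain ⟨c, hc⟩ := h.uniqT hu hu0 hT huT (ν := ν.comp (g.symm : V3 →L[ℝ] V3)) (fun x hx => by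
        apply hν
        rw [hg]
        change T (g (g.symm x)) ∈ B
        rw [g.apply_symm_apply]; exact hx)
      refine ⟨c, ContinuousLinearMap.ext fun x => ?_⟩
      have h1 : ν (g.symm (g x)) = c • u (T (g x)) := DFunLike.congr_fun hc (g x)
      rw [g.symm_apply_apply] at h1
      exact h1
  obtain ⟨ρ, hρ⟩ := exists_indep μ
  let ε : ℕ → ℝ := fun n => 1 / ((n : ℝ) + 1)
  have hε : ∀ n, 0 < ε n := fun n => by positivity
  have hε0 : Tendsto ε atTop (𝓝 0) := tendsto_one_div_add_atTop_nhds_zero_nat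
  let T : ℕ → V3 →L[ℝ] E := fun n => T0 + ε n • ρ.smulRight b
  have hTa : ∀ n x, T n x = T0 x + (ε n * ρ x) • b := by
    intro n x
    change T0 x + ε n • (ρ x • b) = _
    rw [smul_smul]
  have huT : ∀ n x, u (T n x) = ε n * ρ x * u b := by
    intro n x
    rw [hTa, map_add, huT0, zero_add, map_smul, smul_eq_mul]
  have hTi : ∀ n, Function.Injective (T n) := by
    intro n
    rw [injective_iff_map_eq_zero]
    intro x hx
    have h1 := huT n x
    rw [hx, map_zero] at h1
    have h2 : ε n * ρ x = 0 := by
      rcases mul_eq_zero.mp h1.symm with h3 | h3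
      · exact h3
      · linarith
    rw [hTa, h2, zero_smul, add_zero] at hx
    exact (injective_iff_map_eq_zero T0).mp hT0 x hx
  choose g hg using fun n => h.heq T0 (T n) hT0 (hTi n)
  -- uniform bounds
  obtain ⟨κ, hκ, hanti⟩ : ∃ κ : NNReal, 0 < κ ∧ AntilipschitzWith κ T0 :=
    (T0 : V3 →ₗ[ℝ] E).exists_antilipschitzWith (LinearMap.ker_eq_bot.mpr hT0)
  have hlow : ∀ x, ‖x‖ ≤ κ * ‖T0 x‖ := by
    intro x
    have := hanti.le_mul_dist x 0
    simpa using this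
  obtain ⟨R, hR⟩ : ∃ R, ∀ x ∈ B, ‖x - (u x / u b) • b‖ ≤ R := by
    have h1 : Continuous fun x : E => ‖x - (u x / u b) • b‖ := by fun_prop
    obtain ⟨R, hR⟩ := h.hc.bddAbove_image h1.continuousOn
    exact ⟨R, fun x hx => hR ⟨x, hx, rfl⟩⟩
  have hbd : ∀ n y, T n y ∈ B → ‖y‖ ≤ κ * R := by
    intro n y hy
    have h1 := hR _ hy
    have h2 : T n y - (u (T n y) / u b) • b = T0 y := by
      rw [huT, hTa, mul_div_assoc, div_self hub.ne', mul_one]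
      abel
    rw [h2] at h1
    exact (hlow y).trans (mul_le_mul_of_nonneg_left h1 κ.2)
  have hgb : ∃ M, ∀ n, ‖(g n : V3 →L[ℝ] V3)‖ ≤ M := by
    apply banach_steinhaus
    intro x
    have hx : x ∈ Submodule.span ℝ {x | T0 x ∈ B} := by rw [h.hsp T0 hT0]; trivial
    induction hx using Submodule.span_induction with
    | mem x hx => exact ⟨κ * R, fun n => hbd n _ ((hg n x).mp hx)⟩
    | zero => exact ⟨0, fun n => by simp⟩
    | add x y _ _ hx hy =>
      obtain ⟨C, hC⟩ := hx
      obtain ⟨D, hD⟩ := hy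
      refine ⟨C + D, fun n => ?_⟩
      rw [map_add]
      exact (norm_add_le _ _).trans (add_le_add (hC n) (hD n))
    | smul a x _ hx =>
      obtain ⟨C, hC⟩ := hx
      refine ⟨‖a‖ * C, fun n => ?_⟩
      rw [map_smul, norm_smul]
      exact mul_le_mul_of_nonneg_left (hC n) (norm_nonneg _)
  obtain ⟨M, hM⟩ := hgb
  have : ProperSpace (V3 →L[ℝ] V3) := FiniteDimensional.proper ℝ _
  obtain ⟨g0, -, φ, hφ, hlim⟩ := (isCompact_closedBall (0 : V3 →L[ℝ] V3) M).tendsto_subseq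
    (x := fun n => (g n : V3 →L[ℝ] V3)) (fun n => by simpa using hM n)
  have happ : ∀ (x : V3) (y : ℕ → V3), Tendsto y atTop (𝓝 x) →
      Tendsto (fun n => g (φ n) (y n)) atTop (𝓝 (g0 x)) := by
    intro x y hy
    have hc : Continuous fun p : (V3 →L[ℝ] V3) × V3 => p.1 p.2 := by fun_prop
    exact (hc.tendsto (g0, x)).comp (hlim.prodMk_nhds hy)
  have hTapp : ∀ (x : V3) (y : ℕ → V3), Tendsto y atTop (𝓝 x) →
      Tendsto (fun n => T (φ n) (y n)) atTop (𝓝 (T0 x)) := by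
    intro x y hy
    have h1 : Tendsto (fun n => T0 (y n) + (ε (φ n) * ρ (y n)) • b) atTop
        (𝓝 (T0 x + (0 * ρ x) • b)) := by
      refine ((T0.continuous.tendsto x).comp hy).add (Tendsto.smul_const ?_ b)
      exact (hε0.comp hφ.tendsto_atTop).mul ((ρ.continuous.tendsto x).comp hy)
    simp only [zero_mul, zero_smul, add_zero] at h1
    refine h1.congr fun n => ?_
    rw [hTa]
  have hg0K : ∀ x, T0 x ∈ B → T0 (g0 x) ∈ B := by
    intro x hx
    have h1 := hTapp _ _ (happ x (fun _ => x) tendsto_const_nhds)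
    exact h.hc.isClosed.mem_of_tendsto h1 (Eventually.of_forall fun n => (hg (φ n) x).mp hx)
  have hρg : ∀ x, T0 x ∈ B → 0 ≤ ρ (g0 x) := by
    intro x hx
    have h1 := (ρ.continuous.tendsto _).comp (happ x (fun _ => x) tendsto_const_nhds)
    refine ge_of_tendsto h1 (Eventually.of_forall fun n => ?_)
    have h2 := hu0 _ ((hg (φ n) x).mp hx)
    rw [huT] at h2
    have h3 : 0 ≤ ε (φ n) * ρ (g (φ n) x) := nonneg_of_mul_nonneg_left h2 hub
    exact nonneg_of_mul_nonneg_right h3 (hε _)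
  -- a point of the section where `ρ` is positive
  obtain ⟨k0, hk0, hk0ρ⟩ : ∃ k, T0 k ∈ B ∧ 0 < ρ k := by
    by_contra hc
    push Not at hc
    obtain ⟨c, hc'⟩ := hμu (-ρ) (fun x hx => by
      have := hc x hx
      change 0 ≤ - ρ x
      linarith)
    apply hρ (-c)
    refine ContinuousLinearMap.ext fun x => ?_
    have h1 : - ρ x = c * μ x := DFunLike.congr_fun hc' x
    rw [smul_apply, smul_eq_mul]
    linarith
  have hKc : IsCompact {x | T0 x ∈ B} := by
    have := (T0 : V3 →ₗ[ℝ] E).isClosedEmbedding_of_injective (LinearMap.ker_eq_bot.mpr hT0)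
    exact this.isCompact_preimage h.hc
  have hsur1 : ∀ x, T0 x ∈ B → 0 ≤ ρ x → x ∈ LinearMap.range (g0 : V3 →ₗ[ℝ] V3) := by
    intro x hx hρx
    let z : ℕ → V3 := fun n => (1 / (1 + ε (φ n) * ρ x)) • x
    have hz : Tendsto z atTop (𝓝 x) := by
      have h1 : Tendsto (fun n => (1 / (1 + ε (φ n) * ρ x)) • x) atTop
          (𝓝 ((1 / (1 + 0 * ρ x)) • x)) := by
        refine Tendsto.smul_const (Tendsto.div tendsto_const_nhds ?_ (by simp)) x
        exact tendsto_const_nhds.add ((hε0.comp hφ.tendsto_atTop).mul_const _)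
      simp only [zero_mul, add_zero, div_one, one_smul] at h1
      exact h1
    have hzB : ∀ n, T (φ n) (z n) ∈ B := by
      intro n
      have hp : 0 ≤ ε (φ n) * ρ x := mul_nonneg (hε _).le hρx
      have hp1 : 0 < 1 + ε (φ n) * ρ x := by linarith
      have h1 := h.hv hx hbB (a := 1 / (1 + ε (φ n) * ρ x))
        (b := ε (φ n) * ρ x / (1 + ε (φ n) * ρ x)) (by positivity) (by positivity) (by field_simp)
      have h2 : T (φ n) (z n) = (1 / (1 + ε (φ n) * ρ x)) • T0 x +
          (ε (φ n) * ρ x / (1 + ε (φ n) * ρ x)) • b := by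
        rw [hTa]
        change T0 (_ • x) + (_ * ρ (_ • x)) • b = _
        rw [map_smul, map_smul, smul_eq_mul]
        congr 2
        ring
      rw [h2]; exact h1
    let y : ℕ → V3 := fun n => (g (φ n)).symm (z n)
    have hy : ∀ n, y n ∈ {x | T0 x ∈ B} := by
      intro n
      change T0 ((g (φ n)).symm (z n)) ∈ B
      rw [hg (φ n), (g (φ n)).apply_symm_apply]
      exact hzB n
    obtain ⟨y0, -, ψ, hψ, hy0⟩ := hKc.tendsto_subseq hy
    have h3 : Tendsto (fun n => g (φ (ψ n)) (y (ψ n))) atTop (𝓝 (g0 y0)) := by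
      have hc : Continuous fun p : (V3 →L[ℝ] V3) × V3 => p.1 p.2 := by fun_prop
      exact (hc.tendsto (g0, y0)).comp ((hlim.comp hψ.tendsto_atTop).prodMk_nhds hy0)
    have h4 : Tendsto (fun n => g (φ (ψ n)) (y (ψ n))) atTop (𝓝 x) := by
      refine (hz.comp hψ.tendsto_atTop).congr fun n => ?_
      exact ((g (φ (ψ n))).apply_symm_apply _).symm
    exact ⟨y0, tendsto_nhds_unique h3 h4⟩
  have hsur : Function.Surjective g0 := by
    have h1 : LinearMap.range (g0 : V3 →ₗ[ℝ] V3) = ⊤ := by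
      rw [eq_top_iff, ← h.hsp T0 hT0, Submodule.span_le]
      intro x hx
      have hxB : T0 x ∈ B := hx
      -- choose a point of the segment close to `k0`
      obtain ⟨t, ht0, ht1, htρ⟩ : ∃ t : ℝ, 0 < t ∧ t < 1 ∧ 0 ≤ (1 - t) * ρ k0 + t * ρ x := by
        have hD : 0 < ρ k0 + |ρ x| + ρ k0 := by positivity
        refine ⟨ρ k0 / (ρ k0 + |ρ x| + ρ k0), by positivity, ?_, ?_⟩
        · rw [div_lt_one hD]
          have := abs_nonneg (ρ x)
          linarith
        · have h5 : (1 - ρ k0 / (ρ k0 + |ρ x| + ρ k0)) * ρ k0 +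
            ρ k0 / (ρ k0 + |ρ x| + ρ k0) * ρ x =
            (ρ k0 * (ρ k0 + (|ρ x| + ρ x))) / (ρ k0 + |ρ x| + ρ k0) := by
            field_simp
            ring
          rw [h5]
          have := neg_abs_le (ρ x)
          have h6 : 0 ≤ |ρ x| + ρ x := by linarith
          positivity
      have h2 : T0 ((1 - t) • k0 + t • x) ∈ B := by
        rw [map_add, map_smul, map_smul]
        exact h.hv hk0 hxB (by linarith) ht0.le (by ring)
      have h3 := hsur1 _ h2 (by
        rw [map_add, map_smul, map_smul]; exact htρ)
      have h4 := hsur1 _ hk0 hk0ρ.le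
      have h5 : x = t⁻¹ • (((1 - t) • k0 + t • x) - (1 - t) • k0) := by
        rw [add_sub_cancel_left, smul_smul, inv_mul_cancel₀ ht0.ne', one_smul]
      rw [h5]
      exact Submodule.smul_mem _ _ (Submodule.sub_mem _ h3 (Submodule.smul_mem _ _ h4))
    exact LinearMap.range_eq_top.mp h1
  obtain ⟨a, ha⟩ := hμu (ρ.comp g0) hρg
  obtain ⟨c, hc⟩ := hμu (μ.comp g0) (fun x hx => hμ _ (hg0K x hx))
  have hc0 : c ≠ 0 := by
    rintro rfl
    apply hμ0
    refine ContinuousLinearMap.ext fun x => ?_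
    obtain ⟨y, rfl⟩ := hsur x
    have : μ (g0 y) = (0 : ℝ) • μ y := DFunLike.congr_fun hc y
    rw [this, zero_smul]; rfl
  apply hρ (a / c)
  refine ContinuousLinearMap.ext fun x => ?_
  obtain ⟨y, rfl⟩ := hsur x
  have h1 : μ (g0 y) = c * μ y := DFunLike.congr_fun hc y
  have h2 : ρ (g0 y) = a * μ y := DFunLike.congr_fun ha y
  rw [smul_apply, smul_eq_mul, h1, h2]
  field_simp
end originB

section assemble
variable {E : Type*} [NormedAddCommGroup E] [NormedSpace ℝ E] [FiniteDimensional ℝ E]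

theorem sec_span {B : Set E} (hE : Module.finrank ℝ E = 4) (hBint : (interior B).Nonempty)
    (hsec : ∀ X Y : Submodule ℝ E, Module.finrank ℝ X = 3 → Module.finrank ℝ Y = 3 →
      LinearlyEquivalent (B ∩ (X : Set E)) (B ∩ (Y : Set E)))
    (Y : Submodule ℝ E) (hY : Module.finrank ℝ Y = 3) : Submodule.span ℝ (B ∩ (Y : Set E)) = Y := by
  obtain ⟨b, hb⟩ := hBint
  obtain ⟨T, hT, ⟨a, ha⟩, -⟩ := exists_inj3 hE b 0 0
  let X := LinearMap.range (T : V3 →ₗ[ℝ] E)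
  have hX : Module.finrank ℝ X = 3 := by
    have h1 := LinearMap.finrank_range_of_inj (f := (T : V3 →ₗ[ℝ] E)) hT
    rw [h1]; simp [V3]
  have hbX : b ∈ X := ⟨a, ha⟩
  have hXs : Submodule.span ℝ (B ∩ (X : Set E)) = X := by
    apply le_antisymm
    · rw [Submodule.span_le]; exact Set.inter_subset_right
    · intro v hv
      have hc : Tendsto (fun t : ℝ => b + t • v) (𝓝 0) (𝓝 (b + (0 : ℝ) • v)) :=
        (by fun_prop : Continuous fun t : ℝ => b + t • v).tendsto 0
      rw [zero_smul, add_zero] at hc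
      have h1 := hc.eventually (mem_interior_iff_mem_nhds.mp hb)
      obtain ⟨δ, hδ, hball⟩ := Metric.eventually_nhds_iff.mp h1
      have h2 : b + (δ / 2) • v ∈ B := hball (by
        rw [dist_zero_right, Real.norm_eq_abs, abs_of_pos (by positivity)]; linarith)
      have h3 : b + (δ / 2) • v ∈ Submodule.span ℝ (B ∩ (X : Set E)) :=
        Submodule.subset_span ⟨h2, X.add_mem hbX (X.smul_mem _ hv)⟩
      have h4 : b ∈ Submodule.span ℝ (B ∩ (X : Set E)) :=
        Submodule.subset_span ⟨interior_subset hb, hbX⟩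
      have h5 : v = (δ / 2)⁻¹ • ((b + (δ / 2) • v) - b) := by
        rw [add_sub_cancel_left, smul_smul, inv_mul_cancel₀ (by positivity), one_smul]
      rw [h5]
      exact Submodule.smul_mem _ _ (Submodule.sub_mem _ h3 h4)
  obtain ⟨L, -⟩ := hsec X Y hX hY
  have h6 := L.finrank_eq
  rw [hXs, hX] at h6
  apply Submodule.eq_of_le_of_finrank_eq
  · rw [Submodule.span_le]; exact Set.inter_subset_right
  · rw [← h6, hY]

theorem sec_eqv {B : Set E} (hE : Module.finrank ℝ E = 4) (hBint : (interior B).Nonempty)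
    (hsec : ∀ X Y : Submodule ℝ E, Module.finrank ℝ X = 3 → Module.finrank ℝ Y = 3 →
      LinearlyEquivalent (B ∩ (X : Set E)) (B ∩ (Y : Set E)))
    (T T' : V3 →L[ℝ] E) (hT : Function.Injective T) (hT' : Function.Injective T') :
    ∃ g : V3 ≃L[ℝ] V3, ∀ x, T x ∈ B ↔ T' (g x) ∈ B := by
  have hr : ∀ S : V3 →L[ℝ] E, Function.Injective S →
      Module.finrank ℝ (LinearMap.range (S : V3 →ₗ[ℝ] E)) = 3 := by
    intro S hS
    have h1 := LinearMap.finrank_range_of_inj (f := (S : V3 →ₗ[ℝ] E)) hS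
    rw [h1]; simp [V3]
  obtain ⟨L, hL⟩ := hsec _ _ (hr T hT) (hr T' hT')
  have hs1 := sec_span hE hBint hsec _ (hr T hT)
  have hs2 := sec_span hE hBint hsec _ (hr T' hT')
  let e1 := LinearEquiv.ofInjective (T : V3 →ₗ[ℝ] E) hT
  let e2 := LinearEquiv.ofInjective (T' : V3 →ₗ[ℝ] E) hT'
  let G : V3 ≃ₗ[ℝ] V3 := e1.trans ((LinearEquiv.ofEq _ _ hs1.symm).trans
    (L.trans ((LinearEquiv.ofEq _ _ hs2).trans e2.symm)))
  have hG : ∀ x, T' (G x) = (L ((LinearEquiv.ofEq _ _ hs1.symm) (e1 x)) : E) := by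
    intro x
    have h1 : e2 (G x) = (LinearEquiv.ofEq _ _ hs2) (L ((LinearEquiv.ofEq _ _ hs1.symm) (e1 x))) :=
      e2.apply_symm_apply _
    exact congrArg Subtype.val h1
  refine ⟨G.toContinuousLinearEquiv, fun x => ?_⟩
  change T x ∈ B ↔ T' (G x) ∈ B
  let w := (LinearEquiv.ofEq _ _ hs1.symm) (e1 x)
  have hw : (w : E) = T x := rfl
  have hG' : T' (G x) = (L w : E) := hG x
  rw [hG']
  constructor
  · intro hx
    have h1 : (L w : E) ∈ B ∩ (LinearMap.range (T' : V3 →ₗ[ℝ] E) : Set E) := by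
      exact hL.subset ⟨w, ⟨hx, ⟨x, rfl⟩⟩, rfl⟩
    exact h1.1
  · intro hx
    have h1 : (L w : E) ∈ B ∩ (LinearMap.range (T' : V3 →ₗ[ℝ] E) : Set E) :=
      ⟨hx, ⟨G x, hG' ⟩⟩
    obtain ⟨w', hw', he⟩ := hL.superset h1
    have h2 : w' = w := L.injective (Subtype.ext he)
    rw [h2] at hw'
    exact hw'.1

theorem sec_hy {B : Set E} (hE : Module.finrank ℝ E = 4) (hBcomp : IsCompact B) (hBconv : Convex ℝ B)
    (hBint : (interior B).Nonempty)
    (hsec : ∀ X Y : Submodule ℝ E, Module.finrank ℝ X = 3 → Module.finrank ℝ Y = 3 →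
      LinearlyEquivalent (B ∩ (X : Set E)) (B ∩ (Y : Set E))) : Hy B := by
  refine ⟨hE, hBcomp, hBconv, hBint, fun T T' hT hT' => sec_eqv hE hBint hsec T T' hT hT', ?_⟩
  intro T hT
  have hr : Module.finrank ℝ (LinearMap.range (T : V3 →ₗ[ℝ] E)) = 3 := by
    have h1 := LinearMap.finrank_range_of_inj (f := (T : V3 →ₗ[ℝ] E)) hT
    rw [h1]; simp [V3]
  have hs := sec_span hE hBint hsec _ hr
  have h2 : (T : V3 →ₗ[ℝ] E) '' {x | T x ∈ B} = B ∩ (LinearMap.range (T : V3 →ₗ[ℝ] E) : Set E) := by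
    ext y
    constructor
    · rintro ⟨x, hx, rfl⟩
      exact ⟨hx, ⟨x, rfl⟩⟩
    · rintro ⟨hy, ⟨x, rfl⟩⟩
      exact ⟨x, hy, rfl⟩
  rw [← h2, ← Submodule.map_span] at hs
  rw [eq_top_iff]
  intro x _
  have h3 : (T : V3 →ₗ[ℝ] E) x ∈ Submodule.map (T : V3 →ₗ[ℝ] E) (Submodule.span ℝ {x | T x ∈ B}) := by
    rw [hs]; exact ⟨x, rfl⟩
  obtain ⟨y, hy, he⟩ := h3
  have h4 : y = x := hT he
  rw [← h4]; exact hy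

theorem Hy.ban {B : Set E} (h : Hy B) : Ban (gauge B) := by
  have h0 : B ∈ 𝓝 (0 : E) := mem_interior_iff_mem_nhds.mp h.zero_int
  have hab : Absorbent ℝ B := absorbent_nhds_zero h0
  refine ⟨⟨gauge_add_le h.hv hab, ?_, ?_, continuous_gauge h.hv h0⟩, ?_⟩
  · intro t x ht
    rw [gauge_smul_of_nonneg ht, smul_eq_mul]
  · intro x hx
    exact (gauge_pos hab (NormedSpace.isVonNBounded_of_isBounded ℝ h.hc.isBounded)).mpr hx
  · intro T T' hT hT'
    obtain ⟨g, hg⟩ := h.heq T T' hT hT'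
    refine ⟨g, fun x => ?_⟩
    rw [gauge_def', gauge_def']
    congr 1
    ext r
    have : r⁻¹ • T' (g x) ∈ B ↔ r⁻¹ • T x ∈ B := by
      rw [← map_smul, ← map_smul, ← map_smul]
      exact (hg _).symm
    exact and_congr_right fun _ => this

theorem Hy.ell {B : Set E} (h : Hy B) : IsEllipsoid B := by
  have h0 : B ∈ 𝓝 (0 : E) := mem_interior_iff_mem_nhds.mp h.zero_int
  obtain ⟨f, hf1, hf2⟩ := quad_global h.ban h.hE
  refine ⟨f, hf1, ?_, ?_⟩
  · intro x hx
    rw [hf2]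
    have := h.ban.sl.pos x hx
    positivity
  · ext x
    change x ∈ B ↔ f x x ≤ 1
    rw [hf2, sq_le_one_iff₀ (gauge_nonneg x), gauge_le_one_iff_mem_closure h.hv h0,
      h.hc.isClosed.closure_eq]
end assemble

/-- **Main theorem (Banach's conjecture for `n = 3`).** If `B ⊂ ℝ⁴` is a convex body all of
whose intersections with 3-dimensional linear subspaces are linearly equivalent to one another,
then `B` is an ellipsoid centered at `0`. -/
theorem main_theorem
    (B : Set (EuclideanSpace ℝ (Fin 4)))
    (hBcomp : IsCompact B) (hBconv : Convex ℝ B) (hBint : (interior B).Nonempty)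
    (hsec : ∀ X Y : Submodule ℝ (EuclideanSpace ℝ (Fin 4)),
      Module.finrank ℝ X = 3 → Module.finrank ℝ Y = 3 →
      LinearlyEquivalent (B ∩ (X : Set (EuclideanSpace ℝ (Fin 4))))
        (B ∩ (Y : Set (EuclideanSpace ℝ (Fin 4))))) :
    IsEllipsoid B := by
  have hE : Module.finrank ℝ (EuclideanSpace ℝ (Fin 4)) = 4 := by simp
  exact (sec_hy hE hBcomp hBconv hBint hsec).ell
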